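/- arXiv:2201.12840 — 2 statements merged into one kernel-verified Lean document; each statement's English description precedes it below -/
import Mathlib

section
/- Fix N > 1 and let q be an integer with 1 ≤ q ≤ N^{d/(d+1)} and q ≡ 0 (mod 4). Let a, b be integers with 1 ≤ a, b < q, b even, and gcd(a,q) = 1. Then for all x ∈ 𝕋 with |x - b/q| ≤ 1/(100N) and all t with |t - a/q| ≤ 1/(100N²), one has |∑_{n=1}^N e^{2πi(nx + n²t)}| ≥ c · N/q^{1/2} for an absolute constant c > 0. -/
open Real Finset

/-- The one-dimensional quadratic Weyl sum `∑_{n=1}^N e^{2πi(nx + n²t)}`. -/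
noncomputable def wSum1 (N : ℕ) (x t : ℝ) : ℂ :=
  ∑ n ∈ Finset.Icc 1 N,
    Complex.exp (2 * Real.pi * Complex.I * (((n : ℝ) * x + (n : ℝ) ^ 2 * t : ℝ) : ℂ))

theorem integrable_exp_neg_mul_abs {b : ℝ} (hb : 0 < b) :
    MeasureTheory.Integrable (fun x : ℝ => Real.exp (-b * |x|)) := by
  have h := integrable_of_isBigO_exp_neg (f := fun x : ℝ => Real.exp (-b * |x|)) (a := 0) hb
    (by fun_prop) (by
      refine Asymptotics.IsBigO.of_bound 1 ?_
      filter_upwards [Filter.eventually_ge_atTop 0] with x hx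
      simp [abs_of_nonneg hx])
  rw [← MeasureTheory.integrableOn_univ, ← Set.Iic_union_Ioi (a := (0 : ℝ))]
  refine MeasureTheory.IntegrableOn.union ?_ h
  rw [integrableOn_Iic_iff_integrableOn_Iio]
  have h2 := h.comp_neg
  simpa using h2

theorem half_exp_abs_le_cosh (x : ℝ) : Real.exp |x| / 2 ≤ Real.cosh x := by
  rw [← Real.cosh_abs, Real.cosh_eq]
  have := Real.exp_pos (-|x|)
  linarith

theorem sinh_abs_le_norm_cosh (x y : ℝ) :
    Real.sinh |x| ≤ ‖Complex.cosh (x + y * Complex.I)‖ := by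
  have e : Complex.cosh (x + y * Complex.I)
      = ((Real.cosh x * Real.cos y : ℝ) : ℂ) + ((Real.sinh x * Real.sin y : ℝ) : ℂ) * Complex.I := by
    rw [Complex.cosh_add, Complex.cosh_mul_I, Complex.sinh_mul_I]; push_cast; ring
  have hs : 0 ≤ Real.sinh |x| := Real.sinh_nonneg_iff.2 (abs_nonneg x)
  rw [e, Complex.norm_add_mul_I]
  apply Real.le_sqrt_of_sq_le
  have h1 : Real.sinh |x| ^ 2 = Real.sinh x ^ 2 := by
    rcases abs_choice x with h | h <;> rw [h]
    rw [Real.sinh_neg]; ring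
  rw [h1]
  have h2 := Real.cosh_sq x
  have h3 := Real.sin_sq_add_cos_sq y
  nlinarith [sq_nonneg (Real.cos y)]

/-- The integrals of a holomorphic function along the two sides of the strip agree. -/
theorem integral_eq_integral_add_I {D : ℂ → ℂ} {B : ℝ → ℝ}
    (hD : DifferentiableOn ℂ D {z | 0 ≤ z.im ∧ z.im ≤ 1})
    (h0 : MeasureTheory.Integrable (fun x : ℝ => D x))
    (h1 : MeasureTheory.Integrable (fun x : ℝ => D (x + Complex.I)))
    (hB : ∀ᶠ x : ℝ in Filter.atTop, ∀ y ∈ Set.Icc (0 : ℝ) 1,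
      ‖D (x + y * Complex.I)‖ ≤ B x ∧ ‖D ((-x : ℝ) + y * Complex.I)‖ ≤ B x)
    (hlim : Filter.Tendsto B Filter.atTop (nhds 0)) :
    ∫ x : ℝ, D x = ∫ x : ℝ, D (x + Complex.I) := by
  have key : ∀ R : ℝ, (∫ x in (-R)..R, D x) - ∫ x in (-R)..R, D (x + Complex.I)
      = Complex.I • (∫ y in (0:ℝ)..1, D ((-R : ℝ) + y * Complex.I)) -
        Complex.I • (∫ y in (0:ℝ)..1, D (R + y * Complex.I)) := by
    intro R
    have := Complex.integral_boundary_rect_eq_zero_of_differentiableOn D (-R : ℝ) (R + Complex.I)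
      (hD.mono (by
        intro z hz
        rw [Complex.mem_reProdIm] at hz
        simpa using hz.2))
    simp only [Complex.ofReal_re, Complex.ofReal_im, Complex.add_re, Complex.add_im, Complex.I_re,
      Complex.I_im, add_zero, zero_add, Complex.ofReal_zero, Complex.ofReal_one, zero_mul,
      one_mul] at this
    linear_combination this
  have t0 := MeasureTheory.intervalIntegral_tendsto_integral h0 Filter.tendsto_neg_atTop_atBot
    Filter.tendsto_id
  have t1 := MeasureTheory.intervalIntegral_tendsto_integral h1 Filter.tendsto_neg_atTop_atBot
    Filter.tendsto_id
  have t2 := t0.sub t1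
  have t3 : Filter.Tendsto (fun R : ℝ => (∫ x in (-R)..R, D x) - ∫ x in (-R)..R, D (x + Complex.I))
      Filter.atTop (nhds 0) := by
    apply squeeze_zero_norm' (a := fun x => B x + B x)
    · filter_upwards [hB] with R hR
      rw [key]
      refine (norm_sub_le _ _).trans ?_
      rw [norm_smul, norm_smul, Complex.norm_I, one_mul, one_mul]
      gcongr
      · have := intervalIntegral.norm_integral_le_of_norm_le_const (a := (0:ℝ)) (b := 1) (C := B R)
          (f := fun y : ℝ => D ((-R : ℝ) + y * Complex.I)) (by
            intro y hy
            rw [Set.uIoc_of_le zero_le_one] at hy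
            exact (hR y ⟨hy.1.le, hy.2⟩).2)
        simpa using this
      · have := intervalIntegral.norm_integral_le_of_norm_le_const (a := (0:ℝ)) (b := 1) (C := B R)
          (f := fun y : ℝ => D (R + y * Complex.I)) (by
            intro y hy
            rw [Set.uIoc_of_le zero_le_one] at hy
            exact (hR y ⟨hy.1.le, hy.2⟩).1)
        simpa using this
    · simpa using hlim.add hlim
  exact sub_eq_zero.1 (tendsto_nhds_unique t2 t3)

theorem integral_inv_cosh : ∫ x : ℝ, 1 / Real.cosh (π * x) = 1 := by
  have hd : ∀ x : ℝ, HasDerivAt (fun x => 2 / π * Real.arctan (Real.exp (π * x)))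
      (1 / Real.cosh (π * x)) x := by
    intro x
    have h1 : HasDerivAt (fun x : ℝ => Real.exp (π * x)) (Real.exp (π * x) * π) x := by
      simpa using ((hasDerivAt_id x).const_mul π).exp
    have := (h1.arctan).const_mul (2 / π)
    refine this.congr_deriv ?_
    rw [Real.cosh_eq, Real.exp_neg]
    have := Real.exp_pos (π * x)
    have := Real.pi_pos
    field_simp
    ring
  have hint : MeasureTheory.Integrable (fun x : ℝ => 1 / Real.cosh (π * x)) := by
    refine ((integrable_exp_neg_mul_abs Real.pi_pos).const_mul 2).mono'
      (Continuous.aestronglyMeasurable (Continuous.div (by fun_prop) (by fun_prop)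
        (fun x => (Real.cosh_pos _).ne'))) (Filter.Eventually.of_forall fun x => ?_)
    rw [Real.norm_of_nonneg (by have := Real.cosh_pos (π * x); positivity),
      div_le_iff₀ (Real.cosh_pos _)]
    have h := half_exp_abs_le_cosh (π * x)
    rw [abs_mul, abs_of_pos Real.pi_pos] at h
    have e : Real.exp (-π * |x|) * Real.exp (π * |x|) = 1 := by
      rw [← Real.exp_add]; simp
    nlinarith [Real.exp_pos (-π * |x|)]
  have hb : Filter.Tendsto (fun x : ℝ => π * x) Filter.atBot Filter.atBot :=
    Filter.tendsto_id.const_mul_atBot Real.pi_pos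
  have ht : Filter.Tendsto (fun x : ℝ => π * x) Filter.atTop Filter.atTop :=
    Filter.tendsto_id.const_mul_atTop Real.pi_pos
  have l1 : Filter.Tendsto (fun x => 2 / π * Real.arctan (Real.exp (π * x))) Filter.atBot
      (nhds (2 / π * Real.arctan 0)) :=
    ((Real.continuous_arctan.tendsto 0).comp (Real.tendsto_exp_atBot.comp hb)).const_mul _
  have l2 : Filter.Tendsto (fun x => 2 / π * Real.arctan (Real.exp (π * x))) Filter.atTop
      (nhds (2 / π * (π / 2))) :=
    (((Real.tendsto_arctan_atTop.mono_right nhdsWithin_le_nhds).comp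
      (Real.tendsto_exp_atTop.comp ht))).const_mul _
  rw [MeasureTheory.integral_of_hasDerivAt_of_tendsto hd hint l1 l2]
  have := Real.pi_pos
  simp

theorem cosh_pi_mul_ne_zero {w : ℂ} (h0 : 0 ≤ w.im) (h1 : w.im ≤ 1) (hw : w ≠ Complex.I / 2) :
    Complex.cosh (π * w) ≠ 0 := by
  intro h
  have e : (π * w : ℂ) = ((π * w.re : ℝ) : ℂ) + ((π * w.im : ℝ) : ℂ) * Complex.I := by
    conv_lhs => rw [← Complex.re_add_im w]
    push_cast; ring
  have h2 := sinh_abs_le_norm_cosh (π * w.re) (π * w.im)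
  rw [← e, h, norm_zero] at h2
  have h3 : |π * w.re| ≤ 0 := Real.sinh_nonpos_iff.1 h2
  have h4 : w.re = 0 := by
    have := abs_nonpos_iff.1 h3
    rcases mul_eq_zero.1 this with h | h
    · exact absurd h Real.pi_ne_zero
    · exact h
  rw [e, h4] at h
  simp only [mul_zero, Complex.ofReal_zero, zero_add, Complex.cosh_mul_I] at h
  rw [← Complex.ofReal_cos, Complex.ofReal_eq_zero] at h
  have h5 : w.im = 1 / 2 := by
    have i1 : Real.cos (π * w.im) = Real.cos (π / 2) := by rw [h, Real.cos_pi_div_two]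
    have := Real.injOn_cos ⟨by have := Real.pi_pos; positivity, by nlinarith [Real.pi_pos]⟩
      ⟨by have := Real.pi_pos; positivity, by linarith [Real.pi_pos]⟩ i1
    have := Real.pi_pos
    field_simp at *
    linarith
  apply hw
  apply Complex.ext <;> simp [h4, h5]

theorem sinh_ge_exp {x : ℝ} (hx : 1 ≤ x) : Real.exp x / 4 ≤ Real.sinh x := by
  rw [Real.sinh_eq]
  have h1 : Real.exp (-x) ≤ 1 / 2 := by
    rw [Real.exp_neg, inv_le_comm₀ (Real.exp_pos _) (by norm_num)]
    have := Real.add_one_le_exp x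
    norm_num; linarith
  have := Real.add_one_le_exp x
  linarith

/-- Residue theorem for `f / cosh (π z)` on the strip `0 ≤ im z ≤ 1`. -/
theorem integral_div_cosh_add {f : ℂ → ℂ} (hf : Differentiable ℂ f) {A θ : ℝ} (h0 : 0 ≤ θ)
    (h1 : θ < 1) (hA : ∀ x : ℝ, ∀ y ∈ Set.Icc (0 : ℝ) 1,
      ‖f (x + y * Complex.I)‖ ≤ A * Real.exp (θ * (π * |x|))) :
    ∫ x : ℝ, (f x + f (x + Complex.I)) / Complex.cosh (π * x) = 2 * f (Complex.I / 2) := by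
  set c : ℂ := Complex.I / 2 with hc
  set S : Set ℂ := {z | 0 ≤ z.im ∧ z.im ≤ 1} with hS
  have hcosh : Differentiable ℂ (fun w : ℂ => Complex.cosh (π * w)) :=
    Complex.differentiable_cosh.comp (by fun_prop)
  have hcc : Complex.cosh (π * c) = 0 := by
    have : (π * c : ℂ) = ((π / 2 : ℝ) : ℂ) * Complex.I := by rw [hc]; push_cast; ring
    rw [this, Complex.cosh_mul_I, ← Complex.ofReal_cos, Real.cos_pi_div_two, Complex.ofReal_zero]
  have hshift : ∀ w : ℂ, Complex.cosh (π * (w + Complex.I)) = -Complex.cosh (π * w) := by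
    intro w
    rw [mul_add, Complex.cosh_add, Complex.cosh_mul_I, Complex.sinh_mul_I]
    simp
  have hA0 : 0 ≤ A := by
    have := hA 0 0 (by simp)
    simp only [abs_zero, mul_zero, Real.exp_zero, mul_one] at this
    exact (norm_nonneg _).trans this
  set D : ℂ → ℂ := fun w => dslope f c w / dslope (fun w : ℂ => Complex.cosh (π * w)) c w with hDdef
  have hDeq : ∀ w, w ≠ c → D w = (f w - f c) / Complex.cosh (π * w) := by
    intro w hw
    have : w - c ≠ 0 := sub_ne_zero.2 hw
    simp only [hDdef]
    rw [dslope_of_ne _ hw, dslope_of_ne _ hw, slope_def_field, slope_def_field, hcc, sub_zero,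
      div_div_div_cancel_right₀ this]
  have hDdiff : DifferentiableOn ℂ D S := by
    have d1 : DifferentiableOn ℂ (dslope f c) Set.univ :=
      (Complex.differentiableOn_dslope Filter.univ_mem).2 hf.differentiableOn
    have d2 : DifferentiableOn ℂ (dslope (fun w : ℂ => Complex.cosh (π * w)) c) Set.univ :=
      (Complex.differentiableOn_dslope Filter.univ_mem).2 hcosh.differentiableOn
    refine (d1.mono (Set.subset_univ _)).div (d2.mono (Set.subset_univ _)) ?_
    intro w hw
    by_cases hwc : w = c
    · rw [hwc, dslope_same]
      have hd : HasDerivAt (fun w : ℂ => Complex.cosh (π * w)) (Complex.sinh (π * c) * π) c := by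
        simpa using ((hasDerivAt_id c).const_mul (π : ℂ)).ccosh
      rw [hd.deriv]
      have : (π * c : ℂ) = ((π / 2 : ℝ) : ℂ) * Complex.I := by rw [hc]; push_cast; ring
      rw [this, Complex.sinh_mul_I, ← Complex.ofReal_sin, Real.sin_pi_div_two]
      simp [Real.pi_ne_zero]
    · rw [dslope_of_ne _ hwc, slope_def_field, hcc, sub_zero]
      exact div_ne_zero (cosh_pi_mul_ne_zero hw.1 hw.2 hwc) (sub_ne_zero.2 hwc)
  have hne0 : ∀ x : ℝ, (x : ℂ) ≠ c := fun x h => by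
    have := congrArg Complex.im h
    simp [hc] at this
  have hne1 : ∀ x : ℝ, (x : ℂ) + Complex.I ≠ c := fun x h => by
    have := congrArg Complex.im h
    simp [hc] at this
  have hmeas0 : Continuous fun x : ℝ => D x := by
    have : (fun x : ℝ => D x) = fun x : ℝ => (f x - f c) / Complex.cosh (π * x) :=
      funext fun x => hDeq _ (hne0 x)
    rw [this]
    refine Continuous.div ?_ ?_ ?_
    · exact (hf.continuous.comp Complex.continuous_ofReal).sub continuous_const
    · exact hcosh.continuous.comp Complex.continuous_ofReal
    · intro x; exact cosh_pi_mul_ne_zero (by simp) (by simp) (hne0 x)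
  have hmeas1 : Continuous fun x : ℝ => D (x + Complex.I) := by
    have : (fun x : ℝ => D (x + Complex.I)) =
        fun x : ℝ => (f (x + Complex.I) - f c) / Complex.cosh (π * (x + Complex.I)) :=
      funext fun x => hDeq _ (hne1 x)
    rw [this]
    refine Continuous.div ?_ ?_ ?_
    · exact (hf.continuous.comp (by fun_prop)).sub continuous_const
    · exact hcosh.continuous.comp (by fun_prop)
    · intro x; exact cosh_pi_mul_ne_zero (by simp) (by simp) (hne1 x)
  have hcr : ∀ x : ℝ, Complex.cosh (π * x) = (Real.cosh (π * x) : ℂ) := by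
    intro x; push_cast; rfl
  have hcoshlow : ∀ x : ℝ, Real.exp (π * |x|) / 2 ≤ Real.cosh (π * x) := by
    intro x
    have h := half_exp_abs_le_cosh (π * x)
    rwa [abs_mul, abs_of_pos Real.pi_pos] at h
  have hnum : ∀ x : ℝ, ∀ y ∈ Set.Icc (0 : ℝ) 1,
      ‖f (x + y * Complex.I) - f c‖ ≤ (A + ‖f c‖) * Real.exp (θ * (π * |x|)) := by
    intro x y hy
    refine (norm_sub_le _ _).trans ?_
    have i1 := hA x y hy
    have i2 : 1 ≤ Real.exp (θ * (π * |x|)) := Real.one_le_exp (by have := Real.pi_pos; positivity)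
    nlinarith [norm_nonneg (f c)]
  have hfrac : ∀ x K : ℝ, 0 < K → ∀ n C : ℂ, ‖n‖ ≤ (A + ‖f c‖) * Real.exp (θ * (π * |x|)) →
      Real.exp (π * |x|) / K ≤ ‖C‖ →
      ‖n / C‖ ≤ K * (A + ‖f c‖) * Real.exp (-((1 - θ) * π) * |x|) := by
    intro x K hK n C hn hC
    have hCpos : 0 < ‖C‖ := lt_of_lt_of_le (by positivity) hC
    rw [norm_div, div_le_iff₀ hCpos]
    refine hn.trans ?_
    have e : Real.exp (θ * (π * |x|)) = Real.exp (-((1 - θ) * π) * |x|) * Real.exp (π * |x|) := by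
      rw [← Real.exp_add]; ring_nf
    rw [e]
    rw [div_le_iff₀ hK] at hC
    have p1 : 0 ≤ (A + ‖f c‖) * Real.exp (-((1 - θ) * π) * |x|) := by positivity
    nlinarith
  have hrate : 0 < (1 - θ) * π := mul_pos (by linarith) Real.pi_pos
  have hint := (integrable_exp_neg_mul_abs hrate).const_mul (2 * (A + ‖f c‖))
  have I0 : MeasureTheory.Integrable (fun x : ℝ => D x) := by
    refine hint.mono' hmeas0.aestronglyMeasurable (Filter.Eventually.of_forall fun x => ?_)
    rw [hDeq _ (hne0 x)]
    refine hfrac x 2 two_pos _ _ (by simpa using hnum x 0 (by simp)) ?_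
    rw [hcr, Complex.norm_real, Real.norm_of_nonneg (Real.cosh_pos _).le]
    exact hcoshlow x
  have I1 : MeasureTheory.Integrable (fun x : ℝ => D (x + Complex.I)) := by
    refine hint.mono' hmeas1.aestronglyMeasurable (Filter.Eventually.of_forall fun x => ?_)
    rw [hDeq _ (hne1 x)]
    refine hfrac x 2 two_pos _ _ (by simpa using hnum x 1 (by simp)) ?_
    rw [hshift, norm_neg, hcr, Complex.norm_real, Real.norm_of_nonneg (Real.cosh_pos _).le]
    exact hcoshlow x
  have hB : ∀ᶠ x : ℝ in Filter.atTop, ∀ y ∈ Set.Icc (0 : ℝ) 1,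
      ‖D (x + y * Complex.I)‖ ≤ 4 * (A + ‖f c‖) * Real.exp (-((1 - θ) * π) * x) ∧
      ‖D ((-x : ℝ) + y * Complex.I)‖ ≤ 4 * (A + ‖f c‖) * Real.exp (-((1 - θ) * π) * x) := by
    filter_upwards [Filter.eventually_ge_atTop 1] with x hx y hy
    have aux : ∀ t : ℝ, |t| = x → ‖D (t + y * Complex.I)‖ ≤
        4 * (A + ‖f c‖) * Real.exp (-((1 - θ) * π) * x) := by
      intro t ht
      have hne : (t : ℂ) + y * Complex.I ≠ c := by
        intro h
        have := congrArg Complex.re h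
        simp [hc] at this
        rw [this] at ht
        simp at ht; linarith
      rw [hDeq _ hne, ← ht]
      refine hfrac t 4 (by norm_num) _ _ (hnum t y hy) ?_
      have e : (π * (t + y * Complex.I) : ℂ) = ((π * t : ℝ) : ℂ) + ((π * y : ℝ) : ℂ) * Complex.I := by
        push_cast; ring
      rw [e]
      refine le_trans ?_ (sinh_abs_le_norm_cosh _ _)
      rw [abs_mul, abs_of_pos Real.pi_pos]
      apply sinh_ge_exp
      rw [ht]
      nlinarith [Real.pi_gt_three]
    exact ⟨aux x (abs_of_nonneg (by linarith)), aux (-x) (by rw [abs_neg, abs_of_nonneg (by linarith)])⟩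
  have hlim : Filter.Tendsto (fun x : ℝ => 4 * (A + ‖f c‖) * Real.exp (-((1 - θ) * π) * x))
      Filter.atTop (nhds 0) := by
    have : Filter.Tendsto (fun x : ℝ => -((1 - θ) * π) * x) Filter.atTop Filter.atBot :=
      Filter.tendsto_id.const_mul_atTop_of_neg (by linarith)
    simpa using (Real.tendsto_exp_atBot.comp this).const_mul (4 * (A + ‖f c‖))
  have main := integral_eq_integral_add_I hDdiff I0 I1 hB hlim
  have hsech : ∫ x : ℝ, (1 / Complex.cosh (π * x) : ℂ) = 1 := by
    have := congrArg (fun r : ℝ => (r : ℂ)) integral_inv_cosh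
    rw [← integral_complex_ofReal] at this
    simpa using this
  have hsechI : MeasureTheory.Integrable fun x : ℝ => (1 / Complex.cosh (π * x) : ℂ) := by
    by_contra h
    rw [MeasureTheory.integral_undef h] at hsech
    exact zero_ne_one hsech
  have e2 : (fun x : ℝ => (f x + f (x + Complex.I)) / Complex.cosh (π * x)) =
      fun x : ℝ => (D x - D (x + Complex.I)) + 2 * f c * (1 / Complex.cosh (π * x)) := by
    funext x
    rw [hDeq _ (hne0 x), hDeq _ (hne1 x), hshift]
    have := cosh_pi_mul_ne_zero (w := x) (by simp) (by simp) (hne0 x)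
    field_simp
    ring
  have I01 : MeasureTheory.Integrable (fun x : ℝ => D x - D (x + Complex.I)) := I0.sub I1
  rw [e2, MeasureTheory.integral_add I01 (hsechI.const_mul _),
    MeasureTheory.integral_sub I0 I1, main, MeasureTheory.integral_const_mul, hsech]
  ring

theorem integral_exp_div_cosh {σ : ℝ} (hσ : |σ| < 1 / 2) :
    ∫ x : ℝ, Real.exp (-2 * π * σ * x) / Real.cosh (π * x) = 1 / Real.cos (π * σ) := by
  have hcos : 0 < Real.cos (π * σ) := by
    apply Real.cos_pos_of_mem_Ioo
    have := abs_lt.1 hσ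
    constructor <;> nlinarith [Real.pi_pos]
  have key := integral_div_cosh_add (f := fun w => Complex.exp (-2 * π * σ * w)) (by fun_prop)
    (A := 1) (θ := 2 * |σ|) (by positivity) (by linarith) (by
      intro x y _
      rw [Complex.norm_exp, one_mul]
      apply Real.exp_le_exp.2
      have : (-2 * π * σ * (x + y * Complex.I) : ℂ).re = -2 * π * σ * x := by
        simp
      rw [this]
      have h1 : -(σ * x) ≤ |σ| * |x| := by rw [← abs_mul]; exact neg_le_abs _
      nlinarith [Real.pi_pos])
  have e : ∀ x : ℝ, (Complex.exp (-2 * π * σ * x) + Complex.exp (-2 * π * σ * (x + Complex.I)))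
      / Complex.cosh (π * x) = (2 * Real.cos (π * σ) : ℝ) * Complex.exp (-(π * σ * Complex.I)) *
        ((Real.exp (-2 * π * σ * x) / Real.cosh (π * x) : ℝ) : ℂ) := by
    intro x
    push_cast
    rw [Complex.two_cos]
    rw [mul_add, Complex.exp_add]
    rw [show (-2 * π * σ * Complex.I : ℂ) = -(π * σ * Complex.I) + -(π * σ * Complex.I) by ring,
      Complex.exp_add]
    have h : Complex.exp (-(π * σ * Complex.I)) * Complex.exp (π * σ * Complex.I) = 1 := by
      rw [← Complex.exp_add]; simp
    have h2 : Complex.exp (-(π * σ) * Complex.I) = Complex.exp (-(π * σ * Complex.I)) := by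
      ring_nf
    rw [h2]
    linear_combination (-(Complex.exp (-2 * π * σ * x) / Complex.cosh (π * x))) * h
  simp only [e] at key
  rw [MeasureTheory.integral_const_mul, integral_complex_ofReal] at key
  have h3 : Complex.exp (-2 * π * σ * (Complex.I / 2)) = Complex.exp (-(π * σ * Complex.I)) := by
    ring_nf
  rw [h3] at key
  have h4 : (((2 * Real.cos (π * σ)) * ∫ x : ℝ, Real.exp (-2 * π * σ * x) / Real.cosh (π * x) : ℝ)
      : ℂ) = ((2 : ℝ) : ℂ) := by
    apply mul_right_cancel₀ (Complex.exp_ne_zero (-(π * σ * Complex.I)))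
    push_cast at key ⊢
    linear_combination key
  have h5 := Complex.ofReal_injective h4
  rw [eq_div_iff hcos.ne']
  linarith

theorem integrable_exp_div_cosh {σ : ℝ} (hσ : |σ| < 1 / 2) :
    MeasureTheory.Integrable fun x : ℝ => Real.exp (-2 * π * σ * x) / Real.cosh (π * x) := by
  by_contra h
  have := integral_exp_div_cosh hσ
  rw [MeasureTheory.integral_undef h] at this
  have hcos : 0 < Real.cos (π * σ) := by
    apply Real.cos_pos_of_mem_Ioo
    have := abs_lt.1 hσ
    constructor <;> nlinarith [Real.pi_pos]
  have h2 : 0 < 1 / Real.cos (π * σ) := by positivity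
  linarith

/-- The Mordell integral. -/
noncomputable def mordell (τ z : ℂ) : ℂ :=
  ∫ x : ℝ, Complex.exp (π * Complex.I * τ * x ^ 2 - 2 * π * z * x) / Complex.cosh (π * x)

theorem cosh_ofReal_ne_zero (x : ℝ) : Complex.cosh (π * x) ≠ 0 := by
  have : Complex.cosh (π * x) = (Real.cosh (π * x) : ℂ) := by push_cast; rfl
  rw [this]
  exact_mod_cast (Real.cosh_pos _).ne'

theorem norm_cosh_ofReal (x : ℝ) : ‖Complex.cosh (π * x)‖ = Real.cosh (π * x) := by
  have : Complex.cosh (π * x) = (Real.cosh (π * x) : ℂ) := by push_cast; rfl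
  rw [this, Complex.norm_real, Real.norm_of_nonneg (Real.cosh_pos _).le]

theorem integrable_gauss {τ : ℂ} (hτ : 0 < τ.im) (z : ℂ) :
    MeasureTheory.Integrable
      fun x : ℝ => Complex.exp (π * Complex.I * τ * x ^ 2 - 2 * π * z * x) := by
  have := integrable_cexp_quadratic' (b := π * Complex.I * τ) (by simp; nlinarith [Real.pi_pos])
    (-2 * π * z) 0
  convert this using 3
  ring

theorem integral_gauss {τ : ℂ} (hτ : 0 < τ.im) (z : ℂ) :
    ∫ x : ℝ, Complex.exp (π * Complex.I * τ * x ^ 2 - 2 * π * z * x) =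
      (Complex.I / τ) ^ (1 / 2 : ℂ) * Complex.exp (π * Complex.I * z ^ 2 / τ) := by
  have h := integral_cexp_quadratic (b := π * Complex.I * τ) (by simp; nlinarith [Real.pi_pos])
    (-2 * π * z) 0
  have hτ0 : τ ≠ 0 := fun h => by simp [h] at hτ
  have hpi : (π : ℂ) ≠ 0 := by exact_mod_cast Real.pi_ne_zero
  have e1 : (π : ℂ) / -(π * Complex.I * τ) = Complex.I / τ := by
    rw [div_eq_div_iff (by simp [hτ0]) hτ0]
    linear_combination (π * τ) * Complex.I_sq
  have e2 : (0 : ℂ) - (-2 * π * z) ^ 2 / (4 * (π * Complex.I * τ)) =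
      π * Complex.I * z ^ 2 / τ := by
    rw [zero_sub, ← neg_div, div_eq_div_iff (by simp [hτ0]) hτ0]
    linear_combination (-4 * π ^ 2 * z ^ 2 * τ) * Complex.I_sq
  rw [e1, e2] at h
  rw [← h]
  congr 1; ext x; congr 1; ring

theorem norm_gauss_le {τ : ℂ} (hτ : 0 < τ.im) (z : ℂ) (x : ℝ) :
    ‖Complex.exp (π * Complex.I * τ * x ^ 2 - 2 * π * z * x)‖ ≤ Real.exp (-2 * π * z.re * x) := by
  rw [Complex.norm_exp]
  apply Real.exp_le_exp.2
  have : (π * Complex.I * τ * x ^ 2 - 2 * π * z * x : ℂ).re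
      = -(π * τ.im * x ^ 2) - 2 * π * z.re * x := by
    simp [pow_two]
  rw [this]
  have : 0 ≤ π * τ.im * x ^ 2 := by have := Real.pi_pos; positivity
  linarith

theorem integrable_mordell {τ : ℂ} (hτ : 0 < τ.im) (z : ℂ) :
    MeasureTheory.Integrable fun x : ℝ =>
      Complex.exp (π * Complex.I * τ * x ^ 2 - 2 * π * z * x) / Complex.cosh (π * x) := by
  refine (integrable_gauss hτ z).mono (Continuous.aestronglyMeasurable ?_)
    (Filter.Eventually.of_forall fun x => ?_)
  · exact Continuous.div (by fun_prop) (Complex.continuous_cosh.comp (by fun_prop))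
      cosh_ofReal_ne_zero
  · rw [norm_div, norm_cosh_ofReal]
    exact div_le_self (norm_nonneg _) (Real.one_le_cosh _)

theorem norm_mordell_le {τ : ℂ} (hτ : 0 < τ.im) {z : ℂ} (hz : |z.re| < 1 / 2) :
    ‖mordell τ z‖ ≤ 1 / Real.cos (π * z.re) := by
  rw [← integral_exp_div_cosh hz]
  refine MeasureTheory.norm_integral_le_of_norm_le (integrable_exp_div_cosh hz)
    (Filter.Eventually.of_forall fun x => ?_)
  rw [norm_div, norm_cosh_ofReal]
  have := Real.cosh_pos (π * x)
  gcongr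
  exact norm_gauss_le hτ z x

theorem mordell_add_one {τ : ℂ} (hτ : 0 < τ.im) (z : ℂ) :
    mordell τ z + mordell τ (z + 1) = 2 * (Complex.I / τ) ^ (1 / 2 : ℂ) *
      Complex.exp (π * Complex.I * (z + 1 / 2) ^ 2 / τ) := by
  rw [mordell, mordell, ← MeasureTheory.integral_add (integrable_mordell hτ z)
    (integrable_mordell hτ _), mul_assoc (2 : ℂ) ((Complex.I / τ) ^ (1 / 2 : ℂ)), ← integral_gauss hτ, ← MeasureTheory.integral_const_mul]
  congr 1; ext x
  have h := cosh_ofReal_ne_zero x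
  rw [← add_div, div_eq_iff h]
  have h2 : 2 * Complex.cosh (π * x) = Complex.exp (π * x) + Complex.exp (-(π * x)) :=
    Complex.two_cosh _
  rw [show (2 : ℂ) * Complex.exp (π * Complex.I * τ * x ^ 2 - 2 * π * (z + 1 / 2) * x) *
    Complex.cosh (π * x) = Complex.exp (π * Complex.I * τ * x ^ 2 - 2 * π * (z + 1 / 2) * x) *
    (2 * Complex.cosh (π * x)) by ring, h2, mul_add (Complex.exp _), ← Complex.exp_add, ← Complex.exp_add]
  congr 2 <;> ring

theorem mordell_add_tau {τ : ℂ} (hτ : 0 < τ.im) (z : ℂ) :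
    mordell τ z + Complex.exp (-2 * π * Complex.I * z - π * Complex.I * τ) * mordell τ (z + τ) =
      2 * Complex.exp (-π * Complex.I * z - π * Complex.I * τ / 4) := by
  set B : ℝ := 2 * π * |τ.re| + 2 * π * |z.re| with hB
  have hπ := Real.pi_pos
  have key := integral_div_cosh_add
    (f := fun w => Complex.exp (π * Complex.I * τ * w ^ 2 - 2 * π * z * w)) (by fun_prop)
    (A := Real.exp (B ^ 2 / (4 * (π * τ.im)) + π * τ.im + 2 * π * |z.im|)) (θ := 0) le_rfl
    zero_lt_one (by
      intro x y hy
      rw [Complex.norm_exp, zero_mul, Real.exp_zero, mul_one]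
      apply Real.exp_le_exp.2
      have : (π * Complex.I * τ * (x + y * Complex.I) ^ 2 - 2 * π * z * (x + y * Complex.I) : ℂ).re
          = -(π * τ.im) * (x ^ 2 - y ^ 2) - 2 * π * τ.re * x * y - 2 * π * (z.re * x - z.im * y) := by
        simp [pow_two]
        ring
      rw [this]
      have a1 : -(π * τ.im) * x ^ 2 + B * |x| ≤ B ^ 2 / (4 * (π * τ.im)) := by
        rw [le_div_iff₀ (by positivity)]
        rw [← sq_abs x]
        nlinarith [sq_nonneg (2 * (π * τ.im) * |x| - B)]
      have a2 : π * τ.im * y ^ 2 ≤ π * τ.im := by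
        have : y ^ 2 ≤ 1 := by nlinarith [hy.1, hy.2]
        have : 0 < π * τ.im := by positivity
        nlinarith
      have a3 : -(τ.re * x * y) ≤ |τ.re| * |x| := by
        calc -(τ.re * x * y) ≤ |τ.re * x * y| := neg_le_abs _
          _ = |τ.re| * |x| * |y| := by rw [abs_mul, abs_mul]
          _ ≤ |τ.re| * |x| * 1 := by
            gcongr; rw [abs_of_nonneg hy.1]; exact hy.2
          _ = _ := mul_one _
      have a4 : -(z.re * x) ≤ |z.re| * |x| := by rw [← abs_mul]; exact neg_le_abs _
      have a5 : z.im * y ≤ |z.im| := by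
        calc z.im * y ≤ |z.im * y| := le_abs_self _
          _ = |z.im| * |y| := abs_mul _ _
          _ ≤ |z.im| * 1 := by gcongr; rw [abs_of_nonneg hy.1]; exact hy.2
          _ = _ := mul_one _
      have b3 := mul_le_mul_of_nonneg_left a3 (by positivity : (0 : ℝ) ≤ 2 * π)
      have b4 := mul_le_mul_of_nonneg_left a4 (by positivity : (0 : ℝ) ≤ 2 * π)
      have b5 := mul_le_mul_of_nonneg_left a5 (by positivity : (0 : ℝ) ≤ 2 * π)
      rw [hB] at a1
      linarith)
  have i1 := integrable_mordell hτ z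
  have i2 := (integrable_mordell hτ (z + τ)).const_mul
    (Complex.exp (-2 * π * Complex.I * z - π * Complex.I * τ))
  rw [mordell, mordell, ← MeasureTheory.integral_const_mul, ← MeasureTheory.integral_add i1 i2]
  convert key using 1
  · congr 1; ext x
    rw [add_div, ← mul_div_assoc, ← Complex.exp_add]
    congr 3
    linear_combination (-(2 * π * τ * x) - π * Complex.I * τ) * Complex.I_sq
  · congr 2
    linear_combination (-(π * Complex.I * τ / 4)) * Complex.I_sq

theorem mordell_sum {τ : ℂ} (hτ : 0 < τ.im) (β : ℂ) (n : ℕ) :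
    2 * (-Complex.I * Complex.exp (π * Complex.I * τ / 4 - π * Complex.I * β)) *
      ∑ m ∈ range n, Complex.exp (-π * Complex.I * τ * m ^ 2 - 2 * π * Complex.I * β * m) =
    mordell τ (τ * (-1 / 2) + β + 1 / 2) -
      Complex.exp (-π * Complex.I * τ * (n ^ 2 - n) - 2 * π * Complex.I * β * n) *
        mordell τ (τ * (n - 1 / 2) + β + 1 / 2) := by
  induction n with
  | zero => simp; ring_nf
  | succ n ih =>
    rw [sum_range_succ, mul_add, ih]
    have h := mordell_add_tau hτ (τ * (n - 1 / 2) + β + 1 / 2)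
    have e1 : τ * (n - 1 / 2) + β + 1 / 2 + τ = τ * ((n + 1 : ℕ) - 1 / 2) + β + 1 / 2 := by
      push_cast; ring
    rw [e1] at h
    have e2 : Complex.exp (-π * Complex.I * τ * ((n + 1 : ℕ) ^ 2 - (n + 1 : ℕ)) -
        2 * π * Complex.I * β * (n + 1 : ℕ)) =
        -(Complex.exp (-π * Complex.I * τ * (n ^ 2 - n) - 2 * π * Complex.I * β * n) *
          Complex.exp (-2 * π * Complex.I * (τ * (n - 1 / 2) + β + 1 / 2) - π * Complex.I * τ)) := by
      rw [← Complex.exp_add, ← Complex.exp_add_pi_mul_I]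
      push_cast
      congr 1; ring
    have e3 : -Complex.I * Complex.exp (π * Complex.I * τ / 4 - π * Complex.I * β) *
        Complex.exp (-π * Complex.I * τ * n ^ 2 - 2 * π * Complex.I * β * n) =
        Complex.exp (-π * Complex.I * τ * (n ^ 2 - n) - 2 * π * Complex.I * β * n) *
        Complex.exp (-π * Complex.I * (τ * (n - 1 / 2) + β + 1 / 2) - π * Complex.I * τ / 4) := by
      rw [← Complex.exp_neg_pi_div_two_mul_I, ← Complex.exp_add, ← Complex.exp_add,
        ← Complex.exp_add]
      congr 1; ring
    rw [e2]
    linear_combination 2 * e3 - (Complex.exp (-π * Complex.I * τ * (n ^ 2 - n)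
      - 2 * π * Complex.I * β * n)) * h

theorem mordell_sub_nat {τ : ℂ} (hτ : 0 < τ.im) (z : ℂ) (k : ℕ) :
    mordell τ z = (-1) ^ k * mordell τ (z - k) + ∑ j ∈ range k, (-1) ^ j *
      (2 * (Complex.I / τ) ^ (1 / 2 : ℂ) *
        Complex.exp (π * Complex.I * (z - j - 1 / 2) ^ 2 / τ)) := by
  induction k with
  | zero => simp
  | succ k ih =>
    have h := mordell_add_one hτ (z - (k + 1 : ℕ))
    have e1 : z - (k + 1 : ℕ) + 1 = z - k := by push_cast; ring
    have e2 : z - (k + 1 : ℕ) + 1 / 2 = z - k - 1 / 2 := by push_cast; ring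
    rw [e1, e2] at h
    rw [sum_range_succ, ih, pow_succ]
    linear_combination (-1) ^ k * h

/-- The approximate functional equation of the quadratic exponential sum, in exact form. -/
theorem theta_reciprocity {τ : ℂ} (hτ : 0 < τ.im) (β : ℂ) (n k : ℕ) :
    2 * (-Complex.I * Complex.exp (π * Complex.I * τ / 4 - π * Complex.I * β)) *
      ((∑ m ∈ range n, Complex.exp (-π * Complex.I * τ * m ^ 2 - 2 * π * Complex.I * β * m)) +
        Complex.I * (Complex.I / τ) ^ (1 / 2 : ℂ) *
          ∑ j ∈ range k, Complex.exp (π * Complex.I * (β - j) ^ 2 / τ)) =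
    mordell τ (τ * (-1 / 2) + β + 1 / 2) -
      (-1) ^ k * Complex.exp (-π * Complex.I * τ * (n ^ 2 - n) - 2 * π * Complex.I * β * n) *
        mordell τ (τ * (n - 1 / 2) + β + 1 / 2 - k) := by
  have hτ0 : τ ≠ 0 := fun h => by simp [h] at hτ
  have h1 := mordell_sum hτ β n
  have h2 := mordell_sub_nat hτ (τ * (n - 1 / 2) + β + 1 / 2) k
  have h3 : ∀ j : ℕ, Complex.exp (-π * Complex.I * τ * (n ^ 2 - n) - 2 * π * Complex.I * β * n) *
      ((-1) ^ j * Complex.exp (π * Complex.I * (τ * (n - 1 / 2) + β + 1 / 2 - j - 1 / 2) ^ 2 / τ)) =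
      Complex.exp (π * Complex.I * τ / 4 - π * Complex.I * β) *
        Complex.exp (π * Complex.I * (β - j) ^ 2 / τ) := by
    intro j
    have e1 : ((-1 : ℂ)) ^ j = Complex.exp (j * (π * Complex.I)) := by
      rw [Complex.exp_nat_mul, Complex.exp_pi_mul_I]
    rw [e1, ← Complex.exp_add, ← Complex.exp_add, ← Complex.exp_add,
      Complex.exp_eq_exp_iff_exists_int]
    refine ⟨j - n * j, ?_⟩
    field_simp
    push_cast
    ring
  have h4 : Complex.exp (-π * Complex.I * τ * (n ^ 2 - n) - 2 * π * Complex.I * β * n) *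
      (∑ j ∈ range k, (-1) ^ j * (2 * (Complex.I / τ) ^ (1 / 2 : ℂ) *
        Complex.exp (π * Complex.I * (τ * (n - 1 / 2) + β + 1 / 2 - j - 1 / 2) ^ 2 / τ))) =
      2 * (Complex.I / τ) ^ (1 / 2 : ℂ) *
        Complex.exp (π * Complex.I * τ / 4 - π * Complex.I * β) *
        ∑ j ∈ range k, Complex.exp (π * Complex.I * (β - j) ^ 2 / τ) := by
    rw [mul_sum, mul_sum]
    refine sum_congr rfl fun j _ => ?_
    linear_combination 2 * (Complex.I / τ) ^ (1 / 2 : ℂ) * h3 j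
  rw [h2] at h1
  linear_combination h1 - h4 - 2 * Complex.exp (π * Complex.I * τ / 4 - π * Complex.I * β) *
    (Complex.I / τ) ^ (1 / 2 : ℂ) * (∑ j ∈ range k, Complex.exp (π * Complex.I * (β - j) ^ 2 / τ)) *
    Complex.I_sq

theorem sinh_mul_le {θ u : ℝ} (h0 : 0 ≤ θ) (h1 : θ ≤ 1) (hu : 0 ≤ u) :
    Real.sinh (θ * u) ≤ θ * Real.sinh u := by
  have hd : ∀ x : ℝ, HasDerivAt (fun x => θ * Real.sinh x - Real.sinh (θ * x))
      (θ * Real.cosh x - Real.cosh (θ * x) * θ) x := by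
    intro x
    have h1 : HasDerivAt (fun x : ℝ => θ * x) θ x := by
      simpa using (hasDerivAt_id x).const_mul θ
    exact ((Real.hasDerivAt_sinh x).const_mul θ).fun_sub h1.sinh
  have hm : MonotoneOn (fun x => θ * Real.sinh x - Real.sinh (θ * x)) (Set.Ici 0) := by
    apply monotoneOn_of_deriv_nonneg (convex_Ici 0)
    · exact fun x _ => (hd x).continuousAt.continuousWithinAt
    · exact fun x _ => (hd x).differentiableAt.differentiableWithinAt
    · intro x hx
      rw [interior_Ici] at hx
      have hx : 0 < x := hx
      rw [(hd x).deriv]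
      have : Real.cosh (θ * x) ≤ Real.cosh x := by
        rw [Real.cosh_le_cosh, abs_of_nonneg (by positivity), abs_of_pos hx]
        nlinarith
      nlinarith
  have := hm (Set.mem_Ici.2 le_rfl) (Set.mem_Ici.2 hu) hu
  simp at this
  linarith

theorem cosh_mul_le {θ u : ℝ} (h1 : |θ| ≤ 1) :
    Real.cosh (θ * u) ≤ 1 + θ ^ 2 * (Real.cosh u - 1) := by
  have hc : ∀ x : ℝ, Real.cosh x = 1 + 2 * Real.sinh (|x| / 2) ^ 2 := by
    intro x
    have e1 := Real.cosh_two_mul (|x| / 2)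
    have e2 := Real.cosh_sq (|x| / 2)
    rw [← Real.cosh_abs, show |x| = 2 * (|x| / 2) by ring, e1, e2]
    ring_nf
  rw [hc (θ * u), hc u, abs_mul, mul_div_assoc]
  have h := sinh_mul_le (abs_nonneg θ) h1 (u := |u| / 2) (by positivity)
  have h2 : 0 ≤ Real.sinh (|θ| * (|u| / 2)) := Real.sinh_nonneg_iff.2 (by positivity)
  have h3 := pow_le_pow_left₀ h2 h 2
  rw [mul_pow, sq_abs] at h3
  linarith

theorem hasDerivAt_tanh_pi (x : ℝ) :
    HasDerivAt (fun x : ℝ => Real.tanh (π * x)) (π / Real.cosh (π * x) ^ 2) x := by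
  have h1 : HasDerivAt (fun x : ℝ => π * x) π x := by
    simpa using (hasDerivAt_id x).const_mul π
  have h := (h1.sinh).div h1.cosh (Real.cosh_pos _).ne'
  have e : (fun x : ℝ => Real.tanh (π * x)) =
      (fun x => Real.sinh (π * x)) / fun x => Real.cosh (π * x) := by
    funext x; exact Real.tanh_eq_sinh_div_cosh _
  rw [e]
  refine h.congr_deriv ?_
  have := Real.cosh_sq (π * x)
  congr 1
  linear_combination π * this

theorem integral_sech_sq : ∫ x : ℝ, π / Real.cosh (π * x) ^ 2 = 2 := by
  have hπ := Real.pi_pos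
  have hd : ∀ x : ℝ, HasDerivAt (fun x => -2 / (Real.exp (2 * π * x) + 1))
      (π / Real.cosh (π * x) ^ 2) x := by
    intro x
    have h1 : HasDerivAt (fun x : ℝ => Real.exp (2 * π * x) + 1)
        (Real.exp (2 * π * x) * (2 * π)) x := by
      simpa using (((hasDerivAt_id x).const_mul (2 * π)).exp).add_const 1
    have h2 := (h1.fun_inv (by positivity)).const_mul (-2)
    simp only [← div_eq_mul_inv] at h2
    refine h2.congr_deriv ?_
    have e : Real.exp (2 * π * x) = Real.exp (π * x) ^ 2 := by
      rw [← Real.exp_nat_mul]; ring_nf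
    rw [e, Real.cosh_eq, Real.exp_neg]
    have := Real.exp_pos (π * x)
    field_simp
  have hint : MeasureTheory.Integrable (fun x : ℝ => π / Real.cosh (π * x) ^ 2) := by
    have h := integrable_exp_div_cosh (σ := 0) (by simp)
    refine (h.const_mul π).mono' (Continuous.aestronglyMeasurable (Continuous.div (by fun_prop)
      (by fun_prop) (fun x => (pow_pos (Real.cosh_pos _) 2).ne'))) (Filter.Eventually.of_forall
        fun x => ?_)
    have h1 := Real.one_le_cosh (π * x)
    rw [Real.norm_of_nonneg (by positivity)]
    simp only [mul_zero, zero_mul, Real.exp_zero, mul_one_div]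
    gcongr
    nlinarith
  have hb : Filter.Tendsto (fun x : ℝ => 2 * π * x) Filter.atBot Filter.atBot :=
    Filter.tendsto_id.const_mul_atBot (by positivity)
  have ht : Filter.Tendsto (fun x : ℝ => 2 * π * x) Filter.atTop Filter.atTop :=
    Filter.tendsto_id.const_mul_atTop (by positivity)
  have l1 : Filter.Tendsto (fun x => -2 / (Real.exp (2 * π * x) + 1)) Filter.atBot
      (nhds (-2 / (0 + 1))) :=
    tendsto_const_nhds.div ((Real.tendsto_exp_atBot.comp hb).add_const 1) (by norm_num)
  have l2 : Filter.Tendsto (fun x => -2 / (Real.exp (2 * π * x) + 1)) Filter.atTop (nhds 0) :=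
    (Filter.tendsto_atTop_add_const_right _ 1 (Real.tendsto_exp_atTop.comp ht)).const_div_atTop _
  rw [MeasureTheory.integral_of_hasDerivAt_of_tendsto hd hint l1 l2]
  norm_num

theorem integrable_sech_sq : MeasureTheory.Integrable fun x : ℝ => π / Real.cosh (π * x) ^ 2 := by
  by_contra h
  have := integral_sech_sq
  rw [MeasureTheory.integral_undef h] at this
  norm_num at this

theorem integral_exp_mul_sech_sq {σ : ℝ} (hσ : |σ| ≤ 1 / 2) :
    MeasureTheory.Integrable (fun x : ℝ => Real.exp (-2 * π * σ * x) * (π / Real.cosh (π * x) ^ 2)) ∧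
    ∫ x : ℝ, Real.exp (-2 * π * σ * x) * (π / Real.cosh (π * x) ^ 2) ≤ 2 + 4 * σ ^ 2 * (π - 2) := by
  have hπ := Real.pi_pos
  have hcont : ∀ s : ℝ, Continuous
      (fun x : ℝ => Real.exp (-2 * π * s * x) * (π / Real.cosh (π * x) ^ 2)) := fun s =>
    Continuous.mul (by fun_prop) (Continuous.div (by fun_prop)
      (by fun_prop) (fun x => (pow_pos (Real.cosh_pos _) 2).ne'))
  have hsech : MeasureTheory.Integrable fun x : ℝ => 1 / Real.cosh (π * x) := by
    simpa using integrable_exp_div_cosh (σ := 0) (by simp)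
  have hdom := (integrable_sech_sq.const_mul (1 - 4 * σ ^ 2)).add (hsech.const_mul (4 * σ ^ 2 * π))
  have hle : ∀ x : ℝ, Real.cosh (2 * σ * (π * x)) * (π / Real.cosh (π * x) ^ 2) ≤
      (1 - 4 * σ ^ 2) * (π / Real.cosh (π * x) ^ 2) + 4 * σ ^ 2 * π * (1 / Real.cosh (π * x)) := by
    intro x
    have h := cosh_mul_le (θ := 2 * σ) (u := π * x) (by rw [abs_mul, abs_two]; linarith)
    have hc := Real.cosh_pos (π * x)
    have e : (1 - 4 * σ ^ 2) * (π / Real.cosh (π * x) ^ 2) + 4 * σ ^ 2 * π * (1 / Real.cosh (π * x))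
        = (1 + (2 * σ) ^ 2 * (Real.cosh (π * x) - 1)) * (π / Real.cosh (π * x) ^ 2) := by
      field_simp
      ring
    rw [e]
    gcongr
  have hI : ∀ s : ℝ, |s| = |σ| → MeasureTheory.Integrable
      (fun x : ℝ => Real.exp (-2 * π * s * x) * (π / Real.cosh (π * x) ^ 2)) := by
    intro s hs
    refine (hdom.const_mul 2).mono' (hcont s).aestronglyMeasurable
      (Filter.Eventually.of_forall fun x => ?_)
    have hc := Real.cosh_pos (π * x)
    rw [Real.norm_of_nonneg (by positivity)]
    have h1 := hle x
    have h2 : Real.exp (-2 * π * s * x) ≤ 2 * Real.cosh (2 * σ * (π * x)) := by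
      have h3 := half_exp_abs_le_cosh (2 * σ * (π * x))
      have h4 : Real.exp (-2 * π * s * x) ≤ Real.exp |2 * σ * (π * x)| := by
        apply Real.exp_le_exp.2
        calc -2 * π * s * x ≤ |-2 * π * s * x| := le_abs_self _
          _ = |2 * σ * (π * x)| := by
            rw [abs_mul, abs_mul, abs_mul, abs_mul, abs_mul, hs, abs_neg, abs_mul]; ring
      linarith
    simp only [Pi.add_apply]
    calc _ ≤ 2 * Real.cosh (2 * σ * (π * x)) * (π / Real.cosh (π * x) ^ 2) := by gcongr
      _ ≤ _ := by linarith
  refine ⟨hI σ rfl, ?_⟩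
  have hn := hI (-σ) (abs_neg σ)
  have e1 : ∫ x : ℝ, Real.exp (-2 * π * σ * x) * (π / Real.cosh (π * x) ^ 2) =
      ∫ x : ℝ, Real.exp (-2 * π * (-σ) * x) * (π / Real.cosh (π * x) ^ 2) := by
    rw [← MeasureTheory.integral_neg_eq_self]
    congr 1; ext x
    rw [mul_neg π x, Real.cosh_neg]
    congr 2; ring
  have e2 : 2 * ∫ x : ℝ, Real.exp (-2 * π * σ * x) * (π / Real.cosh (π * x) ^ 2) =
      2 * ∫ x : ℝ, Real.cosh (2 * σ * (π * x)) * (π / Real.cosh (π * x) ^ 2) := by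
    rw [two_mul]
    conv_lhs => rw [e1]
    conv_lhs => arg 1; rw [← e1]
    rw [← MeasureTheory.integral_add (hI σ rfl) hn, ← MeasureTheory.integral_const_mul]
    congr 1; ext x
    rw [Real.cosh_eq (2 * σ * (π * x)), show -2 * π * σ * x = -(2 * σ * (π * x)) by ring,
      show -2 * π * -σ * x = 2 * σ * (π * x) by ring]
    ring
  have e3 := mul_left_cancel₀ two_ne_zero e2
  rw [e3]
  have hcI : MeasureTheory.Integrable
      (fun x : ℝ => Real.cosh (2 * σ * (π * x)) * (π / Real.cosh (π * x) ^ 2)) := by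
    refine (((hI σ rfl).add hn).const_mul (1 / 2)).congr (Filter.Eventually.of_forall fun x => ?_)
    simp only [Pi.add_apply]
    rw [Real.cosh_eq (2 * σ * (π * x)), show -2 * π * σ * x = -(2 * σ * (π * x)) by ring,
      show -2 * π * -σ * x = 2 * σ * (π * x) by ring]
    ring
  refine (MeasureTheory.integral_mono hcI hdom hle).trans (le_of_eq ?_)
  have h5 := MeasureTheory.integral_add (integrable_sech_sq.const_mul (1 - 4 * σ ^ 2))
    (hsech.const_mul (4 * σ ^ 2 * π))
  rw [MeasureTheory.integral_const_mul, MeasureTheory.integral_const_mul, integral_sech_sq,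
    integral_inv_cosh] at h5
  refine h5.trans ?_
  ring

theorem exists_gauss_bound {τ : ℂ} (hτ : 0 < τ.im) (T : ℝ) :
    ∃ C : ℝ, 0 ≤ C ∧ ∀ z : ℂ, ‖z‖ ≤ T → ∀ x : ℝ,
      (1 + |x|) * ‖Complex.exp (π * Complex.I * τ * x ^ 2 - 2 * π * z * x)‖ ≤
        C * Real.exp (-1 * |x|) := by
  have hπ := Real.pi_pos
  refine ⟨Real.exp ((2 * π * T + 2) ^ 2 / (4 * (π * τ.im))), (Real.exp_pos _).le, fun z hz x => ?_⟩
  have h1 : 1 + |x| ≤ Real.exp |x| := by linarith [Real.add_one_le_exp |x|]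
  refine (mul_le_mul_of_nonneg_right h1 (norm_nonneg _)).trans ?_
  rw [Complex.norm_exp, ← Real.exp_add, ← Real.exp_add]
  apply Real.exp_le_exp.2
  have : (π * Complex.I * τ * x ^ 2 - 2 * π * z * x : ℂ).re
      = -(π * τ.im * x ^ 2) - 2 * π * z.re * x := by
    simp [pow_two]
  rw [this]
  have a1 : -(z.re * x) ≤ T * |x| := by
    calc -(z.re * x) ≤ |z.re * x| := neg_le_abs _
      _ = |z.re| * |x| := abs_mul _ _
      _ ≤ T * |x| := by gcongr; exact (Complex.abs_re_le_norm z).trans hz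
  have a2 := mul_le_mul_of_nonneg_left a1 (by positivity : (0 : ℝ) ≤ 2 * π)
  have a3 : -(π * τ.im) * x ^ 2 + (2 * π * T + 2) * |x| ≤
      (2 * π * T + 2) ^ 2 / (4 * (π * τ.im)) := by
    rw [le_div_iff₀ (by positivity), ← sq_abs x]
    nlinarith [sq_nonneg (2 * (π * τ.im) * |x| - (2 * π * T + 2))]
  linarith

theorem abs_tanh_le_one (x : ℝ) : |Real.tanh x| ≤ 1 := by
  rw [abs_le]
  exact ⟨(Real.neg_one_lt_tanh x).le, (Real.tanh_lt_one x).le⟩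

theorem mordell_sub_eq {τ : ℂ} (hτ : 0 < τ.im) (v : ℂ) :
    mordell τ (v - 1 / 2) - mordell τ (v + 1 / 2) =
      2 * ∫ x : ℝ, Complex.exp (π * Complex.I * τ * x ^ 2 - 2 * π * v * x) *
        (Real.tanh (π * x) : ℝ) := by
  rw [mordell, mordell, ← MeasureTheory.integral_sub (integrable_mordell hτ _)
    (integrable_mordell hτ _), ← MeasureTheory.integral_const_mul]
  congr 1; ext x
  have h := cosh_ofReal_ne_zero x
  have e1 : ((Real.tanh (π * x) : ℝ) : ℂ) = Complex.sinh (π * x) / Complex.cosh (π * x) := by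
    rw [Complex.ofReal_tanh, Complex.tanh_eq_sinh_div_cosh]; push_cast; rfl
  rw [e1, ← sub_div, ← mul_div_assoc, ← mul_div_assoc]
  congr 1
  have h2 : 2 * Complex.sinh (π * x) = Complex.exp (π * x) - Complex.exp (-(π * x)) :=
    Complex.two_sinh _
  have e2 : Complex.exp (π * Complex.I * τ * x ^ 2 - 2 * π * (v - 1 / 2) * x) =
      Complex.exp (π * Complex.I * τ * x ^ 2 - 2 * π * v * x) * Complex.exp (π * x) := by
    rw [← Complex.exp_add]; congr 1; ring
  have e3 : Complex.exp (π * Complex.I * τ * x ^ 2 - 2 * π * (v + 1 / 2) * x) =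
      Complex.exp (π * Complex.I * τ * x ^ 2 - 2 * π * v * x) * Complex.exp (-(π * x)) := by
    rw [← Complex.exp_add]; congr 1; ring
  rw [e2, e3]
  linear_combination -(Complex.exp (π * Complex.I * τ * x ^ 2 - 2 * π * v * x)) * h2

theorem norm_integral_gauss_tanh_le {τ : ℂ} (hτ : 0 < τ.im) {v : ℂ} (hv : |v.re| ≤ 1 / 2) :
    ‖∫ x : ℝ, Complex.exp (π * Complex.I * τ * x ^ 2 - 2 * π * v * x) *
        (Real.tanh (π * x) : ℝ)‖ ≤
      ‖v‖ / ‖τ‖ * (2 + 4 / 3 * (π - 2) * v.re ^ 2) * Real.exp (2 * π * |(v ^ 2 / τ).im|) := by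
  have hπ := Real.pi_pos
  have hτ0 : τ ≠ 0 := fun h => by simp [h] at hτ
  set E : ℝ → ℝ → ℂ := fun t x =>
    Complex.exp (π * Complex.I * τ * x ^ 2 - 2 * π * (t * v) * x) with hE
  set J : ℝ → ℂ := fun t => ∫ x : ℝ, E t x * (Real.tanh (π * x) : ℝ) with hJ
  set W : ℝ → ℂ := fun t => ∫ x : ℝ, E t x * (π / Real.cosh (π * x) ^ 2 : ℝ) with hW
  set P : ℝ → ℂ := fun t => Complex.exp (-π * Complex.I * t ^ 2 * (v ^ 2 / τ)) with hP
  have hEc : ∀ t, Continuous (E t) := fun t => by simp only [hE]; fun_prop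
  have htc : Continuous fun x : ℝ => ((Real.tanh (π * x) : ℝ) : ℂ) :=
    Complex.continuous_ofReal.comp
      (continuous_iff_continuousAt.2 fun x => (hasDerivAt_tanh_pi x).continuousAt)
  have hsc : Continuous fun x : ℝ => ((π / Real.cosh (π * x) ^ 2 : ℝ) : ℂ) :=
    Complex.continuous_ofReal.comp (Continuous.div (by fun_prop)
      (by fun_prop) (fun x => (pow_pos (Real.cosh_pos _) 2).ne'))
  have htn : ∀ x : ℝ, ‖((Real.tanh (π * x) : ℝ) : ℂ)‖ ≤ 1 := fun x => by
    rw [Complex.norm_real]; exact abs_tanh_le_one _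
  have hsn : ∀ x : ℝ, ‖((π / Real.cosh (π * x) ^ 2 : ℝ) : ℂ)‖ ≤ π := fun x => by
    have := Real.one_le_cosh (π * x)
    rw [Complex.norm_real, Real.norm_of_nonneg (by positivity)]
    exact div_le_self hπ.le (by nlinarith)
  -- integrability of polynomially weighted integrands
  have hint : ∀ (t K : ℝ) (w : ℝ → ℂ), Continuous w → (∀ x, ‖w x‖ ≤ K * (1 + |x|)) →
      MeasureTheory.Integrable fun x => E t x * w x := by
    intro t K w hw hwK
    obtain ⟨C, hC0, hC⟩ := exists_gauss_bound hτ ‖(t * v : ℂ)‖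
    refine (((integrable_exp_neg_mul_abs one_pos).const_mul C).const_mul K).mono'
      ((hEc t).mul hw).aestronglyMeasurable (Filter.Eventually.of_forall fun x => ?_)
    have hK : 0 ≤ K := by
      have := (norm_nonneg _).trans (hwK 0)
      simpa using this
    rw [norm_mul]
    calc ‖E t x‖ * ‖w x‖ ≤ ‖E t x‖ * (K * (1 + |x|)) := by gcongr; exact hwK x
      _ = K * ((1 + |x|) * ‖E t x‖) := by ring
      _ ≤ _ := mul_le_mul_of_nonneg_left (hC _ le_rfl x) hK
  have hxE : ∀ t : ℝ, MeasureTheory.Integrable fun x : ℝ =>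
      E t x * (x * (Real.tanh (π * x) : ℝ)) := fun t =>
    hint t 1 _ (Complex.continuous_ofReal.mul htc) fun x => by
      rw [norm_mul, Complex.norm_real, Real.norm_eq_abs]
      nlinarith [abs_nonneg x, htn x, norm_nonneg ((Real.tanh (π * x) : ℝ) : ℂ)]
  have hEt : ∀ t : ℝ, MeasureTheory.Integrable fun x : ℝ => E t x * (Real.tanh (π * x) : ℝ) :=
    fun t => hint t 1 _ htc fun x => by linarith [htn x, abs_nonneg x]
  have hEs : ∀ t : ℝ, MeasureTheory.Integrable fun x : ℝ =>
      E t x * (π / Real.cosh (π * x) ^ 2 : ℝ) :=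
    fun t => hint t π _ hsc fun x => by nlinarith [hsn x, abs_nonneg x]
  -- differentiation under the integral
  have hJd : ∀ t : ℝ, HasDerivAt J (∫ x : ℝ, -2 * π * v * (E t x * (x * (Real.tanh (π * x) : ℝ)))) t := by
    intro t
    obtain ⟨C, hC0, hC⟩ := exists_gauss_bound hτ ((|t| + 1) * ‖v‖)
    refine (hasDerivAt_integral_of_dominated_loc_of_deriv_le (s := Metric.ball t 1)
      (F := fun s x => E s x * (Real.tanh (π * x) : ℝ))
      (F' := fun s x => -2 * π * v * (E s x * (x * (Real.tanh (π * x) : ℝ))))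
      (bound := fun x => 2 * π * ‖v‖ * (C * Real.exp (-1 * |x|))) (Metric.ball_mem_nhds t one_pos)
      (Filter.Eventually.of_forall fun s => ((hEc s).mul htc).aestronglyMeasurable) (hEt t)
      ((hxE t).const_mul _).aestronglyMeasurable
      (Filter.Eventually.of_forall fun x s hs => ?_)
      (((integrable_exp_neg_mul_abs one_pos).const_mul C).const_mul _)
      (Filter.Eventually.of_forall fun x s _ => ?_)).2
    · have e0 : ‖(-2 * π * v : ℂ)‖ = 2 * π * ‖v‖ := by
        rw [norm_mul, norm_mul, norm_neg, Complex.norm_real, Real.norm_of_nonneg hπ.le]; simp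
      rw [norm_mul, e0, norm_mul, norm_mul, Complex.norm_real x, Real.norm_eq_abs]
      have hs' : ‖(s * v : ℂ)‖ ≤ (|t| + 1) * ‖v‖ := by
        rw [norm_mul, Complex.norm_real, Real.norm_eq_abs]
        gcongr
        rw [Metric.mem_ball, Real.dist_eq] at hs
        have := abs_sub_abs_le_abs_sub s t
        linarith
      have h1 := hC _ hs' x
      refine mul_le_mul_of_nonneg_left (le_trans ?_ h1) (by positivity)
      have h2 : |x| * ‖((Real.tanh (π * x) : ℝ) : ℂ)‖ ≤ 1 + |x| := by
        nlinarith [abs_nonneg x, htn x, norm_nonneg ((Real.tanh (π * x) : ℝ) : ℂ)]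
      rw [mul_comm (1 + |x|)]
      exact mul_le_mul_of_nonneg_left h2 (norm_nonneg _)
    · have h1 : HasDerivAt (fun s : ℝ => π * Complex.I * τ * x ^ 2 - 2 * π * (s * v) * x)
          (-2 * π * v * x) s := by
        have h0 : HasDerivAt (fun s : ℝ => (s : ℂ)) 1 s := Complex.ofRealCLM.hasDerivAt
        have := ((((h0.mul_const v).const_mul (2 * π : ℂ))).mul_const (x : ℂ)).const_sub
          (π * Complex.I * τ * x ^ 2)
        refine this.congr_deriv ?_
        ring
      refine (h1.cexp.mul_const _).congr_deriv ?_
      simp only [hE]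
      ring
  -- integration by parts
  have hparts : ∀ t : ℝ, (2 * π * Complex.I * τ) * (∫ x : ℝ, E t x * (x * (Real.tanh (π * x) : ℝ)))
      = 2 * π * t * v * J t - W t := by
    intro t
    have hEd : ∀ x : ℝ, HasDerivAt (E t) (E t x * (2 * π * Complex.I * τ * x - 2 * π * (t * v))) x := by
      intro x
      have h0 : HasDerivAt (fun s : ℝ => (s : ℂ)) 1 x := Complex.ofRealCLM.hasDerivAt
      have h1 := ((h0.fun_pow 2).const_mul (π * Complex.I * τ)).fun_sub (h0.const_mul (2 * π * (t * v)))
      refine h1.cexp.congr_deriv ?_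
      simp only [hE]
      push_cast
      ring
    have htd : ∀ x : ℝ, HasDerivAt (fun x : ℝ => ((Real.tanh (π * x) : ℝ) : ℂ))
        ((π / Real.cosh (π * x) ^ 2 : ℝ) : ℂ) x := fun x => (hasDerivAt_tanh_pi x).ofReal_comp
    have i2 : MeasureTheory.Integrable fun x : ℝ =>
        E t x * (2 * π * Complex.I * τ * x - 2 * π * (t * v)) * (Real.tanh (π * x) : ℝ) := by
      refine (((hxE t).const_mul (2 * π * Complex.I * τ)).sub
        ((hEt t).const_mul (2 * π * (t * v)))).congr (Filter.Eventually.of_forall fun x => ?_)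
      simp only [Pi.sub_apply]
      ring
    have := MeasureTheory.integral_mul_deriv_eq_deriv_mul_of_integrable (fun x _ => hEd x)
      (fun x _ => htd x) (hEs t) i2 (hEt t)
    have e3 : ∫ x : ℝ, E t x * (2 * π * Complex.I * τ * x - 2 * π * (t * v)) * (Real.tanh (π * x) : ℝ)
        = (2 * π * Complex.I * τ) * (∫ x : ℝ, E t x * (x * (Real.tanh (π * x) : ℝ))) -
          2 * π * (t * v) * J t := by
      rw [hJ, ← MeasureTheory.integral_const_mul, ← MeasureTheory.integral_const_mul,
        ← MeasureTheory.integral_sub ((hxE t).const_mul _) ((hEt t).const_mul _)]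
      congr 1; ext x; ring
    rw [e3] at this
    simp only [hW]
    linear_combination this
  have hPd : ∀ t : ℝ, HasDerivAt P (P t * (-2 * π * Complex.I * t * (v ^ 2 / τ))) t := by
    intro t
    have h0 : HasDerivAt (fun s : ℝ => (s : ℂ)) 1 t := Complex.ofRealCLM.hasDerivAt
    have h1 := ((h0.fun_pow 2).const_mul (-π * Complex.I)).mul_const (v ^ 2 / τ)
    refine h1.cexp.congr_deriv ?_
    simp only [hP]
    push_cast
    ring
  have hΨ : ∀ t : ℝ, HasDerivAt (fun t => P t * J t) (P t * (-(Complex.I * v / τ) * W t)) t := by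
    intro t
    refine ((hPd t).mul (hJd t)).congr_deriv ?_
    rw [MeasureTheory.integral_const_mul]
    have hp := hparts t
    have e : (∫ x : ℝ, E t x * (x * (Real.tanh (π * x) : ℝ))) =
        (2 * π * t * v * J t - W t) / (2 * π * Complex.I * τ) := by
      rw [eq_div_iff (by simp [hτ0, Real.pi_ne_zero])]
      rw [← hp]; ring
    rw [e]
    have : (π : ℂ) ≠ 0 := by exact_mod_cast hπ.ne'
    field_simp
    linear_combination (P t * v * W t - 2 * P t * v ^ 2 * π * t * J t) * Complex.I_sq
  set M : ℝ := Real.exp (π * |(v ^ 2 / τ).im|) with hM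
  have hPn : ∀ t ∈ Set.Ico (0 : ℝ) 1, ‖P t‖ ≤ M := by
    intro t ht
    rw [hP, hM, Complex.norm_exp]
    apply Real.exp_le_exp.2
    have : (-π * Complex.I * t ^ 2 * (v ^ 2 / τ) : ℂ).re = π * t ^ 2 * (v ^ 2 / τ).im := by
      generalize v ^ 2 / τ = w
      simp [pow_two]
    rw [this, mul_assoc]
    refine mul_le_mul_of_nonneg_left ?_ hπ.le
    have h1 := le_abs_self (v ^ 2 / τ).im
    have h2 : t ^ 2 ≤ 1 := by nlinarith [ht.1, ht.2]
    calc t ^ 2 * (v ^ 2 / τ).im ≤ t ^ 2 * |(v ^ 2 / τ).im| := by gcongr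
      _ ≤ 1 * |(v ^ 2 / τ).im| := by gcongr
      _ = _ := one_mul _
  have hWn : ∀ t ∈ Set.Ico (0 : ℝ) 1, ‖W t‖ ≤ 2 + 4 * (t * v.re) ^ 2 * (π - 2) := by
    intro t ht
    have hb : |t * v.re| ≤ 1 / 2 := by
      rw [abs_mul, abs_of_nonneg ht.1]
      nlinarith [ht.1, ht.2, abs_nonneg v.re]
    obtain ⟨i1, i2⟩ := integral_exp_mul_sech_sq hb
    refine le_trans (MeasureTheory.norm_integral_le_of_norm_le i1
      (Filter.Eventually.of_forall fun x => ?_)) i2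
    rw [norm_mul, Complex.norm_real, Real.norm_of_nonneg (by positivity)]
    have := norm_gauss_le hτ (t * v) x
    rw [Complex.re_ofReal_mul] at this
    gcongr
  have main := image_norm_le_of_norm_deriv_right_le_deriv_boundary (a := 0) (b := 1)
    (f := fun t => P t * J t)
    (f' := fun t => P t * (-(Complex.I * v / τ) * W t))
    (fun t _ => (hΨ t).continuousAt.continuousWithinAt)
    (fun t _ => (hΨ t).hasDerivWithinAt)
    (B := fun t => M * (‖v‖ / ‖τ‖) * (2 * t + 4 / 3 * v.re ^ 2 * (π - 2) * t ^ 3))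
    (B' := fun t => M * (‖v‖ / ‖τ‖) * (2 + 4 * (t * v.re) ^ 2 * (π - 2)))
    (by
      have hJ0 : J 0 = 0 := by
        have h1 : J 0 = -J 0 := by
          rw [hJ]
          simp only
          conv_lhs => rw [← MeasureTheory.integral_neg_eq_self]
          rw [← MeasureTheory.integral_neg]
          congr 1; ext x
          simp [hE, Real.tanh_neg]
        have h2 : 2 * J 0 = 0 := by linear_combination h1
        simpa using h2
      simp [hJ0])
    (by
      intro x
      have h := (((hasDerivAt_id x).const_mul 2).fun_add (((hasDerivAt_id x).fun_pow 3).const_mul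
        (4 / 3 * v.re ^ 2 * (π - 2)))).const_mul (M * (‖v‖ / ‖τ‖))
      refine h.congr_deriv ?_
      simp only [id]
      push_cast
      ring)
    (by
      intro t ht
      rw [norm_mul, norm_mul, norm_neg, norm_div, norm_mul, Complex.norm_I, one_mul]
      have h1 := hPn t ht
      have h2 := hWn t ht
      rw [mul_assoc]
      gcongr)
    (x := 1) (by simp)
  have eJ : J 1 = ∫ x : ℝ, Complex.exp (π * Complex.I * τ * x ^ 2 - 2 * π * v * x) *
        (Real.tanh (π * x) : ℝ) := by
    simp [hJ, hE]
  rw [← eJ]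
  have hPinv : ‖J 1‖ ≤ M * ‖P 1 * J 1‖ := by
    rw [norm_mul, ← mul_assoc]
    have h1 : 1 ≤ M * ‖P 1‖ := by
      rw [hP, hM, Complex.norm_exp, ← Real.exp_add]
      apply Real.one_le_exp
      have : (-π * Complex.I * (1 : ℝ) ^ 2 * (v ^ 2 / τ) : ℂ).re = π * (v ^ 2 / τ).im := by
        generalize v ^ 2 / τ = w
        simp
      rw [this]
      have := neg_le_abs (v ^ 2 / τ).im
      nlinarith
    nlinarith [norm_nonneg (J 1)]
  have hMM : Real.exp (2 * π * |(v ^ 2 / τ).im|) = M * M := by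
    rw [hM, ← Real.exp_add]; ring_nf
  rw [hMM]
  have hM0 : 0 ≤ M := (Real.exp_pos _).le
  calc ‖J 1‖ ≤ M * ‖P 1 * J 1‖ := hPinv
    _ ≤ M * (M * (‖v‖ / ‖τ‖) * (2 * 1 + 4 / 3 * v.re ^ 2 * (π - 2) * 1 ^ 3)) :=
      mul_le_mul_of_nonneg_left main hM0
    _ = _ := by ring

/-- The incomplete Gaussian sum of modulus `τ` and shift `β`. -/
noncomputable def chirpSum (τ β : ℂ) (n : ℕ) : ℂ :=
  ∑ m ∈ range n, Complex.exp (-π * Complex.I * τ * m ^ 2 - 2 * π * Complex.I * β * m)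

/-- The sum dual to `chirpSum` under the reciprocity law. -/
noncomputable def dualSum (τ β : ℂ) (k : ℕ) : ℂ :=
  ∑ j ∈ range k, Complex.exp (π * Complex.I * (β - j) ^ 2 / τ)

/-- The term of the reciprocity law that does not depend on the length of the sum. -/
noncomputable def chirpShift (τ β : ℂ) : ℂ :=
  mordell τ (τ * (-1 / 2) + β + 1 / 2) /
    (2 * (-Complex.I * Complex.exp (π * Complex.I * τ / 4 - π * Complex.I * β)))

theorem chirpSum_sub_shift {τ : ℂ} (hτ : 0 < τ.im) (β : ℂ) (n k : ℕ) :
    chirpSum τ β n + Complex.I * (Complex.I / τ) ^ (1 / 2 : ℂ) * dualSum τ β k - chirpShift τ β =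
      -((-1) ^ k * Complex.exp (-π * Complex.I * τ * (n ^ 2 - n) - 2 * π * Complex.I * β * n) /
        (2 * (-Complex.I * Complex.exp (π * Complex.I * τ / 4 - π * Complex.I * β))) *
        mordell τ (τ * (n - 1 / 2) + β + 1 / 2 - k)) := by
  have h := theta_reciprocity hτ β n k
  rw [chirpSum, dualSum, chirpShift]
  have hK : 2 * (-Complex.I * Complex.exp (π * Complex.I * τ / 4 - π * Complex.I * β)) ≠ 0 := by
    simp [Complex.exp_ne_zero]
  have h2 := congrArg (· / (2 * (-Complex.I * Complex.exp (π * Complex.I * τ / 4 - π * Complex.I * β)))) h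
  rw [mul_div_cancel_left₀ _ hK] at h2
  rw [h2]
  ring

theorem norm_chirp_factor (τ : ℂ) (β : ℝ) (n k : ℕ) :
    ‖(-1 : ℂ) ^ k * Complex.exp (-π * Complex.I * τ * (n ^ 2 - n) - 2 * π * Complex.I * β * n) /
        (2 * (-Complex.I * Complex.exp (π * Complex.I * τ / 4 - π * Complex.I * β)))‖ =
      Real.exp (π * τ.im * (n - 1 / 2) ^ 2) / 2 := by
  have e1 : (-π * Complex.I * τ * (n ^ 2 - n) - 2 * π * Complex.I * β * n : ℂ).re =
      π * τ.im * (n ^ 2 - n) := by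
    simp [pow_two]
  have e2 : (π * Complex.I * τ / 4 - π * Complex.I * β : ℂ).re = -(π * τ.im / 4) := by
    have : (π * Complex.I * τ / 4 - π * Complex.I * β : ℂ) =
      ((1 / 4 : ℝ) : ℂ) * (π * Complex.I * τ) - π * Complex.I * β := by push_cast; ring
    rw [this]
    simp
    ring
  rw [norm_div, norm_mul, norm_mul, norm_mul, norm_pow, norm_neg, norm_neg, Complex.norm_I,
    Complex.norm_exp, Complex.norm_exp, e1, e2]
  simp only [norm_one, one_pow, one_mul, Complex.norm_ofNat]
  rw [div_mul_eq_div_div_swap, ← Real.exp_sub]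
  congr 2
  ring

theorem norm_chirpSum_sub_le {τ : ℂ} (hτ : 0 < τ.im) (β : ℝ) (n k : ℕ)
    (hz : |τ.re * (n - 1 / 2) + β + 1 / 2 - k| < 1 / 2) :
    ‖chirpSum τ β n + Complex.I * (Complex.I / τ) ^ (1 / 2 : ℂ) * dualSum τ β k - chirpShift τ β‖ ≤
      Real.exp (π * τ.im * (n - 1 / 2) ^ 2) *
        (1 / 2 / Real.cos (π * (τ.re * (n - 1 / 2) + β + 1 / 2 - k))) := by
  rw [chirpSum_sub_shift hτ, norm_neg, norm_mul, norm_chirp_factor]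
  have e : (τ * (n - 1 / 2) + β + 1 / 2 - k : ℂ).re = τ.re * (n - 1 / 2) + β + 1 / 2 - k := by
    have : (τ * (n - 1 / 2) + β + 1 / 2 - k : ℂ) =
        τ * ((n - 1 / 2 : ℝ) : ℂ) + ((β + 1 / 2 - k : ℝ) : ℂ) := by push_cast; ring
    rw [this, Complex.add_re, Complex.re_mul_ofReal, Complex.ofReal_re]
    ring
  rw [← e] at hz ⊢
  calc _ ≤ Real.exp (π * τ.im * (n - 1 / 2) ^ 2) / 2 * (1 / Real.cos (π * _)) :=
        mul_le_mul_of_nonneg_left (norm_mordell_le hτ hz) (by positivity)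
    _ = _ := by ring

theorem norm_chirpSum_sub_avg_le {τ : ℂ} (hτ : 0 < τ.im) (β : ℝ) (n p : ℕ) {v : ℂ}
    (hv : v = τ * (n - 1 / 2) + β - p) (hz : |v.re| ≤ 1 / 2) :
    ‖chirpSum τ β n + Complex.I * (Complex.I / τ) ^ (1 / 2 : ℂ) *
        ((dualSum τ β p + dualSum τ β (p + 1)) / 2) - chirpShift τ β‖ ≤
      Real.exp (π * τ.im * (n - 1 / 2) ^ 2) *
        (‖v‖ / ‖τ‖ * (1 + 2 / 3 * (π - 2) * v.re ^ 2) * Real.exp (2 * π * |(v ^ 2 / τ).im|)) := by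
  have h1 := chirpSum_sub_shift hτ β n p
  have h2 := chirpSum_sub_shift hτ β n (p + 1)
  have e1 : τ * (n - 1 / 2) + β + 1 / 2 - p = v + 1 / 2 := by rw [hv]; ring
  have e2 : τ * (n - 1 / 2) + β + 1 / 2 - (p + 1 : ℕ) = v - 1 / 2 := by rw [hv]; push_cast; ring
  rw [e1] at h1
  rw [e2] at h2
  have h3 := mordell_sub_eq hτ v
  have e3 : chirpSum τ β n + Complex.I * (Complex.I / τ) ^ (1 / 2 : ℂ) *
        ((dualSum τ β p + dualSum τ β (p + 1)) / 2) - chirpShift τ β =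
      (-1) ^ p * Complex.exp (-π * Complex.I * τ * (n ^ 2 - n) - 2 * π * Complex.I * β * n) /
        (2 * (-Complex.I * Complex.exp (π * Complex.I * τ / 4 - π * Complex.I * β))) *
      ∫ x : ℝ, Complex.exp (π * Complex.I * τ * x ^ 2 - 2 * π * v * x) *
        (Real.tanh (π * x) : ℝ) := by
    rw [pow_succ] at h2
    generalize (∫ x : ℝ, Complex.exp (π * Complex.I * τ * x ^ 2 - 2 * π * v * x) *
        (Real.tanh (π * x) : ℝ)) = J at *
    linear_combination h1 / 2 + h2 / 2 + (-1) ^ p *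
      Complex.exp (-π * Complex.I * τ * (n ^ 2 - n) - 2 * π * Complex.I * β * n) /
        (2 * (-Complex.I * Complex.exp (π * Complex.I * τ / 4 - π * Complex.I * β))) * h3 / 2
  rw [e3, norm_mul, norm_chirp_factor]
  calc _ ≤ Real.exp (π * τ.im * (n - 1 / 2) ^ 2) / 2 * (‖v‖ / ‖τ‖ *
        (2 + 4 / 3 * (π - 2) * v.re ^ 2) * Real.exp (2 * π * |(v ^ 2 / τ).im|)) :=
        mul_le_mul_of_nonneg_left (norm_integral_gauss_tanh_le hτ hz) (by positivity)
    _ = _ := by ring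

theorem exists_norm_sub_le_of_tendsto {D : ℕ → ℕ → ℂ} {c : ℕ → ℂ} {B : ℕ → ℕ → ℝ} {D' : ℕ → ℂ}
    {B' : ℕ → ℝ} (hD : ∀ n, Filter.Tendsto (fun m => D m n) Filter.atTop (nhds (D' n)))
    (hB : ∀ n, Filter.Tendsto (fun m => B m n) Filter.atTop (nhds (B' n)))
    (h : ∀ m n, ‖D m n - c m‖ ≤ B m n) : ∃ c0, ∀ n, ‖D' n - c0‖ ≤ B' n := by
  obtain ⟨R, hR⟩ := ((hD 0).norm.add (hB 0)).bddAbove_range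
  have hc : ∀ m, c m ∈ Metric.closedBall (0 : ℂ) R := fun m => by
    rw [mem_closedBall_zero_iff]
    have h1 : ‖D m 0‖ + B m 0 ≤ R := hR ⟨m, rfl⟩
    have h2 := norm_sub_norm_le (c m) (D m 0)
    rw [norm_sub_rev] at h2
    linarith [h m 0]
  obtain ⟨c0, -, φ, hφ, hlim⟩ := tendsto_subseq_of_bounded Metric.isBounded_closedBall hc
  refine ⟨c0, fun n => ?_⟩
  have h1 := (((hD n).comp hφ.tendsto_atTop).sub hlim).norm
  exact le_of_tendsto_of_tendsto' h1 ((hB n).comp hφ.tendsto_atTop) fun m => h _ n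

theorem half_div_cos_le {ω s w : ℝ} (hs : 0 < s) (hω : ω = s ^ 2) (h2 : ω ≤ 1 / 2)
    (hw : |w| ≤ 1 / 2 - 0.415 * s) :
    1 / 2 / Real.cos (π * w) ≤ (0.415 + 0.065 * ω) / s := by
  have hπ1 := Real.pi_gt_d4
  have hπ2 := Real.pi_lt_d4
  have hs1 : s ≤ 0.7072 := by nlinarith
  have hv : 0 < π * (0.415 * s) := by positivity
  have h1 : Real.sin (π * (0.415 * s)) ≤ Real.cos (π * w) := by
    rw [← Real.cos_pi_div_two_sub, ← Real.cos_abs (π * w), abs_mul, abs_of_pos Real.pi_pos]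
    apply Real.cos_le_cos_of_nonneg_of_le_pi (by positivity) (by nlinarith)
    nlinarith
  have h3 := Real.sin_ge_sub_cube hv.le
  have h4 : 1.3037 * s - 0.3695 * s ^ 3 ≤ Real.cos (π * w) := by
    have e1 : 1.3037 * s ≤ π * (0.415 * s) := by nlinarith
    have e2 : π * (0.415 * s) ≤ 1.30378 * s := by nlinarith
    have e3 : (π * (0.415 * s)) ^ 3 ≤ (1.30378 * s) ^ 3 := pow_le_pow_left₀ hv.le e2 3
    have e4 : (1.30378 * s) ^ 3 / 6 ≤ 0.3695 * s ^ 3 := by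
      have := pow_pos hs 3
      rw [mul_pow]; norm_num; nlinarith
    linarith
  have h5 : 0 < 1.3037 * s - 0.3695 * s ^ 3 := by nlinarith
  rw [div_le_div_iff₀ (h5.trans_le h4) hs]
  have h6 : 1 / 2 ≤ (0.415 + 0.065 * ω) * (1.3037 - 0.3695 * ω) := by
    have : 0 ≤ ω := by rw [hω]; positivity
    nlinarith
  calc 1 / 2 * s ≤ (0.415 + 0.065 * ω) * (1.3037 - 0.3695 * ω) * s := by gcongr
    _ = (0.415 + 0.065 * ω) * (1.3037 * s - 0.3695 * s ^ 3) := by rw [hω]; ring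
    _ ≤ _ := by
      have : 0 ≤ ω := by rw [hω]; positivity
      gcongr

theorem avg_error_le {ω s w : ℝ} (hs : 0 < s) (hω : ω = s ^ 2)
    (hw : |w| ≤ 0.415 * s) :
    |w| / ω * (1 + 2 / 3 * (π - 2) * w ^ 2) ≤ (0.415 + 0.065 * ω) / s := by
  have hπ1 := Real.pi_gt_d4
  have hπ2 := Real.pi_lt_d4
  have h1 : w ^ 2 ≤ (0.415 * s) ^ 2 := by rw [← sq_abs w]; gcongr
  have h2 : 1 + 2 / 3 * (π - 2) * w ^ 2 ≤ 1 + 0.15 * s ^ 2 := by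
    have := sq_nonneg w
    nlinarith
  have h0 : 0 ≤ 1 + 2 / 3 * (π - 2) * w ^ 2 := by
    have : 0 ≤ π - 2 := by linarith
    positivity
  calc |w| / ω * (1 + 2 / 3 * (π - 2) * w ^ 2) ≤ 0.415 * s / ω * (1 + 0.15 * s ^ 2) := by
        subst hω; gcongr
    _ = 0.415 * (1 + 0.15 * ω) / s := by subst hω; field_simp
    _ ≤ _ := by
      have : 0 ≤ ω := by rw [hω]; positivity
      gcongr
      linarith

theorem gauss_step {ω β : ℝ} (h0 : 0 < ω) (h1 : ω ≤ 1 / 2) (hβ : 1 ≤ β) :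
    ∃ c0 u : ℂ, ‖u‖ = 1 ∧ ∀ n : ℕ,
      ‖chirpSum ω β n - c0 - u * (1 / √ω : ℝ) *
        ((dualSum ω β (⌊ω * (n - 1 / 2) + β - 0.415 * √ω⌋₊ + 1) +
          dualSum ω β (⌊ω * (n - 1 / 2) + β + 0.415 * √ω⌋₊ + 1)) / 2)‖ ≤
        (0.415 + 0.065 * ω) / √ω := by
  set s := √ω with hsdef
  have hs : 0 < s := Real.sqrt_pos.2 h0
  have hω : ω = s ^ 2 := (Real.sq_sqrt h0.le).symm
  have hs1 : s ≤ 0.7072 := by nlinarith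
  have hω0 : (ω : ℂ) ≠ 0 := by exact_mod_cast h0.ne'
  set τ : ℕ → ℂ := fun m => ω + (1 / ((m : ℝ) + 1) : ℝ) * Complex.I with hτ
  have hlim : Filter.Tendsto τ Filter.atTop (nhds (ω : ℂ)) := by
    have := (Complex.continuous_ofReal.tendsto 0).comp (tendsto_one_div_add_atTop_nhds_zero_nat (𝕜 := ℝ))
    have := (this.mul_const Complex.I).const_add (ω : ℂ)
    simpa [hτ, Function.comp_def] using this
  have him : ∀ m, 0 < (τ m).im := fun m => by
    have : (0 : ℝ) < 1 / ((m : ℝ) + 1) := by positivity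
    simpa only [hτ, Complex.add_im, Complex.ofReal_im, Complex.im_ofReal_mul, Complex.I_im,
      zero_add, mul_one] using this
  have hre : ∀ m, (τ m).re = ω := fun m => by simp [hτ]
  have himlim : Filter.Tendsto (fun m => (τ m).im) Filter.atTop (nhds 0) := by
    have := (Complex.continuous_im.tendsto (ω : ℂ)).comp hlim
    simpa [Function.comp_def] using this
  set P : ℕ → ℕ := fun n => ⌊ω * (n - 1 / 2) + β - 0.415 * s⌋₊ + 1 with hP
  set Q : ℕ → ℕ := fun n => ⌊ω * (n - 1 / 2) + β + 0.415 * s⌋₊ + 1 with hQ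
  set D : ℂ → ℕ → ℂ := fun t n => chirpSum t β n + Complex.I * (Complex.I / t) ^ (1 / 2 : ℂ) *
        ((dualSum t β (P n) + dualSum t β (Q n)) / 2) with hD
  have hroot : ContinuousAt (fun t : ℂ => (Complex.I / t) ^ (1 / 2 : ℂ)) ω := by
    refine ContinuousAt.cpow (continuousAt_const.div continuousAt_id hω0) continuousAt_const ?_
    rw [Complex.mem_slitPlane_iff]
    right
    rw [Complex.div_ofReal_im]
    simp [h0.ne']
  have hdual : ∀ k, ContinuousAt (fun t : ℂ => dualSum t β k) ω := fun k => by
    simp only [dualSum]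
    exact tendsto_finsetSum _ fun j _ => (continuousAt_const.div continuousAt_id hω0).cexp
  have hDc : ∀ n, ContinuousAt (fun t => D t n) ω := fun n => by
    refine ContinuousAt.add ?_ ((continuousAt_const.mul hroot).mul
      (((hdual _).add (hdual _)).div_const 2))
    simp only [chirpSum]
    fun_prop
  have hfac : ∀ n : ℕ, Filter.Tendsto (fun m => Real.exp (π * (τ m).im * ((n : ℝ) - 1 / 2) ^ 2))
      Filter.atTop (nhds 1) := fun n => by
    have := (Real.continuous_exp.tendsto _).comp
      ((himlim.const_mul π).mul_const (((n : ℝ) - 1 / 2) ^ 2))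
    simpa [Function.comp_def] using this
  have key : ∀ n, ∃ B : ℕ → ℝ, ∃ b, b ≤ (0.415 + 0.065 * ω) / s ∧
      Filter.Tendsto B Filter.atTop (nhds b) ∧
      ∀ m, ‖D (τ m) n - chirpShift (τ m) β‖ ≤ B m := by
    intro n
    have hy : 0 ≤ ω * (n - 1 / 2) + β - 0.415 * s := by
      have : 0 ≤ ω * n := by positivity
      nlinarith
    have hf1 := Nat.floor_le hy
    have hf2 := Nat.lt_floor_add_one (ω * (n - 1 / 2) + β - 0.415 * s)
    by_cases hc : ω * (n - 1 / 2) + β + 0.415 * s < P n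
    · have hQP : Q n = P n := by
        have hfe : ⌊ω * (n - 1 / 2) + β + 0.415 * s⌋₊ = ⌊ω * (n - 1 / 2) + β - 0.415 * s⌋₊ := by
          rw [Nat.floor_eq_iff (by linarith)]
          refine ⟨by linarith, ?_⟩
          simpa [hP] using hc
        simp only [hP, hQ, hfe]
      have hpc : (P n : ℝ) = ⌊ω * (n - 1 / 2) + β - 0.415 * s⌋₊ + 1 := by simp [hP]
      have hw : |ω * (n - 1 / 2) + β + 1 / 2 - P n| ≤ 1 / 2 - 0.415 * s := by
        rw [abs_le]; constructor <;> linarith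
      refine ⟨fun m => Real.exp (π * (τ m).im * (n - 1 / 2) ^ 2) *
        (1 / 2 / Real.cos (π * (ω * (n - 1 / 2) + β + 1 / 2 - P n))), _,
        half_div_cos_le hs hω h1 hw, ?_, fun m => ?_⟩
      · simpa using (hfac n).mul_const (1 / 2 / Real.cos (π * (ω * (n - 1 / 2) + β + 1 / 2 - P n)))
      · have := norm_chirpSum_sub_le (him m) β n (P n) (by
          rw [hre]; have : 0 < 0.415 * s := by positivity
          linarith)
        rw [hre] at this
        refine le_trans (le_of_eq ?_) this
        simp only [hD, hQP]
        congr 3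
        ring
    · have hpc : (P n : ℝ) = ⌊ω * (n - 1 / 2) + β - 0.415 * s⌋₊ + 1 := by simp [hP]
      have hQP : Q n = P n + 1 := by
        have hfe : ⌊ω * (n - 1 / 2) + β + 0.415 * s⌋₊ = P n := by
          rw [Nat.floor_eq_iff (by linarith)]
          exact ⟨by linarith, by linarith⟩
        simp only [hQ, hfe]
      have hw : |ω * (n - 1 / 2) + β - P n| ≤ 0.415 * s := by
        rw [abs_le]; constructor <;> linarith
      have hvre : ∀ m, (τ m * (n - 1 / 2) + β - P n : ℂ).re = ω * (n - 1 / 2) + β - P n :=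
        fun m => by
          have : (τ m * (n - 1 / 2) + β - P n : ℂ) =
            τ m * ((n - 1 / 2 : ℝ) : ℂ) + ((β - P n : ℝ) : ℂ) := by push_cast; ring
          rw [this, Complex.add_re, Complex.re_mul_ofReal, Complex.ofReal_re, hre]
          ring
      have hlimv : Filter.Tendsto (fun m => (τ m * (n - 1 / 2) + β - P n : ℂ)) Filter.atTop
          (nhds ((ω * (n - 1 / 2) + β - P n : ℝ) : ℂ)) := by
        have := ((hlim.mul_const ((n : ℂ) - 1 / 2)).add_const (β : ℂ)).sub_const (P n : ℂ)
        convert this using 2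
        push_cast; ring
      refine ⟨fun m => Real.exp (π * (τ m).im * (n - 1 / 2) ^ 2) *
        (‖(τ m * (n - 1 / 2) + β - P n : ℂ)‖ / ‖τ m‖ *
          (1 + 2 / 3 * (π - 2) * (τ m * (n - 1 / 2) + β - P n : ℂ).re ^ 2) *
          Real.exp (2 * π * |((τ m * (n - 1 / 2) + β - P n : ℂ) ^ 2 / τ m).im|)), _,
        avg_error_le hs hω hw, ?_, fun m => ?_⟩
      · have a1 := hlimv.norm.div hlim.norm (by simpa using h0.ne')
        have a2 := (Complex.continuous_im.tendsto _).comp ((hlimv.pow 2).div hlim hω0)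
        have a3 := (Real.continuous_exp.tendsto _).comp (a2.abs.const_mul (2 * π))
        have a4 := (hfac n).mul ((a1.mul_const
          (1 + 2 / 3 * (π - 2) * (ω * (n - 1 / 2) + β - P n) ^ 2)).mul a3)
        simp only [hvre]
        have e1 : (((ω * (n - 1 / 2) + β - P n : ℝ) : ℂ) ^ 2 / (ω : ℂ)).im = 0 := by
          rw [← Complex.ofReal_pow, ← Complex.ofReal_div, Complex.ofReal_im]
        rw [e1, Complex.norm_real, Complex.norm_real, Real.norm_of_nonneg h0.le] at a4
        simpa [Function.comp_def] using a4
      · have := norm_chirpSum_sub_avg_le (him m) β n (P n) rfl (by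
          rw [hvre]; linarith)
        simpa only [hD, hQP] using this
  choose B b hb hBlim hB using key
  obtain ⟨c0, hc0⟩ := exists_norm_sub_le_of_tendsto (D := fun m n => D (τ m) n)
    (c := fun m => chirpShift (τ m) β) (B := fun m n => B n m) (D' := fun n => D ω n)
    (fun n => (hDc n).tendsto.comp hlim) hBlim (fun m n => hB n m)
  refine ⟨c0, -(Complex.I * (Complex.I / ω) ^ (1 / 2 : ℂ) * s), ?_, fun n => ?_⟩
  · rw [norm_neg, norm_mul, norm_mul, Complex.norm_I, one_mul, Complex.norm_real,
      Real.norm_of_nonneg hs.le]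
    have : ‖(Complex.I / ω : ℂ) ^ (1 / 2 : ℂ)‖ = (1 / ω) ^ (1 / 2 : ℝ) := by
      have h := Complex.norm_cpow_of_ne_zero (z := Complex.I / ω) (div_ne_zero Complex.I_ne_zero hω0)
        (1 / 2 : ℂ)
      have e : (1 / 2 : ℂ) = ((1 / 2 : ℝ) : ℂ) := by push_cast; ring
      rw [h, e, Complex.ofReal_re, Complex.ofReal_im]
      simp [Real.norm_of_nonneg h0.le]
    rw [this, ← Real.sqrt_eq_rpow, Real.sqrt_div zero_le_one, Real.sqrt_one, ← hsdef]
    field_simp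
  · refine le_trans (le_of_eq ?_) ((hc0 n).trans (hb n))
    have hsC : (s : ℂ) ≠ 0 := by exact_mod_cast hs.ne'
    change ‖_ - c0 - _ * _ * ((dualSum ω β (P n) + dualSum ω β (Q n)) / 2)‖ = _
    simp only [hD]
    congr 1
    push_cast
    field_simp
    ring

/-- The partial sums of `f` stay within `C √M` of a curve `c0 + √M u K n`, where `K` is monotone
in its real part, has imaginary part bounded by `I`, and gains `1` over each period `M`. -/
def TracksCurve (f : ℕ → ℂ) (M : ℕ) (C I : ℝ) : Prop :=
  ∃ (u c0 : ℂ) (K : ℕ → ℂ), ‖u‖ = 1 ∧ Monotone (fun n => (K n).re) ∧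
    (∀ n, K (n + M) = K n + 1) ∧ (∀ n, |(K n).im| ≤ I) ∧
    ∀ n, ‖∑ m ∈ range n, f m - c0 - √M * u * K n‖ ≤ C * √M

theorem TracksCurve.const_mul {f : ℕ → ℂ} {M : ℕ} {C I : ℝ} (h : TracksCurve f M C I) {w : ℂ}
    (hw : ‖w‖ = 1) : TracksCurve (fun m => w * f m) M C I := by
  obtain ⟨u, c0, K, hu, hm, hp, hi, hb⟩ := h
  refine ⟨w * u, w * c0, K, by rw [norm_mul, hw, hu, one_mul], hm, hp, hi, fun n => ?_⟩
  have e : ∑ m ∈ range n, w * f m - w * c0 - √M * (w * u) * K n =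
      w * (∑ m ∈ range n, f m - c0 - √M * u * K n) := by
    rw [← Finset.mul_sum]; ring
  rw [e, norm_mul, hw, one_mul]
  exact hb n

theorem TracksCurve.conj {f : ℕ → ℂ} {M : ℕ} {C I : ℝ} (h : TracksCurve f M C I) :
    TracksCurve (fun m => starRingEnd ℂ (f m)) M C I := by
  obtain ⟨u, c0, K, hu, hm, hp, hi, hb⟩ := h
  refine ⟨starRingEnd ℂ u, starRingEnd ℂ c0, fun n => starRingEnd ℂ (K n), by simpa using hu,
    by simpa using hm, fun n => by simp [hp], fun n => by simpa using hi n, fun n => ?_⟩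
  rw [← Complex.norm_conj]
  simpa using hb n

theorem TracksCurve.shift {f : ℕ → ℂ} {M : ℕ} {C I : ℝ} (h : TracksCurve f M C I) (l : ℕ) :
    TracksCurve (fun m => f (m + l)) M C I := by
  obtain ⟨u, c0, K, hu, hm, hp, hi, hb⟩ := h
  refine ⟨u, c0 - ∑ m ∈ range l, f m, fun n => K (n + l), hu,
    fun a b hab => hm (Nat.add_le_add_right hab l), fun n => ?_, fun n => hi _, fun n => ?_⟩
  · rw [← hp]; rw [add_right_comm]
  · have e : ∑ m ∈ range n, f (m + l) = ∑ m ∈ range (n + l), f m - ∑ m ∈ range l, f m := by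
      rw [add_comm n l, Finset.sum_range_add, add_sub_cancel_left]
      exact Finset.sum_congr rfl fun m _ => by rw [add_comm]
    rw [e]
    convert hb (n + l) using 2
    ring

/-- The quadratic phase `m ↦ e(ω m² / 2 + β m)`. -/
noncomputable def chirp (ω β : ℝ) (m : ℕ) : ℂ :=
  Complex.exp ((π * (ω * m ^ 2 + 2 * β * m) : ℝ) * Complex.I)

theorem exp_ofReal_mul_I_eq {x y : ℝ} (h : ∃ k : ℤ, x = y + k * (2 * π)) :
    Complex.exp (x * Complex.I) = Complex.exp (y * Complex.I) := by
  obtain ⟨k, hk⟩ := h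
  rw [Complex.exp_eq_exp_iff_exists_int]
  exact ⟨k, by rw [hk]; push_cast; ring⟩

theorem chirp_add_int (ω β : ℝ) (k : ℤ) : chirp ω (β + k) = chirp ω β := by
  ext m
  exact exp_ofReal_mul_I_eq ⟨k * m, by push_cast; ring⟩

theorem chirp_sub_int (ω β : ℝ) (s : ℤ) : chirp (ω - s) (β + s / 2) = chirp ω β := by
  ext m
  obtain ⟨k, hk⟩ : Even ((m : ℤ) * (m + 1)) := Int.even_mul_succ_self _
  refine exp_ofReal_mul_I_eq ⟨-s * (k - m), ?_⟩
  have hk' : (m : ℝ) * (m + 1) = k + k := by exact_mod_cast hk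
  push_cast
  linear_combination -s * π * hk'

theorem conj_chirp (ω β : ℝ) (m : ℕ) : starRingEnd ℂ (chirp ω β m) = chirp (-ω) (-β) m := by
  rw [chirp, chirp, ← Complex.exp_conj, map_mul, Complex.conj_I, Complex.conj_ofReal]
  congr 1; push_cast; ring

theorem tracksCurve_one : TracksCurve (fun _ => 1) 1 0 0 :=
  ⟨1, 0, fun n => n, by simp, fun a b hab => by simpa using hab, fun n => by push_cast; ring,
    fun n => by simp, fun n => by simp⟩

theorem tracksCurve_step {M a : ℕ} (ha : 0 < a) (haM : 2 * a ≤ M) {b : ℝ} {C I : ℝ}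
    (hb1 : 1 ≤ b) (h : TracksCurve (chirp (M / a) (-(b * M / a))) a C I) :
    TracksCurve (chirp (a / M) b) M (C + (0.415 + 0.065 * (a / M)) / √a) I := by
  have ha' : (0 : ℝ) < a := by exact_mod_cast ha
  have hM' : (0 : ℝ) < M := by exact_mod_cast (by omega : 0 < M)
  have hω : (a / M : ℝ) ≤ 1 / 2 := by
    rw [div_le_div_iff₀ hM' two_pos]; exact_mod_cast (by omega : a * 2 ≤ 1 * M)
  have hω0 : (0 : ℝ) < a / M := by positivity
  obtain ⟨c0, u, hu, hs⟩ := gauss_step hω0 hω hb1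
  set w : ℂ := Complex.exp ((π * (b ^ 2 * M / a) : ℝ) * Complex.I) with hwd
  have hw : ‖w‖ = 1 := Complex.norm_exp_ofReal_mul_I _
  obtain ⟨u1, c1, K, hu1, hm, hp, hi, hbd⟩ := h.const_mul hw
  have hdual : ∀ k, dualSum (a / M : ℝ) b k =
      ∑ j ∈ range k, w * chirp (M / a) (-(b * M / a)) j := fun k => by
    refine Finset.sum_congr rfl fun j _ => ?_
    rw [hwd, chirp, ← Complex.exp_add]
    congr 1
    have h1 : (a : ℂ) ≠ 0 := by exact_mod_cast ha.ne'
    have h2 : (M : ℂ) ≠ 0 := by exact_mod_cast hM'.ne'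
    push_cast
    field_simp
    ring
  set s : ℝ := √(a / M : ℝ) with hsd
  have hs0 : 0 < s := Real.sqrt_pos.2 hω0
  have hsM : √(a : ℝ) = s * √(M : ℝ) := by
    rw [hsd, ← Real.sqrt_mul hω0.le]; congr 1; field_simp
  have hsa : 0 < √(a : ℝ) := Real.sqrt_pos.2 ha'
  have hsm : s ≤ 0.7072 := by
    have : s ^ 2 = a / M := Real.sq_sqrt hω0.le
    nlinarith
  have hy : ∀ n : ℕ, 0 ≤ (a / M : ℝ) * (n - 1 / 2) + b - 0.415 * s := fun n => by
    have : 0 ≤ (a / M : ℝ) * n := by positivity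
    nlinarith
  have hshift : ∀ n : ℕ, (a / M : ℝ) * ((n + M : ℕ) - 1 / 2) = (a / M : ℝ) * (n - 1 / 2) + a := by
    intro n; push_cast; field_simp; ring
  have main : TracksCurve (fun m => Complex.exp (-π * Complex.I * (a / M : ℝ) * m ^ 2 -
      2 * π * Complex.I * b * m)) M (C + (0.415 + 0.065 * (a / M)) / √a) I := by
    refine ⟨u * u1, c0 + u * (1 / s : ℝ) * c1, fun n =>
      (K (⌊(a / M : ℝ) * (n - 1 / 2) + b - 0.415 * s⌋₊ + 1) +
        K (⌊(a / M : ℝ) * (n - 1 / 2) + b + 0.415 * s⌋₊ + 1)) / 2,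
      by rw [norm_mul, hu, hu1, one_mul], ?_, ?_, ?_, ?_⟩
    · intro n m hnm
      have hnm' : (n : ℝ) ≤ m := by exact_mod_cast hnm
      have h1 := hm (show ⌊(a / M : ℝ) * (n - 1 / 2) + b - 0.415 * s⌋₊ + 1 ≤
        ⌊(a / M : ℝ) * (m - 1 / 2) + b - 0.415 * s⌋₊ + 1 by gcongr)
      have h2 := hm (show ⌊(a / M : ℝ) * (n - 1 / 2) + b + 0.415 * s⌋₊ + 1 ≤
        ⌊(a / M : ℝ) * (m - 1 / 2) + b + 0.415 * s⌋₊ + 1 by gcongr)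
      simp only [Complex.div_ofNat_re, Complex.add_re] at h1 h2 ⊢
      linarith
    · intro n
      simp only [hshift]
      have e1 : (a / M : ℝ) * (n - 1 / 2) + a + b - 0.415 * s =
        (a / M : ℝ) * (n - 1 / 2) + b - 0.415 * s + a := by ring
      have e2 : (a / M : ℝ) * (n - 1 / 2) + a + b + 0.415 * s =
        (a / M : ℝ) * (n - 1 / 2) + b + 0.415 * s + a := by ring
      have hy2 : 0 ≤ (a / M : ℝ) * (n - 1 / 2) + b + 0.415 * s := by linarith [hy n]
      rw [e1, e2, Nat.floor_add_natCast (hy n), Nat.floor_add_natCast hy2]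
      have e3 : ∀ x, K (x + a + 1) = K (x + 1) + 1 := fun x => by rw [add_right_comm, hp]
      rw [e3, e3]
      ring
    · intro n
      have h1 := abs_le.1 (hi (⌊(a / M : ℝ) * (n - 1 / 2) + b - 0.415 * s⌋₊ + 1))
      have h2 := abs_le.1 (hi (⌊(a / M : ℝ) * (n - 1 / 2) + b + 0.415 * s⌋₊ + 1))
      simp only [Complex.div_ofNat_im, Complex.add_im]
      rw [abs_le]
      constructor <;> linarith [h1.1, h1.2, h2.1, h2.2]
    · intro n
      beta_reduce
      have h0 := hs n
      rw [hdual, hdual] at h0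
      have h1 := hbd (⌊(a / M : ℝ) * (n - 1 / 2) + b - 0.415 * s⌋₊ + 1)
      have h2 := hbd (⌊(a / M : ℝ) * (n - 1 / 2) + b + 0.415 * s⌋₊ + 1)
      generalize (⌊(a / M : ℝ) * (n - 1 / 2) + b - 0.415 * s⌋₊ + 1) = p at *
      generalize (⌊(a / M : ℝ) * (n - 1 / 2) + b + 0.415 * s⌋₊ + 1) = q at *
      generalize (∑ j ∈ range p, w * chirp (M / a) (-(b * M / a)) j) = Gp at *
      generalize (∑ j ∈ range q, w * chirp (M / a) (-(b * M / a)) j) = Gq at *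
      change ‖chirpSum (a / M : ℝ) b n - _ - _‖ ≤ _
      have hsC : (s : ℂ) ≠ 0 := by exact_mod_cast hs0.ne'
      have e : chirpSum (a / M : ℝ) b n - (c0 + u * (1 / s : ℝ) * c1) -
          √M * (u * u1) * ((K p + K q) / 2) =
          (chirpSum (a / M : ℝ) b n - c0 - u * (1 / s : ℝ) * ((Gp + Gq) / 2)) +
          u * (1 / s : ℝ) * (1 / 2 : ℝ) * ((Gp - c1 - √a * u1 * K p) + (Gq - c1 - √a * u1 * K q)) := by
        rw [hsM]
        push_cast
        field_simp
        ring
      have hn : ‖u * (1 / s : ℝ) * (1 / 2 : ℝ)‖ = 1 / s * (1 / 2) := by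
        rw [norm_mul, norm_mul, hu, Complex.norm_real, Complex.norm_real,
          Real.norm_of_nonneg (by positivity), Real.norm_of_nonneg (by positivity), one_mul]
      rw [e]
      calc _ ≤ (0.415 + 0.065 * (a / M : ℝ)) / s + 1 / s * (1 / 2) * (C * √a + C * √a) := by
            refine (norm_add_le _ _).trans (add_le_add h0 ?_)
            rw [norm_mul, hn]
            exact mul_le_mul_of_nonneg_left ((norm_add_le _ _).trans (add_le_add h1 h2))
              (by positivity)
        _ = _ := by
            have : 0 < √(M : ℝ) := Real.sqrt_pos.2 hM'
            rw [hsM]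
            field_simp
            ring
  have hfin := main.conj
  convert hfin using 1
  ext m
  rw [← Complex.exp_conj, chirp]
  congr 1
  simp only [map_sub, map_mul, map_neg, map_pow, Complex.conj_I, Complex.conj_ofReal,
    Complex.conj_natCast, map_ofNat]
  push_cast
  ring

theorem sum_range_periodic {F : ℕ → ℂ} {M : ℕ} (hF : ∀ j, F (j + M) = F j) (k r : ℕ) :
    ∑ j ∈ range (M * k + r), F j = k * ∑ j ∈ range M, F j + ∑ j ∈ range r, F j := by
  induction k with
  | zero => simp
  | succ k ih =>
    have e : M * (k + 1) + r = M + (M * k + r) := by ring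
    rw [e, Finset.sum_range_add]
    have : ∀ j, F (M + j) = F j := fun j => by rw [add_comm, hF]
    simp only [this]
    rw [ih]
    push_cast
    ring

theorem tracksCurve_of_periodic {F : ℕ → ℂ} {M : ℕ} (hM : 0 < M) (hF : ∀ j, F (j + M) = F j)
    {t : ℕ → ℂ} {C I : ℝ} (hC : 0 ≤ C) {G : ℂ} (c0 : ℂ) (hG : ∑ j ∈ range M, F j = G)
    (hGn : G.re ^ 2 + G.im ^ 2 = M)
    (hmono : ∀ r, r + 1 < M → (t r).re ≤ (t (r + 1)).re)
    (hwrap : (t (M - 1)).re ≤ (t 0).re + 1) (him : ∀ r < M, |(t r).im| ≤ I)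
    (hb : ∀ r < M, (∑ j ∈ range r, F j - c0 - G * t r).re ^ 2 +
      (∑ j ∈ range r, F j - c0 - G * t r).im ^ 2 ≤ C ^ 2 * M) :
    TracksCurve F M C I := by
  have hM' : (0 : ℝ) < M := by exact_mod_cast hM
  have hs : 0 < √(M : ℝ) := Real.sqrt_pos.2 hM'
  have hsC : (√(M : ℝ) : ℂ) ≠ 0 := by exact_mod_cast hs.ne'
  have hnorm : ∀ z : ℂ, ‖z‖ = √(z.re ^ 2 + z.im ^ 2) := fun z => by
    rw [Complex.norm_def, Complex.normSq_apply, pow_two, pow_two]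
  refine ⟨G / √(M : ℝ), c0, fun n => (n / M : ℕ) + t (n % M), ?_, ?_, fun n => ?_, fun n => ?_,
    fun n => ?_⟩
  · rw [norm_div, Complex.norm_real, Real.norm_of_nonneg hs.le, hnorm, hGn, div_self hs.ne']
  · refine monotone_nat_of_le_succ fun n => ?_
    simp only [Complex.add_re, Complex.natCast_re]
    by_cases h : n % M + 1 < M
    · have e1 : (n + 1) % M = n % M + 1 := by
        rw [Nat.add_mod, Nat.mod_eq_of_lt (by omega : 1 < M), Nat.mod_eq_of_lt h]
      have e2 : (n + 1) / M = n / M := by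
        rw [Nat.succ_div, if_neg]; · rfl
        intro hd
        rw [Nat.dvd_iff_mod_eq_zero] at hd
        omega
      rw [e1, e2]
      have := hmono _ h
      linarith
    · have hlt := Nat.mod_lt n hM
      have e0 : n % M = M - 1 := by omega
      have e1 : (n + 1) % M = 0 := by
        rw [← Nat.dvd_iff_mod_eq_zero]
        refine ⟨n / M + 1, ?_⟩
        have := Nat.div_add_mod n M
        rw [mul_add]
        omega
      have e2 : (n + 1) / M = n / M + 1 := by
        rw [Nat.succ_div, if_pos (Nat.dvd_of_mod_eq_zero e1)]
      rw [e0, e1, e2]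
      push_cast
      linarith
  · beta_reduce
    rw [Nat.add_div_right _ hM, Nat.add_mod_right]
    push_cast; ring
  · simpa using him _ (Nat.mod_lt n hM)
  · have h := hb _ (Nat.mod_lt n hM)
    have e : ∑ m ∈ range n, F m - c0 - √(M : ℝ) * (G / √(M : ℝ)) * ((n / M : ℕ) + t (n % M)) =
        ∑ j ∈ range (n % M), F j - c0 - G * t (n % M) := by
      conv_lhs => rw [← Nat.div_add_mod n M]
      rw [sum_range_periodic hF, hG, mul_div_cancel₀ _ hsC, Nat.div_add_mod n M]
      ring
    beta_reduce
    rw [e, hnorm]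
    refine (Real.sqrt_le_sqrt h).trans (le_of_eq ?_)
    rw [Real.sqrt_mul (by positivity), Real.sqrt_sq hC]

/-- The general term of the centred quadratic Gauss sum of modulus `M`. -/
noncomputable def gaussTerm (M j : ℕ) : ℂ :=
  Complex.exp ((π * (j * (j - M) / M) : ℝ) * Complex.I)

theorem gaussTerm_add {M : ℕ} (hM : 0 < M) (j : ℕ) : gaussTerm M (j + M) = gaussTerm M j := by
  have hM' : (M : ℝ) ≠ 0 := by exact_mod_cast hM.ne'
  refine exp_ofReal_mul_I_eq ⟨j, ?_⟩
  push_cast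
  field_simp
  ring

theorem gaussTerm_zero (M : ℕ) : gaussTerm M 0 = 1 := by simp [gaussTerm]

theorem gaussTerm_eq {M j : ℕ} {x c s : ℝ} (hx : (j : ℝ) * (j - M) / M * π = -x)
    (hc : Real.cos x = c) (hs : Real.sin x = s) : gaussTerm M j = ⟨c, -s⟩ := by
  rw [gaussTerm, mul_comm π, hx, Complex.exp_mul_I, ← Complex.ofReal_cos, ← Complex.ofReal_sin,
    Real.cos_neg, Real.sin_neg, hc, hs]
  apply Complex.ext <;> simp

theorem tracksCurve_chirp_of_gaussTerm {M : ℕ} (hM : 0 < M) {C I : ℝ}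
    (h : TracksCurve (gaussTerm M) M C I) {β : ℝ} {l : ℤ} (hβ : M * (1 + 2 * β) = 2 * l) :
    TracksCurve (chirp (1 / M) β) M C I := by
  have hM' : (M : ℝ) ≠ 0 := by exact_mod_cast hM.ne'
  obtain ⟨n, hn⟩ : ∃ n : ℕ, l % M = n :=
    ⟨(l % M).toNat, (Int.toNat_of_nonneg (Int.emod_nonneg _ (by omega))).symm⟩
  have hl : (l : ℝ) = M * ((l / M : ℤ) : ℝ) + n := by
    have h1 := Int.mul_ediv_add_emod l M
    rw [hn] at h1
    exact_mod_cast h1.symm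
  have e := (h.shift n).const_mul
    (Complex.norm_exp_ofReal_mul_I (-(π * (n * (n - M) / M) : ℝ)))
  convert e using 1
  rw [← chirp_add_int _ _ (-(l / M))]
  ext m
  have hb : β = l / M - 1 / 2 := by field_simp; linarith
  rw [chirp, gaussTerm, ← Complex.exp_add, hb, hl, ← add_mul, ← Complex.ofReal_add]
  congr 3
  push_cast
  field_simp
  ring

theorem gaussTerm_symm {M j : ℕ} (h : j ≤ M) : gaussTerm M (M - j) = gaussTerm M j := by
  rw [gaussTerm, gaussTerm, Nat.cast_sub h]
  congr 3
  ring

theorem tracksCurve_gaussTerm_two : TracksCurve (gaussTerm 2) 2 0 0.25 := by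
  have g1 : gaussTerm 2 1 = ⟨0, -1⟩ :=
    gaussTerm_eq (x := π / 2) (by push_cast; ring) Real.cos_pi_div_two Real.sin_pi_div_two
  refine tracksCurve_of_periodic (t := fun r => if r = 0 then ⟨0, -1 / 4⟩ else ⟨1 / 2, 1 / 4⟩)
    (by norm_num) (gaussTerm_add (by norm_num)) le_rfl (G := ⟨1, -1⟩) ⟨1 / 4, 1 / 4⟩
    ?_ ?_ ?_ ?_ ?_ ?_
  · simp [Finset.sum_range_succ, gaussTerm_zero, g1, Complex.ext_iff]
  · norm_num
  · intro r hr
    have : r < 1 := by omega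
    interval_cases r; norm_num
  · norm_num
  · intro r hr
    interval_cases r <;> norm_num [abs_le]
  · intro r hr
    interval_cases r <;> norm_num [Finset.sum_range_succ, gaussTerm_zero]

theorem tracksCurve_gaussTerm_three : TracksCurve (gaussTerm 3) 3 0 0.289 := by
  have hx : (2 * π / 3 : ℝ) = π - π / 3 := by ring
  have g1 : gaussTerm 3 1 = ⟨-(1 / 2), -(√3 / 2)⟩ :=
    gaussTerm_eq (x := 2 * π / 3) (by push_cast; ring)
      (by rw [hx, Real.cos_pi_sub, Real.cos_pi_div_three])
      (by rw [hx, Real.sin_pi_sub, Real.sin_pi_div_three])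
  have g2 : gaussTerm 3 2 = ⟨-(1 / 2), -(√3 / 2)⟩ := by
    rw [← g1]; exact gaussTerm_symm (M := 3) (j := 1) (by norm_num)
  have h3 : √3 ^ 2 = (3 : ℝ) := Real.sq_sqrt (by norm_num)
  have h30 : 0 ≤ √3 := Real.sqrt_nonneg 3
  have h31 : √3 ≤ 1.734 := by nlinarith
  refine tracksCurve_of_periodic (t := fun r => if r = 0 then ⟨0, -√3 / 6⟩ else
      if r = 1 then ⟨0, √3 / 6⟩ else ⟨1 / 2, 0⟩)
    (by norm_num) (gaussTerm_add (by norm_num)) le_rfl (G := ⟨0, -√3⟩) ⟨1 / 2, 0⟩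
    ?_ ?_ ?_ ?_ ?_ ?_
  · simp [Finset.sum_range_succ, gaussTerm_zero, g1, g2, Complex.ext_iff]
    constructor <;> ring
  · simp
  · intro r hr
    have : r < 2 := by omega
    interval_cases r <;> norm_num
  · norm_num
  · intro r hr
    interval_cases r <;> norm_num [abs_le] <;> constructor <;> linarith
  · intro r hr
    interval_cases r <;> simp [Finset.sum_range_succ, gaussTerm_zero, g1] <;> ring_nf <;>
      norm_num [h3]

theorem tracksCurve_gaussTerm_four : TracksCurve (gaussTerm 4) 4 0.28 0 := by
  have hx : (3 * π / 4 : ℝ) = π - π / 4 := by ring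
  have g1 : gaussTerm 4 1 = ⟨-(√2 / 2), -(√2 / 2)⟩ :=
    gaussTerm_eq (x := 3 * π / 4) (by push_cast; ring)
      (by rw [hx, Real.cos_pi_sub, Real.cos_pi_div_four])
      (by rw [hx, Real.sin_pi_sub, Real.sin_pi_div_four])
  have g2 : gaussTerm 4 2 = ⟨-1, -0⟩ :=
    gaussTerm_eq (x := π) (by push_cast; ring) Real.cos_pi Real.sin_pi
  have g3 : gaussTerm 4 3 = ⟨-(√2 / 2), -(√2 / 2)⟩ := by
    rw [← g1]; exact gaussTerm_symm (M := 4) (j := 1) (by norm_num)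
  have h2 : √2 ^ 2 = (2 : ℝ) := Real.sq_sqrt (by norm_num)
  have h20 : 0 ≤ √2 := Real.sqrt_nonneg 2
  have h21 : √2 ≤ 1.4143 := by nlinarith
  have h22 : 1.4142 ≤ √2 := by nlinarith
  refine tracksCurve_of_periodic (t := fun r => if r ≤ 1 then ⟨-0.18, 0⟩ else
      if r = 2 then ⟨0.15, 0⟩ else ⟨0.5, 0⟩)
    (by norm_num) (gaussTerm_add (by norm_num)) (by norm_num) (G := ⟨-√2, -√2⟩)
    ⟨0.177 * √2, -0.177 * √2⟩ ?_ ?_ ?_ ?_ ?_ ?_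
  · simp [Finset.sum_range_succ, gaussTerm_zero, g1, g2, g3, Complex.ext_iff]
    ring
  · simp
    norm_num
  · intro r hr
    have : r < 3 := by omega
    interval_cases r <;> norm_num
  · norm_num
  · intro r hr
    interval_cases r <;> norm_num [abs_le]
  · intro r hr
    interval_cases r <;> simp [Finset.sum_range_succ, gaussTerm_zero, g1, g2] <;>
      nlinarith

theorem tracksCurve_gaussTerm_five : TracksCurve (gaussTerm 5) 5 0.346 0 := by
  have h5 : √5 ^ 2 = (5 : ℝ) := Real.sq_sqrt (by norm_num)
  have h50 : 0 ≤ √5 := Real.sqrt_nonneg 5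
  have h51 : √5 ≤ 2.2361 := by nlinarith
  have h52 : 2.236 ≤ √5 := by nlinarith
  obtain ⟨s, hs⟩ : ∃ s, s = Real.sin (π / 5) := ⟨_, rfl⟩
  have hc := Real.cos_pi_div_five
  have hs0 : 0 ≤ s := hs ▸ Real.sin_nonneg_of_nonneg_of_le_pi (by positivity) (by linarith [Real.pi_pos])
  have hsq : s ^ 2 = (10 - 2 * √5) / 16 := by
    have := Real.sin_sq_add_cos_sq (π / 5)
    rw [← hs, hc] at this
    linear_combination this - h5 / 16
  have hs1 : s ≤ 0.588 := by nlinarith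
  have hs2 : 0.5877 ≤ s := by nlinarith
  have hx1 : (4 * π / 5 : ℝ) = π - π / 5 := by ring
  have hx2 : (6 * π / 5 : ℝ) = π / 5 + π := by ring
  have g1 : gaussTerm 5 1 = ⟨-((1 + √5) / 4), -s⟩ :=
    gaussTerm_eq (x := 4 * π / 5) (by push_cast; ring)
      (by rw [hx1, Real.cos_pi_sub, hc]) (by rw [hx1, Real.sin_pi_sub, hs])
  have g2 : gaussTerm 5 2 = ⟨-((1 + √5) / 4), - -s⟩ :=
    gaussTerm_eq (x := 6 * π / 5) (by push_cast; ring)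
      (by rw [hx2, Real.cos_add_pi, hc]) (by rw [hx2, Real.sin_add_pi, hs])
  have g3 : gaussTerm 5 3 = ⟨-((1 + √5) / 4), - -s⟩ := by
    rw [← g2]; exact gaussTerm_symm (M := 5) (j := 2) (by norm_num)
  have g4 : gaussTerm 5 4 = ⟨-((1 + √5) / 4), -s⟩ := by
    rw [← g1]; exact gaussTerm_symm (M := 5) (j := 1) (by norm_num)
  refine tracksCurve_of_periodic (t := fun r => if r ≤ 1 then ⟨-0.22, 0⟩ else
      if r = 2 then ⟨-0.085, 0⟩ else if r = 3 then ⟨0.276, 0⟩ else ⟨0.638, 0⟩)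
    (by norm_num) (gaussTerm_add (by norm_num)) (by norm_num) (G := ⟨-√5, 0⟩)
    ⟨0, 0⟩ ?_ ?_ ?_ ?_ ?_ ?_
  · simp [Finset.sum_range_succ, gaussTerm_zero, g1, g2, g3, g4, Complex.ext_iff]
    ring
  · simp
  · intro r hr
    have : r < 4 := by omega
    interval_cases r <;> norm_num
  · norm_num
  · intro r hr
    interval_cases r <;> norm_num [abs_le]
  · intro r hr
    interval_cases r <;> simp [Finset.sum_range_succ, gaussTerm_zero, g1, g2, g3] <;>
      nlinarith

theorem tracksCurve_gaussTerm_six : TracksCurve (gaussTerm 6) 6 0.39 0 := by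
  have h3 : √3 ^ 2 = (3 : ℝ) := Real.sq_sqrt (by norm_num)
  have h30 : 0 ≤ √3 := Real.sqrt_nonneg 3
  have h31 : √3 ≤ 1.7321 := by nlinarith
  have h32 : 1.732 ≤ √3 := by nlinarith
  have hx1 : (5 * π / 6 : ℝ) = π - π / 6 := by ring
  have hx2 : (4 * π / 3 : ℝ) = π / 3 + π := by ring
  have hx3 : (3 * π / 2 : ℝ) = π / 2 + π := by ring
  have g1 : gaussTerm 6 1 = ⟨-(√3 / 2), -(1 / 2)⟩ :=
    gaussTerm_eq (x := 5 * π / 6) (by push_cast; ring)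
      (by rw [hx1, Real.cos_pi_sub, Real.cos_pi_div_six])
      (by rw [hx1, Real.sin_pi_sub, Real.sin_pi_div_six])
  have g2 : gaussTerm 6 2 = ⟨-(1 / 2), -(-(√3 / 2))⟩ :=
    gaussTerm_eq (x := 4 * π / 3) (by push_cast; ring)
      (by rw [hx2, Real.cos_add_pi, Real.cos_pi_div_three])
      (by rw [hx2, Real.sin_add_pi, Real.sin_pi_div_three])
  have g3 : gaussTerm 6 3 = ⟨-0, - -1⟩ :=
    gaussTerm_eq (x := 3 * π / 2) (by push_cast; ring)
      (by rw [hx3, Real.cos_add_pi, Real.cos_pi_div_two])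
      (by rw [hx3, Real.sin_add_pi, Real.sin_pi_div_two])
  have g4 : gaussTerm 6 4 = ⟨-(1 / 2), -(-(√3 / 2))⟩ := by
    rw [← g2]; exact gaussTerm_symm (M := 6) (j := 2) (by norm_num)
  have g5 : gaussTerm 6 5 = ⟨-(√3 / 2), -(1 / 2)⟩ := by
    rw [← g1]; exact gaussTerm_symm (M := 6) (j := 1) (by norm_num)
  refine tracksCurve_of_periodic (t := fun r => if r ≤ 2 then ⟨-0.144, 0⟩ else
      if r = 3 then ⟨0.211, 0⟩ else if r = 4 then ⟨0.5, 0⟩ else ⟨0.856, 0⟩)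
    (by norm_num) (gaussTerm_add (by norm_num)) (by norm_num) (G := ⟨-√3, √3⟩)
    ⟨0.14 * √3, 0.14 * √3⟩ ?_ ?_ ?_ ?_ ?_ ?_
  · simp [Finset.sum_range_succ, gaussTerm_zero, g1, g2, g3, g4, g5, Complex.ext_iff]
    constructor <;> ring
  · simp
    norm_num
  · intro r hr
    have : r < 5 := by omega
    interval_cases r <;> norm_num
  · norm_num
  · intro r hr
    interval_cases r <;> norm_num [abs_le]
  · intro r hr
    interval_cases r <;> simp [Finset.sum_range_succ, gaussTerm_zero, g1, g2, g3, g4] <;>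
      nlinarith

/-- A uniform quality of approximation, with the slack needed for one more reciprocity step. -/
def TracksWell (f : ℕ → ℂ) (M : ℕ) (ω : ℝ) : Prop :=
  ∃ C I : ℝ, 0 ≤ C ∧ 0 ≤ I ∧ TracksCurve f M C I ∧
    C + 0.12 * I + (1.345 - 0.2 * ω) / √M ≤ 0.93

theorem step_slack {ω ω' s : ℝ} (hs : 0 < s) (hω : ω = s ^ 2) (h' : ω' ≤ 1 / 2)
    (h1 : 1 / ω ≥ 2 + ω') (h0 : 0 < ω') :
    0.415 + 0.065 * ω + (1.345 - 0.2 * ω) * s ≤ 1.345 - 0.2 * ω' := by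
  have hω0 : 0 < ω := by rw [hω]; positivity
  rw [ge_iff_le, le_div_iff₀ hω0] at h1
  have h2 : ω ≤ 1 / 2 := by nlinarith
  rcases le_total ω 0.4 with h | h
  · have hs1 : s ≤ 0.63246 := by nlinarith
    subst hω
    nlinarith
  · have hs2 : s ≤ 0.70711 := by nlinarith
    have hs1 : 0.6324 ≤ s := by nlinarith
    have h3 : ω' * ω ≤ 1 - 2 * ω := by linarith
    have h4 : ω * (0.415 + 0.065 * ω + (1.345 - 0.2 * ω) * s) ≤ 1.745 * ω - 0.2 := by
      have h6 : s ≤ 0.7463 * ω + 0.335 := by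
        subst hω
        nlinarith [sq_nonneg (s - 0.67)]
      have h7 : 0 ≤ ω * (1.345 - 0.2 * ω) := by nlinarith
      nlinarith [mul_le_mul_of_nonneg_left h6 h7, mul_nonneg (sub_nonneg.2 h) (sub_nonneg.2 h2)]
    nlinarith

theorem tracksWell_one_of_gaussTerm {M : ℕ} (hM : 0 < M) {C I : ℝ} (hC : 0 ≤ C) (hI : 0 ≤ I)
    (h : TracksCurve (gaussTerm M) M C I) {s : ℝ} (hs : 0 < s) (hsM : s ^ 2 ≤ M)
    (hnum : C + 0.12 * I + (1.345 - 0.2 * (1 / M)) / s ≤ 0.93) {β : ℝ} {l : ℤ}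
    (hβ : M * (1 + 2 * β) = 2 * l) : TracksWell (chirp (1 / M) β) M (1 / M) := by
  refine ⟨C, I, hC, hI, tracksCurve_chirp_of_gaussTerm hM h hβ, le_trans ?_ hnum⟩
  have h1 : s ≤ √M := Real.le_sqrt_of_sq_le hsM
  have h2 : 1 / (M : ℝ) ≤ 1 := by
    rw [div_le_one (by exact_mod_cast hM)]; exact_mod_cast hM
  have h3 : 0 ≤ 1.345 - 0.2 * (1 / (M : ℝ)) := by linarith
  gcongr

theorem tracksWell_one {M : ℕ} (hM : 2 ≤ M) {β : ℝ} {l : ℤ} (hβ : M * (1 + 2 * β) = 2 * l) :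
    TracksWell (chirp (1 / M) β) M (1 / M) := by
  wlog hβ1 : 1 ≤ β generalizing β l
  · rw [← chirp_add_int _ _ ⌈1 - β⌉]
    refine this (l := l + M * ⌈1 - β⌉) ?_ (by have := Int.le_ceil (1 - β); linarith)
    push_cast
    linear_combination hβ
  rcases Nat.lt_or_ge M 7 with h | h
  · interval_cases M
    · exact tracksWell_one_of_gaussTerm (by norm_num) (by norm_num) (by norm_num)
        tracksCurve_gaussTerm_two (s := 1.4142) (by norm_num) (by norm_num) (by norm_num) hβ
    · exact tracksWell_one_of_gaussTerm (by norm_num) (by norm_num) (by norm_num)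
        tracksCurve_gaussTerm_three (s := 1.732) (by norm_num) (by norm_num) (by norm_num) hβ
    · exact tracksWell_one_of_gaussTerm (by norm_num) (by norm_num) (by norm_num)
        tracksCurve_gaussTerm_four (s := 2) (by norm_num) (by norm_num) (by norm_num) hβ
    · exact tracksWell_one_of_gaussTerm (by norm_num) (by norm_num) (by norm_num)
        tracksCurve_gaussTerm_five (s := 2.236) (by norm_num) (by norm_num) (by norm_num) hβ
    · exact tracksWell_one_of_gaussTerm (by norm_num) (by norm_num) (by norm_num)
        tracksCurve_gaussTerm_six (s := 2.4494) (by norm_num) (by norm_num) (by norm_num) hβ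
  · have hs : 2.6457 ≤ √(M : ℝ) := by
      apply Real.le_sqrt_of_sq_le
      have : (7 : ℝ) ≤ M := by exact_mod_cast h
      norm_num; linarith
    have hM7 : (1 : ℝ) / M ≤ 1 / 7 := by
      have : (7 : ℝ) ≤ M := by exact_mod_cast h
      gcongr
    have hM0 : (0 : ℝ) < 1 / M := by positivity
    have key := tracksCurve_step (M := M) (a := 1) (b := β) (C := 0) (I := 0) one_pos (by omega) hβ1
      (by
        convert tracksCurve_one using 1
        ext m
        rw [chirp]
        obtain ⟨e, he⟩ : Even ((m : ℤ) * (m - 1)) := by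
          have := Int.even_mul_succ_self (m - 1 : ℤ)
          rwa [sub_add_cancel, mul_comm] at this
        have he' : (m : ℝ) * (m - 1) = e + e := by exact_mod_cast he
        rw [exp_ofReal_mul_I_eq (y := 0) ⟨M * e + M * m - l * m, ?_⟩]
        · simp
        · push_cast
          linear_combination π * M * he' - π * m * hβ)
    rw [Nat.cast_one, Real.sqrt_one] at key
    refine ⟨_, 0, ?_, le_rfl, key, ?_⟩
    · positivity
    · have h3 : (1.345 - 0.2 * (1 / (M : ℝ))) / √M ≤ (1.345 - 0.2 * (1 / (M : ℝ))) / 2.6457 := by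
        have : 0 ≤ 1.345 - 0.2 * (1 / (M : ℝ)) := by linarith
        gcongr
      have h4 : (1.345 - 0.2 * (1 / (M : ℝ))) / 2.6457 = 1.345 / 2.6457 - 0.2 / 2.6457 * (1 / M) := by
        ring
      have h5 : (1.345 : ℝ) / 2.6457 ≤ 0.50838 := by norm_num
      have h6 : (0.0755 : ℝ) ≤ 0.2 / 2.6457 := by norm_num
      nlinarith

theorem TracksWell.conj {f : ℕ → ℂ} {M : ℕ} {ω : ℝ} (h : TracksWell f M ω) :
    TracksWell (fun m => starRingEnd ℂ (f m)) M ω := by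
  obtain ⟨C, I, hC, hI, hf, hn⟩ := h
  exact ⟨C, I, hC, hI, hf.conj, hn⟩


theorem tracksWell_of_int {M : ℕ} (hM : 2 ≤ M)
    (ih : ∀ a : ℕ, 0 < a → 2 * a ≤ M → a.Coprime M → ∀ (β : ℝ) (l : ℤ),
      M * (a + 2 * β) = 2 * l → TracksWell (chirp (a / M) β) M (a / M))
    {A : ℤ} (hA : IsCoprime A M) {β : ℝ} {l : ℤ} (hβ : M * (A + 2 * β) = 2 * l) :
    ∃ (ω : ℝ) (s : ℤ), 0 < ω ∧ ω ≤ 1 / 2 ∧ |(A / M : ℝ) - s| = ω ∧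
      TracksWell (chirp (A / M) β) M ω := by
  have hM' : (0 : ℝ) < M := by exact_mod_cast (by omega : 0 < M)
  obtain ⟨e, he⟩ : Even ((M : ℤ) * (M - 1)) := by
    have := Int.even_mul_succ_self (M - 1 : ℤ)
    rwa [sub_add_cancel, mul_comm] at this
  have he' : (M : ℝ) * (M - 1) = e + e := by exact_mod_cast he
  obtain ⟨s, r, hr, hAr⟩ : ∃ (s : ℤ) (r : ℕ), 2 * r ≤ M ∧ (A = M * s + r ∨ A = M * s - r) := by
    have h1 := Int.mul_ediv_add_emod A M
    have h2 := Int.emod_nonneg A (by omega : (M : ℤ) ≠ 0)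
    have h3 := Int.emod_lt_of_pos A (by omega : (0 : ℤ) < M)
    rcases le_or_gt (2 * (A % M)) M with h | h
    · exact ⟨A / M, (A % M).toNat, by omega, Or.inl (by omega)⟩
    · refine ⟨A / M + 1, (M - A % M).toNat, by omega, Or.inr ?_⟩
      rw [mul_add]
      omega
  have hcop : r.Coprime M := by
    rw [← Nat.isCoprime_iff_coprime]
    rcases hAr with h | h
    · have e1 : (r : ℤ) = A + M * -s := by rw [h]; ring
      rw [e1]; exact IsCoprime.add_mul_left_left hA _
    · have e1 : (r : ℤ) = -A + M * s := by rw [h]; ring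
      rw [e1]; exact IsCoprime.add_mul_left_left hA.neg_left _
  have hr0 : 0 < r := by
    rcases Nat.eq_zero_or_pos r with h | h
    · rw [h, Nat.coprime_zero_left] at hcop; omega
    · exact h
  have hr0' : (0 : ℝ) < r := by exact_mod_cast hr0
  have hω : (r / M : ℝ) ≤ 1 / 2 := by
    rw [div_le_div_iff₀ hM' two_pos]; exact_mod_cast (by omega : r * 2 ≤ 1 * M)
  refine ⟨r / M, s, by positivity, hω, ?_⟩
  rw [← chirp_sub_int _ β s]
  rcases hAr with h | h
  · have e1 : (A / M : ℝ) - s = r / M := by rw [h]; push_cast; field_simp; ring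
    rw [e1]
    refine ⟨abs_of_pos (by positivity), ih r hr0 hr hcop _ (l - s * e) ?_⟩
    rw [h] at hβ
    push_cast at hβ ⊢
    linear_combination hβ - s * he'
  · have e1 : (A / M : ℝ) - s = -(r / M) := by rw [h]; push_cast; field_simp; ring
    rw [e1]
    refine ⟨by rw [abs_neg]; exact abs_of_pos (by positivity), ?_⟩
    have := (ih r hr0 hr hcop (-(β + s / 2)) (-l + s * e) (by
      rw [h] at hβ
      push_cast at hβ ⊢
      linear_combination -hβ + s * he')).conj
    simpa only [conj_chirp, neg_neg] using this

theorem tracksWell_of_le_half (M : ℕ) (hM : 2 ≤ M) : ∀ a : ℕ, 0 < a → 2 * a ≤ M → a.Coprime M →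
    ∀ (β : ℝ) (l : ℤ), M * (a + 2 * β) = 2 * l → TracksWell (chirp (a / M) β) M (a / M) := by
  induction M using Nat.strong_induction_on with
  | _ M ih =>
  intro a ha haM hcop β l hβ
  rcases Nat.lt_or_ge a 2 with h | h
  · obtain rfl : a = 1 := by omega
    simpa using tracksWell_one hM (β := β) (l := l) (by simpa using hβ)
  wlog hβ1 : 1 ≤ β generalizing β l
  · rw [← chirp_add_int _ _ ⌈1 - β⌉]
    refine this _ (l + M * ⌈1 - β⌉) ?_ (by have := Int.le_ceil (1 - β); linarith)
    push_cast
    linear_combination hβ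
  have ha' : (0 : ℝ) < a := by exact_mod_cast ha
  have hM' : (0 : ℝ) < M := by exact_mod_cast (by omega : 0 < M)
  obtain ⟨ω', s, h0, h1, hs, C, I, hC, hI, hT, hn⟩ := tracksWell_of_int h (ih a (by omega) h)
    (A := M) (Nat.isCoprime_iff_coprime.2 hcop.symm) (β := -(β * M / a)) (l := a * M - l) (by
      push_cast
      field_simp
      linear_combination -hβ)
  have key := tracksCurve_step ha haM hβ1 (by simpa using hT)
  refine ⟨_, I, by positivity, hI, key, ?_⟩
  have hω0 : (0 : ℝ) < a / M := by positivity
  have h2 : (2 : ℝ) ≤ M / a := by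
    rw [le_div_iff₀ ha']; exact_mod_cast haM
  have h3 : 1 / (a / M : ℝ) ≥ 2 + ω' := by
    rw [one_div_div]
    push_cast at hs
    have hs2 : 2 ≤ s := by
      by_contra! hc
      have : (s : ℝ) ≤ 1 := by exact_mod_cast (by omega : s ≤ 1)
      have := le_abs_self ((M / a : ℝ) - s)
      linarith
    rcases hs2.eq_or_lt with h4 | h4
    · rw [← h4] at hs
      push_cast at hs
      rw [abs_of_nonneg (by linarith)] at hs
      linarith
    · have : (3 : ℝ) ≤ s := by exact_mod_cast h4
      have := neg_abs_le ((M / a : ℝ) - s)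
      linarith
  have hsq : √(a / M : ℝ) ^ 2 = a / M := Real.sq_sqrt hω0.le
  have slack := step_slack (Real.sqrt_pos.2 hω0) hsq.symm h1 h3 h0
  have hsa : 0 < √(a : ℝ) := Real.sqrt_pos.2 ha'
  have hsM : (1.345 - 0.2 * (a / M : ℝ)) / √M = (1.345 - 0.2 * (a / M : ℝ)) * √(a / M : ℝ) / √a := by
    have : 0 < √(M : ℝ) := Real.sqrt_pos.2 hM'
    rw [Real.sqrt_div ha'.le]
    field_simp
  rw [hsM]
  have : (0.415 + 0.065 * (a / M : ℝ)) / √a + (1.345 - 0.2 * (a / M : ℝ)) * √(a / M : ℝ) / √a ≤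
      (1.345 - 0.2 * ω') / √a := by
    rw [← add_div]
    gcongr
  linarith

theorem sum_mul_sub_eq (w Z : ℕ → ℂ) (L : ℕ) :
    ∑ n ∈ range (L + 1), w n * (Z (n + 1) - Z n) =
      w L * Z (L + 1) - w 0 * Z 0 - ∑ n ∈ range L, (w (n + 1) - w n) * Z (n + 1) := by
  induction L with
  | zero => simp; ring
  | succ L ih => rw [sum_range_succ, ih, sum_range_succ _ L]; ring

theorem norm_sum_mul_sub_le {w Z : ℕ → ℂ} {L : ℕ} {A B V R : ℝ} (h0 : ‖w 0‖ ≤ A) (hL : ‖w L‖ ≤ B)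
    (hV : ∑ n ∈ range L, ‖w (n + 1) - w n‖ ≤ V) (hZ : ∀ n, ‖Z n‖ ≤ R) :
    ‖∑ n ∈ range (L + 1), w n * (Z (n + 1) - Z n)‖ ≤ (A + B + V) * R := by
  have hR : 0 ≤ R := (norm_nonneg _).trans (hZ 0)
  rw [sum_mul_sub_eq]
  calc _ ≤ ‖w L * Z (L + 1)‖ + ‖w 0 * Z 0‖ + ‖∑ n ∈ range L, (w (n + 1) - w n) * Z (n + 1)‖ :=
        (norm_sub_le _ _).trans (add_le_add_left (norm_sub_le _ _) _)
    _ ≤ B * R + A * R + V * R := by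
        refine add_le_add (add_le_add ?_ ?_) ?_
        · rw [norm_mul]; exact mul_le_mul hL (hZ _) (norm_nonneg _) ((norm_nonneg _).trans hL)
        · rw [norm_mul]; exact mul_le_mul h0 (hZ _) (norm_nonneg _) ((norm_nonneg _).trans h0)
        · refine (norm_sum_le _ _).trans (le_trans ?_ (mul_le_mul_of_nonneg_right hV hR))
          rw [Finset.sum_mul]
          exact Finset.sum_le_sum fun n _ => by
            rw [norm_mul]; exact mul_le_mul_of_nonneg_left (hZ _) (norm_nonneg _)
    _ = _ := by ring

theorem norm_exp_sub_exp_le (x y : ℝ) :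
    ‖Complex.exp (x * Complex.I) - Complex.exp (y * Complex.I)‖ ≤ |x - y| := by
  have e : Complex.exp (x * Complex.I) - Complex.exp (y * Complex.I) =
      Complex.exp (y * Complex.I) * (Complex.exp (Complex.I * (x - y : ℝ)) - 1) := by
    rw [mul_sub, ← Complex.exp_add, mul_one]
    congr 2
    push_cast; ring
  rw [e, norm_mul, Complex.norm_exp_ofReal_mul_I, one_mul]
  exact Real.norm_exp_I_mul_ofReal_sub_one_le

/-- A curve that advances by at least two periods forces a lower bound on slowly modulated sums. -/
theorem TracksCurve.le_norm_sum {g : ℕ → ℂ} {M L : ℕ} {C I V : ℝ} {θ : ℕ → ℝ}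
    (h : TracksCurve g M C I) (hC : 0 ≤ C) (hI : 0 ≤ I) (hCI : C + 0.12 * I ≤ 0.93)
    (hM : 0 < M) (hL : 2 * M ≤ L + 1) (h0 : θ 0 = 0)
    (hV : ∑ n ∈ range L, |θ (n + 1) - θ n| ≤ V) (hV1 : V ≤ 0.1257) :
    0.003 * ((L + 1) / M : ℕ) * √M ≤ ‖∑ n ∈ range (L + 1), Complex.exp (θ n * Complex.I) * g n‖ := by
  obtain ⟨u, c0, K, hu, hm, hp, hi, hb⟩ := h
  have hs : 0 < √(M : ℝ) := Real.sqrt_pos.2 (by exact_mod_cast hM)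
  have hV0 : 0 ≤ V := (Finset.sum_nonneg fun _ _ => abs_nonneg _).trans hV
  set w : ℕ → ℂ := fun n => Complex.exp (θ n * Complex.I) with hw
  set E : ℕ → ℂ := fun n => ∑ m ∈ range n, g m - c0 - √M * u * K n with hE
  have hθ : ∀ n ≤ L, |θ n| ≤ V := fun n hn => by
    have e : θ n = ∑ k ∈ range n, (θ (k + 1) - θ k) := by rw [Finset.sum_range_sub, h0, sub_zero]
    rw [e]
    refine (Finset.abs_sum_le_sum_abs _ _).trans (le_trans ?_ hV)
    exact Finset.sum_le_sum_of_subset_of_nonneg (Finset.range_subset_range.2 hn)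
      fun _ _ _ => abs_nonneg _
  have hwV : ∑ n ∈ range L, ‖w (n + 1) - w n‖ ≤ V :=
    (Finset.sum_le_sum fun n _ => norm_exp_sub_exp_le _ _).trans hV
  have hw1 : ∀ n, ‖w n‖ = 1 := fun n => Complex.norm_exp_ofReal_mul_I _
  have hwre : ∀ n, (w n).re = Real.cos (θ n) := fun n => Complex.exp_ofReal_mul_I_re _
  have hwim : ∀ n, (w n).im = Real.sin (θ n) := fun n => Complex.exp_ofReal_mul_I_im _
  have hsplit : ∑ n ∈ range (L + 1), w n * g n =
      √M * u * ∑ n ∈ range (L + 1), w n * (K (n + 1) - K n) +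
        ∑ n ∈ range (L + 1), w n * (E (n + 1) - E n) := by
    rw [Finset.mul_sum, ← Finset.sum_add_distrib]
    refine Finset.sum_congr rfl fun n _ => ?_
    simp only [hE, Finset.sum_range_succ]
    ring
  have hErr : ‖∑ n ∈ range (L + 1), w n * (E (n + 1) - E n)‖ ≤ (1 + 1 + V) * (C * √M) :=
    norm_sum_mul_sub_le (hw1 0).le (hw1 L).le hwV hb
  have hIm : ‖∑ n ∈ range (L + 1), ((w n).im : ℂ) *
      (((K (n + 1)).im : ℂ) - ((K n).im : ℂ))‖ ≤ (0 + V + V) * I := by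
    refine norm_sum_mul_sub_le (w := fun n => ((w n).im : ℂ)) (Z := fun n => ((K n).im : ℂ))
      ?_ ?_ (le_trans (Finset.sum_le_sum fun n _ => ?_) hwV) fun n => ?_
    · simp [hwim, h0]
    · rw [Complex.norm_real, Real.norm_eq_abs, hwim]
      exact Real.abs_sin_le_abs.trans (hθ L le_rfl)
    · rw [← Complex.ofReal_sub, Complex.norm_real, ← Complex.sub_im]
      exact Complex.abs_im_le_norm _
    · rw [Complex.norm_real]; exact hi n
  have hK : ∀ k : ℕ, K (k * M) = K 0 + k := fun k => by
    induction k with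
    | zero => simp
    | succ k ih => rw [add_mul, one_mul, hp, ih]; push_cast; ring
  have hadv : (((L + 1) / M : ℕ) : ℝ) ≤ (K (L + 1)).re - (K 0).re := by
    have h1 := hm (Nat.div_mul_le_self (L + 1) M)
    simp only [hK, Complex.add_re, Complex.natCast_re] at h1
    linarith
  have hre : 0.992 * ((K (L + 1)).re - (K 0).re) ≤
      ∑ n ∈ range (L + 1), (w n).re * ((K (n + 1)).re - (K n).re) := by
    rw [← Finset.sum_range_sub (fun n => (K n).re), Finset.mul_sum]
    refine Finset.sum_le_sum fun n hn => mul_le_mul_of_nonneg_right ?_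
      (sub_nonneg.2 (hm (Nat.le_succ n)))
    rw [hwre]
    have h1 := Real.one_sub_sq_div_two_le_cos (x := θ n)
    have h2 := hθ n (by rw [Finset.mem_range] at hn; omega)
    have h3 : θ n ^ 2 ≤ V ^ 2 := by rw [← sq_abs]; gcongr
    nlinarith
  have hmain : 0.992 * (((L + 1) / M : ℕ) : ℝ) - 2 * V * I ≤
      ‖∑ n ∈ range (L + 1), w n * (K (n + 1) - K n)‖ := by
    refine le_trans ?_ (Complex.re_le_norm _)
    have e : (∑ n ∈ range (L + 1), w n * (K (n + 1) - K n)).re =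
        ∑ n ∈ range (L + 1), (w n).re * ((K (n + 1)).re - (K n).re) -
        (∑ n ∈ range (L + 1), ((w n).im : ℂ) * (((K (n + 1)).im : ℂ) - ((K n).im : ℂ))).re := by
      rw [Complex.re_sum, Complex.re_sum, ← Finset.sum_sub_distrib]
      refine Finset.sum_congr rfl fun n _ => ?_
      simp
    have := Complex.re_le_norm
      (∑ n ∈ range (L + 1), ((w n).im : ℂ) * (((K (n + 1)).im : ℂ) - ((K n).im : ℂ)))
    rw [e]
    linarith
  have htwo : (2 : ℝ) ≤ (((L + 1) / M : ℕ) : ℝ) := by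
    exact_mod_cast (Nat.le_div_iff_mul_le hM).2 hL
  rw [hsplit]
  have h1 := norm_sub_le_norm_add (√M * u * ∑ n ∈ range (L + 1), w n * (K (n + 1) - K n))
    (∑ n ∈ range (L + 1), w n * (E (n + 1) - E n))
  rw [norm_mul, norm_mul, hu, mul_one, Complex.norm_real, Real.norm_of_nonneg hs.le] at h1
  have h2 := mul_le_mul_of_nonneg_left hmain hs.le
  have h3 : 0.003 * (((L + 1) / M : ℕ) : ℝ) ≤
      0.992 * (((L + 1) / M : ℕ) : ℝ) - 2 * V * I - (1 + 1 + V) * C := by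
    nlinarith
  nlinarith [mul_le_mul_of_nonneg_right h3 hs.le]

theorem sum_abs_phase_sub_le {N L : ℕ} (hN : N = L + 1) {η δ : ℝ} (hη : |η| ≤ 1 / (100 * N))
    (hδ : |δ| ≤ 1 / (100 * (N : ℝ) ^ 2)) :
    ∑ n ∈ range L, |2 * π * (η * ((n + 1 : ℕ) + 1) + δ * ((n + 1 : ℕ) + 1) ^ 2 - η - δ) -
      2 * π * (η * (n + 1) + δ * (n + 1) ^ 2 - η - δ)| ≤ 0.1257 := by
  have hN' : (0 : ℝ) < N := by exact_mod_cast (by omega : 0 < N)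
  have hterm : ∀ n ∈ range L, |2 * π * (η * ((n + 1 : ℕ) + 1) + δ * ((n + 1 : ℕ) + 1) ^ 2 - η - δ) -
      2 * π * (η * (n + 1) + δ * (n + 1) ^ 2 - η - δ)| ≤
      2 * π * (1 / (100 * N)) + 2 * π * (1 / (100 * (N : ℝ) ^ 2)) *
        (((n + 1 : ℕ) + 1 : ℝ) ^ 2 - (n + 1) ^ 2) := fun n _ => by
    have e : 2 * π * (η * ((n + 1 : ℕ) + 1) + δ * ((n + 1 : ℕ) + 1) ^ 2 - η - δ) -
      2 * π * (η * (n + 1) + δ * (n + 1) ^ 2 - η - δ) =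
      2 * π * η + 2 * π * δ * (((n + 1 : ℕ) + 1 : ℝ) ^ 2 - (n + 1) ^ 2) := by push_cast; ring
    have hd : 0 ≤ ((n + 1 : ℕ) + 1 : ℝ) ^ 2 - (n + 1) ^ 2 := by
      push_cast
      have : (0 : ℝ) ≤ n := by positivity
      nlinarith
    rw [e]
    refine (abs_add_le _ _).trans ?_
    rw [abs_mul (2 * π) η, abs_mul (2 * π * δ), abs_mul (2 * π) δ, abs_of_nonneg hd,
      abs_of_pos (by positivity : 0 < 2 * π)]
    gcongr
  refine (Finset.sum_le_sum hterm).trans ?_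
  rw [Finset.sum_add_distrib, Finset.sum_const, ← Finset.mul_sum,
    Finset.sum_range_sub (fun n : ℕ => ((n : ℝ) + 1) ^ 2)]
  have hL : (L : ℝ) = N - 1 := by rw [hN]; push_cast; ring
  simp only [Finset.card_range, nsmul_eq_mul, hL]
  have e1 : ((N : ℝ) - 1) * (2 * π * (1 / (100 * N))) ≤ 2 * π / 100 := by
    rw [mul_one_div, ← mul_div_assoc, div_le_div_iff₀ (by positivity) (by norm_num)]
    nlinarith [Real.pi_pos]
  have e2 : 2 * π * (1 / (100 * (N : ℝ) ^ 2)) * (((N : ℝ) - 1 + 1) ^ 2 - ((0 : ℕ) + 1) ^ 2) ≤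
      2 * π / 100 := by
    rw [mul_one_div, div_mul_eq_mul_div, div_le_div_iff₀ (by positivity) (by norm_num)]
    push_cast
    nlinarith [Real.pi_pos]
  have := Real.pi_lt_d4
  linarith

/-- Major-arc lower bound for the one-dimensional quadratic Weyl sum. -/
theorem stmt7 :
    ∃ c > (0 : ℝ), ∀ (d N q a b : ℕ) (x t : ℝ),
      1 ≤ d → 1 < N →
      1 ≤ q → (q : ℝ) ≤ (N : ℝ) ^ ((d : ℝ) / ((d : ℝ) + 1)) → q % 4 = 0 →
      1 ≤ a → a < q → 1 ≤ b → b < q → Even b → Nat.Coprime a q →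
      |x - (b : ℝ) / q| ≤ 1 / (100 * N) →
      |t - (a : ℝ) / q| ≤ 1 / (100 * (N : ℝ) ^ 2) →
      c * (N : ℝ) / (q : ℝ) ^ (1 / 2 : ℝ) ≤ ‖wSum1 N x t‖ := by
  refine ⟨0.0015, by norm_num, fun d N q a b x t _ hN hq hqN hq4 _ _ _ _ hbe hcop hx ht => ?_⟩
  obtain ⟨k, rfl⟩ : ∃ k, q = 4 * k := ⟨q / 4, by omega⟩
  have hk : 0 < k := by omega
  obtain ⟨M, hMk⟩ : ∃ M, M = 2 * k := ⟨_, rfl⟩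
  have hM : 2 ≤ M := by omega
  have hqM : 4 * k = 2 * M := by omega
  rw [hqM] at hqN hcop hx ht ⊢
  have hM' : (0 : ℝ) < M := by exact_mod_cast (by omega : 0 < M)
  have hNM : 2 * M ≤ N := by
    have h1 : ((2 * M : ℕ) : ℝ) ≤ N := by
      refine hqN.trans ?_
      conv_rhs => rw [← Real.rpow_one (N : ℝ)]
      apply Real.rpow_le_rpow_of_exponent_le (by exact_mod_cast hN.le)
      rw [div_le_one (by positivity)]
      linarith
    exact_mod_cast h1
  obtain ⟨e, he⟩ := hbe
  have hcopM : IsCoprime (a : ℤ) M :=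
    Nat.isCoprime_iff_coprime.2 (Nat.Coprime.coprime_dvd_right (Dvd.intro_left 2 rfl) hcop)
  obtain ⟨ω, -, -, hω, -, C, I, hC, hI, hT, hn⟩ := tracksWell_of_int hM
    (tracksWell_of_le_half M hM) hcopM (β := b / (2 * M : ℕ)) (l := k * a + e) (by
      rw [he, hMk]
      have : (k : ℝ) ≠ 0 := by exact_mod_cast hk.ne'
      push_cast
      field_simp
      ring)
  have hCI : C + 0.12 * I ≤ 0.93 := by
    have : 0 ≤ (1.345 - 0.2 * ω) / √(M : ℝ) := by
      apply div_nonneg _ (Real.sqrt_nonneg _)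
      linarith
    linarith
  obtain ⟨L, rfl⟩ : ∃ L, N = L + 1 := ⟨N - 1, by omega⟩
  obtain ⟨η, hη⟩ : ∃ η, η = x - (b : ℝ) / (2 * M : ℕ) := ⟨_, rfl⟩
  obtain ⟨δ, hδ⟩ : ∃ δ, δ = t - (a : ℝ) / (2 * M : ℕ) := ⟨_, rfl⟩
  rw [← hη] at hx
  rw [← hδ] at ht
  have key := (hT.shift 1).le_norm_sum hC hI hCI (by omega) hNM
    (θ := fun n => 2 * π * (η * (n + 1) + δ * (n + 1) ^ 2 - η - δ)) (by simp)
    (sum_abs_phase_sub_le rfl hx ht) le_rfl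
  have hsum : wSum1 (L + 1) x t = Complex.exp ((2 * π * (η + δ) : ℝ) * Complex.I) *
      ∑ n ∈ range (L + 1), Complex.exp
        ((2 * π * (η * (n + 1) + δ * (n + 1) ^ 2 - η - δ) : ℝ) * Complex.I) *
          chirp ((a : ℤ) / M) (b / (2 * M : ℕ)) (n + 1) := by
    rw [wSum1, ← Finset.Ico_add_one_right_eq_Icc, Finset.sum_Ico_eq_sum_range, Finset.mul_sum]
    refine Finset.sum_congr rfl fun n _ => ?_
    rw [chirp, ← Complex.exp_add, ← Complex.exp_add]
    congr 1
    have h1 : (M : ℂ) ≠ 0 := by exact_mod_cast hM'.ne'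
    rw [hη, hδ]
    push_cast
    field_simp
    ring
  rw [hsum, norm_mul, Complex.norm_exp_ofReal_mul_I, one_mul]
  refine le_trans ?_ key
  rw [← Real.sqrt_eq_rpow, div_le_iff₀ (Real.sqrt_pos.2 (by exact_mod_cast (by omega : 0 < 2 * M)))]
  have h1 : √(M : ℝ) ≤ √((2 * M : ℕ) : ℝ) := Real.sqrt_le_sqrt (by push_cast; linarith)
  have h2 : ((L + 1 : ℕ) : ℝ) ≤ 2 * (((L + 1) / M : ℕ) * M) := by
    have h3 := Nat.div_add_mod (L + 1) M
    have h4 := Nat.mod_lt (L + 1) (by omega : 0 < M)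
    have h5 : M ≤ (L + 1) / M * M :=
      Nat.le_mul_of_pos_left _ (Nat.div_pos (by omega) (by omega))
    exact_mod_cast (by rw [mul_comm] at h3; omega : L + 1 ≤ 2 * ((L + 1) / M * M))
  have h3 : √(M : ℝ) * √(M : ℝ) = M := Real.mul_self_sqrt hM'.le
  calc 0.0015 * ((L + 1 : ℕ) : ℝ) ≤ 0.003 * ((L + 1) / M : ℕ) * (√(M : ℝ) * √(M : ℝ)) := by
        rw [h3]; linarith
    _ ≤ 0.003 * ((L + 1) / M : ℕ) * (√(M : ℝ) * √((2 * M : ℕ) : ℝ)) := by gcongr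
    _ = _ := by ring
end

section
/- There exists a measurable set E ⊂ 𝕋^d with Lebesgue measure |E| ≥ c > 0 (independent of N) such that for every x ∈ E, sup_{0<t<1} |∏_{j=1}^d ∑_{n_j=1}^N e^{2πi(n_j x_j + n_j² t)}| ≥ c' N^{d/2 + d/(2(d+1))}, where c, c' > 0 depend only on d. -/
open MeasureTheory Real Finset

/-- The `d`-dimensional quadratic Weyl sum `ω_N(x,t)`. -/
noncomputable def wSum (d N : ℕ) (x : Fin d → ℝ) (t : ℝ) : ℂ :=
  ∑ n ∈ Fintype.piFinset (fun _ : Fin d => Finset.Icc 1 N),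
    Complex.exp (2 * Real.pi * Complex.I *
      ((((∑ j, (n j : ℝ) * x j) + (∑ j, ((n j : ℝ)) ^ 2) * t : ℝ)) : ℂ))

/-- The additive character `y ↦ e^{2πiy}` of `ℝ`. -/
noncomputable def unitExp (y : ℝ) : ℂ := Complex.exp (2 * π * Complex.I * (y : ℂ))

lemma unitExp_add (y z : ℝ) : unitExp (y + z) = unitExp y * unitExp z := by
  rw [unitExp, unitExp, unitExp, ← Complex.exp_add]
  push_cast
  ring_nf

lemma norm_unitExp (y : ℝ) : ‖unitExp y‖ = 1 := by
  rw [unitExp, show 2 * π * Complex.I * (y : ℂ) = ((2 * π * y : ℝ) : ℂ) * Complex.I by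
    push_cast; ring]
  exact Complex.norm_exp_ofReal_mul_I _

lemma unitExp_re (y : ℝ) : (unitExp y).re = Real.cos (2 * π * y) := by
  rw [unitExp, show 2 * π * Complex.I * (y : ℂ) = ((2 * π * y : ℝ) : ℂ) * Complex.I by
    push_cast; ring]
  exact Complex.exp_ofReal_mul_I_re _

lemma unitExp_intCast (k : ℤ) : unitExp k = 1 := by
  rw [unitExp, Complex.exp_eq_one_iff]
  exact ⟨k, by push_cast; ring⟩

lemma unitExp_add_intCast (y : ℝ) (k : ℤ) : unitExp (y + k) = unitExp y := by
  rw [unitExp_add, unitExp_intCast, mul_one]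

lemma conj_unitExp (y : ℝ) : (starRingEnd ℂ) (unitExp y) = unitExp (-y) := by
  rw [unitExp, unitExp, ← Complex.exp_conj]
  simp [Complex.conj_ofNat]

lemma unitExp_nat_mul (n : ℕ) (y : ℝ) : unitExp (n * y) = unitExp y ^ n := by
  rw [unitExp, unitExp, ← Complex.exp_nat_mul]
  push_cast
  ring_nf

lemma half_le_unitExp_re {y : ℝ} (hy : |y| ≤ 1 / 6) : 1 / 2 ≤ (unitExp y).re := by
  rw [unitExp_re, ← Real.cos_pi_div_three, ← Real.cos_abs (2 * π * y)]
  apply Real.cos_le_cos_of_nonneg_of_le_pi (abs_nonneg _) (by linarith [pi_pos])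
  rw [abs_mul, abs_of_pos (by positivity : 0 < 2 * π)]
  nlinarith [pi_pos]

/-- Concavity of the sine, in a form adapted to reciprocals. -/
lemma two_mul_mul_one_sub_le_sin {s : ℝ} (h0 : 0 ≤ s) (h1 : s ≤ 1) :
    2 * (s * (1 - s)) ≤ Real.sin (π * s) := by
  rcases le_total s (1 / 2) with h | h
  · have := Real.mul_le_sin (x := π * s) (by positivity) (by nlinarith [pi_pos])
    have e : 2 / π * (π * s) = 2 * s := by field_simp
    nlinarith
  · have := Real.mul_le_sin (x := π * (1 - s)) (mul_nonneg pi_pos.le (by linarith))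
      (by nlinarith [pi_pos])
    have e : 2 / π * (π * (1 - s)) = 2 * (1 - s) := by field_simp
    rw [e, show π * (1 - s) = π - π * s by ring, Real.sin_pi_sub] at this
    nlinarith

lemma norm_sum_unitExp_le {s : ℝ} (h0 : 0 < s) (h1 : s < 1) (M : ℕ) :
    ‖∑ i ∈ range M, unitExp (i * s)‖ ≤ (s⁻¹ + (1 - s)⁻¹) / 2 := by
  have hpos : 0 < s * (1 - s) := mul_pos h0 (by linarith)
  have hnorm : 4 * (s * (1 - s)) ≤ ‖unitExp s - 1‖ := by
    rw [unitExp, show 2 * π * Complex.I * (s : ℂ) = Complex.I * ((2 * π * s : ℝ) : ℂ) by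
      push_cast; ring, Complex.norm_exp_I_mul_ofReal_sub_one, Real.norm_eq_abs,
      show 2 * π * s / 2 = π * s by ring]
    refine le_trans ?_ (le_abs_self _)
    linarith [two_mul_mul_one_sub_le_sin h0.le h1.le]
  have hne : unitExp s ≠ 1 := by
    intro h
    rw [h, sub_self, norm_zero] at hnorm
    linarith
  simp_rw [unitExp_nat_mul]
  rw [geom_sum_eq hne, norm_div]
  have hnum : ‖unitExp s ^ M - 1‖ ≤ 2 := by
    refine (norm_sub_le _ _).trans ?_
    rw [norm_pow, norm_unitExp]
    norm_num
  have heq : (s⁻¹ + (1 - s)⁻¹) / 2 = 2 / (4 * (s * (1 - s))) := by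
    have : 1 - s ≠ 0 := by linarith
    field_simp
    ring
  rw [heq]
  exact div_le_div₀ (by norm_num) hnum (by positivity) hnorm

/-- A double sum over a square, arranged along its diagonals. -/
lemma sum_sum_Icc_eq_sum_diagonals {M : Type*} [AddCommMonoid M] (N : ℕ) (F : ℕ → ℕ → M) :
    ∑ m ∈ Icc 1 N, ∑ n ∈ Icc 1 N, F m n =
      ∑ h ∈ Ioo (-(N : ℤ)) N, ∑ i ∈ range (N - h.natAbs),
        F (i + 1 + h.toNat) (i + 1 + (-h).toNat) := by
  rw [Finset.sum_sigma', Finset.sum_sigma']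
  refine Finset.sum_bij' (fun p _ => ⟨(p.1 : ℤ) - p.2, min p.1 p.2 - 1⟩)
    (fun p _ => ⟨p.2 + 1 + p.1.toNat, p.2 + 1 + (-p.1).toNat⟩) ?_ ?_ ?_ ?_ ?_
  · rintro ⟨m, n⟩ h
    simp only [mem_sigma, mem_Icc, mem_Ioo, mem_range] at h ⊢
    omega
  · rintro ⟨m, n⟩ h
    simp only [mem_sigma, mem_Icc, mem_Ioo, mem_range] at h ⊢
    omega
  · rintro ⟨m, n⟩ h
    simp only [mem_sigma, mem_Icc] at h
    simp only [Sigma.mk.injEq, heq_eq_eq]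
    omega
  · rintro ⟨m, n⟩ h
    simp only [mem_sigma, mem_Ioo, mem_range] at h
    simp only [Sigma.mk.injEq, heq_eq_eq]
    omega
  · rintro ⟨m, n⟩ h
    simp only [mem_sigma, mem_Icc] at h
    congr 1 <;> dsimp only <;> omega

lemma norm_sq_sum_unitExp (N : ℕ) (φ : ℕ → ℝ) :
    ‖∑ n ∈ Icc 1 N, unitExp (φ n)‖ ^ 2 =
      ∑ h ∈ Ioo (-(N : ℤ)) N, (∑ i ∈ range (N - h.natAbs),
        unitExp (φ (i + 1 + h.toNat) - φ (i + 1 + (-h).toNat))).re := by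
  have h1 : ((‖∑ n ∈ Icc 1 N, unitExp (φ n)‖ ^ 2 : ℝ) : ℂ) =
      ∑ m ∈ Icc 1 N, ∑ n ∈ Icc 1 N, unitExp (φ m - φ n) := by
    push_cast
    rw [← Complex.mul_conj', map_sum, Finset.sum_mul_sum]
    simp_rw [conj_unitExp, ← unitExp_add, sub_eq_add_neg]
  rw [sum_sum_Icc_eq_sum_diagonals] at h1
  rw [← Complex.re_sum, ← h1, Complex.ofReal_re]

/-- The one-dimensional quadratic Weyl sum. -/
noncomputable def quadSum (N : ℕ) (x t : ℝ) : ℂ :=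
  ∑ n ∈ Icc 1 N, unitExp (n * x + (n : ℝ) ^ 2 * t)

lemma quadSum_phase_sub (x t : ℝ) (i : ℕ) (h : ℤ) :
    (((i + 1 + h.toNat : ℕ) : ℝ) * x + ((i + 1 + h.toNat : ℕ) : ℝ) ^ 2 * t) -
      (((i + 1 + (-h).toNat : ℕ) : ℝ) * x + ((i + 1 + (-h).toNat : ℕ) : ℝ) ^ 2 * t) =
    (h * x + (h * (2 + h.natAbs)) * t) + i * (2 * h * t) := by
  rcases le_total 0 h with h0 | h0
  · obtain ⟨k, rfl⟩ := Int.eq_ofNat_of_zero_le h0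
    simp
    ring
  · obtain ⟨k, hk⟩ := Int.eq_ofNat_of_zero_le (neg_nonneg.mpr h0)
    obtain rfl : h = -k := by omega
    simp
    ring

lemma diagonal_re_ge {N q : ℕ} (hq : 0 < q) {x : ℝ} {a : ℤ} (hx : |x - a / q| * N ≤ 1 / 6)
    {h : ℤ} (hN : h.natAbs ≤ N) (hd : (2 * q : ℤ) ∣ h) (i : ℕ) :
    1 / 2 ≤ (unitExp ((h * x + (h * (2 + h.natAbs)) * (1 / (4 * q))) +
      i * (2 * h * (1 / (4 * q))))).re := by
  obtain ⟨l, rfl⟩ := hd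
  have hq' : (q : ℝ) ≠ 0 := by positivity
  obtain ⟨s, hs⟩ : ∃ s : ℤ, (((2 * q * l).natAbs : ℕ) : ℤ) = 2 * q * s := by
    refine ⟨|l|, ?_⟩
    rw [Int.natCast_natAbs, abs_mul, abs_of_nonneg (by positivity)]
  have hs' : (((2 * q * l).natAbs : ℕ) : ℝ) = 2 * q * s := by
    have := congrArg (Int.cast : ℤ → ℝ) hs
    rw [Int.cast_natCast] at this
    rw [this]
    push_cast
    rfl
  have e : ((((2 * q * l : ℤ) : ℝ) * x + (((2 * q * l : ℤ) : ℝ) * (2 + (2 * q * l).natAbs))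
      * (1 / (4 * q))) + i * (2 * ((2 * q * l : ℤ) : ℝ) * (1 / (4 * q)))) =
      ((2 * q * l : ℤ) : ℝ) * (x - a / q) + ((2 * l * a + l + q * l * s + i * l : ℤ) : ℝ) := by
    rw [hs']
    push_cast
    field_simp
    ring
  rw [e, unitExp_add_intCast]
  apply half_le_unitExp_re
  rw [abs_mul, mul_comm]
  refine le_trans ?_ hx
  gcongr
  rw [← Int.cast_abs, ← Int.natCast_natAbs]
  exact_mod_cast hN

/-- The bound `r / 2 * (1 / k + 1 / (r - k))` for geometric sums of ratio `e^{2πik/r}`. -/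
noncomputable def recipWeight (r : ℕ) (k : ℤ) : ℝ := r / 2 * ((k : ℝ)⁻¹ + ((r : ℝ) - k)⁻¹)

lemma off_diagonal_norm_le {q : ℕ} (hq : 0 < q) (y : ℝ) {h : ℤ} (hd : ¬ (2 * q : ℤ) ∣ h)
    (M : ℕ) :
    ‖∑ i ∈ range M, unitExp (y + i * (2 * h * (1 / (4 * q))))‖ ≤
      recipWeight (2 * q) (h % (2 * q : ℕ)) := by
  have hq' : (q : ℝ) ≠ 0 := by positivity
  have hr : (0 : ℤ) < 2 * q := by positivity
  set k : ℤ := h % (2 * q : ℕ) with hk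
  have hk0 : 0 < k := lt_of_le_of_ne (Int.emod_nonneg _ (by push_cast; omega))
    (fun e => hd (Int.dvd_of_emod_eq_zero (by push_cast at hk; omega)))
  have hk1 : k < 2 * q := by
    have := Int.emod_lt_of_pos h hr
    push_cast at hk; omega
  have hk0' : (0 : ℝ) < k := by exact_mod_cast hk0
  have hk1' : (k : ℝ) < 2 * q := by exact_mod_cast hk1
  have hdm : (h : ℝ) = k + 2 * q * (h / (2 * q : ℕ) : ℤ) := by
    have := Int.emod_add_mul_ediv h (2 * q : ℕ)
    rw [← hk] at this
    exact_mod_cast this.symm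
  have e : ∀ i : ℕ, unitExp (y + i * (2 * h * (1 / (4 * q)))) =
      unitExp y * unitExp (i * (k / (2 * q))) := by
    intro i
    rw [unitExp_add]
    congr 1
    rw [← unitExp_add_intCast (i * (k / (2 * q))) (i * (h / (2 * q : ℕ) : ℤ))]
    congr 1
    rw [hdm]
    push_cast
    field_simp
    ring
  simp_rw [e]
  rw [← Finset.mul_sum, norm_mul, norm_unitExp, one_mul]
  refine (norm_sum_unitExp_le (by positivity) ((div_lt_one (by positivity)).mpr hk1') M).trans
    (le_of_eq ?_)
  have : (2 * q : ℝ) - k ≠ 0 := by linarith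
  have : 1 - (k : ℝ) / (2 * q) ≠ 0 := by
    rw [sub_ne_zero]; intro h; field_simp at h; linarith
  rw [recipWeight]
  push_cast
  have : 1 - (k : ℝ) / (2 * q) = (2 * q - k) / (2 * q) := by field_simp
  rw [this, inv_div, inv_div]
  field_simp

lemma recipWeight_nonneg {r : ℕ} {k : ℤ} (h0 : 0 ≤ k) (h1 : k ≤ r) : 0 ≤ recipWeight r k := by
  have h0' : (0 : ℝ) ≤ k := by exact_mod_cast h0
  have h1' : (k : ℝ) ≤ r := by exact_mod_cast h1
  have : 0 ≤ (r : ℝ) - k := by linarith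
  unfold recipWeight
  positivity

lemma sum_recipWeight_le {r : ℕ} (hr : 0 < r) :
    ∑ k ∈ Ioo (0 : ℤ) r, recipWeight r k ≤ r * (1 + Real.log r) := by
  have h1 : ∑ k ∈ Ioo (0 : ℤ) r, recipWeight r k =
      ∑ i ∈ range (r - 1), recipWeight r ((i + 1 : ℕ) : ℤ) := by
    refine Finset.sum_bij' (fun k _ => (k - 1).toNat) (fun i _ => ((i + 1 : ℕ) : ℤ)) ?_ ?_ ?_ ?_ ?_
    · intro k hk
      simp only [mem_Ioo, mem_range] at hk ⊢
      omega
    · intro k hk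
      simp only [mem_Ioo, mem_range] at hk ⊢
      omega
    · intro k hk
      simp only [mem_Ioo] at hk
      omega
    · intro k hk
      omega
    · intro k hk
      simp only [mem_Ioo] at hk
      congr 1
      omega
  have h2 : ∑ i ∈ range (r - 1), ((r : ℝ) - ((i + 1 : ℕ) : ℤ))⁻¹ =
      ∑ i ∈ range (r - 1), (((i + 1 : ℕ) : ℤ) : ℝ)⁻¹ := by
    rw [← Finset.sum_range_reflect]
    refine Finset.sum_congr rfl fun i hi => ?_
    rw [mem_range] at hi
    congr 1
    have : ((r - 1 - 1 - i + 1 : ℕ) : ℤ) = r - 1 - i := by omega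
    rw [this]
    push_cast
    ring
  have h3 : ∑ i ∈ range (r - 1), (((i + 1 : ℕ) : ℤ) : ℝ)⁻¹ ≤ 1 + Real.log r := by
    have h := harmonic_le_one_add_log r
    rw [harmonic] at h
    push_cast at h ⊢
    refine le_trans ?_ h
    exact Finset.sum_le_sum_of_subset_of_nonneg (Finset.range_mono (Nat.sub_le _ _))
      fun i _ _ => by positivity
  rw [h1]
  simp only [recipWeight]
  rw [← Finset.mul_sum, Finset.sum_add_distrib, h2]
  have : (0 : ℝ) < r := by exact_mod_cast hr
  nlinarith

lemma sum_recipWeight_emod_le {r N K : ℕ} (hr : 0 < r) (hK : N ≤ K * r) :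
    ∑ h ∈ (Ioo (-(N : ℤ)) N).filter (fun h => ¬ (r : ℤ) ∣ h), recipWeight r (h % r) ≤
      2 * K * (r * (1 + Real.log r)) := by
  have hr' : (0 : ℤ) < r := by exact_mod_cast hr
  have hK' : (N : ℤ) ≤ K * r := by exact_mod_cast hK
  set s := (Ioo (-(N : ℤ)) N).filter (fun h => ¬ (r : ℤ) ∣ h) with hs
  have himg : s.image (fun h : ℤ => (h / r, h % r)) ⊆ Ico (-(K : ℤ)) K ×ˢ Ioo (0 : ℤ) r := by
    intro p hp
    obtain ⟨h, hh, rfl⟩ := Finset.mem_image.mp hp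
    rw [hs, mem_filter, mem_Ioo] at hh
    simp only [mem_product, mem_Ico, mem_Ioo]
    refine ⟨⟨?_, ?_⟩, ?_, Int.emod_lt_of_pos _ hr'⟩
    · rw [Int.le_ediv_iff_mul_le hr']
      linarith [hh.1.1]
    · rw [Int.ediv_lt_iff_lt_mul hr']
      linarith [hh.1.2]
    · exact lt_of_le_of_ne (Int.emod_nonneg _ hr'.ne')
        fun e => hh.2 (Int.dvd_of_emod_eq_zero e.symm)
  have hinj : Set.InjOn (fun h : ℤ => (h / (r : ℤ), h % (r : ℤ))) s := by
    intro a _ b _ hab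
    simp only [Prod.mk.injEq] at hab
    rw [← Int.emod_add_mul_ediv a r, ← Int.emod_add_mul_ediv b r, hab.1, hab.2]
  calc ∑ h ∈ s, recipWeight r (h % r)
      = ∑ p ∈ s.image (fun h : ℤ => (h / (r : ℤ), h % (r : ℤ))), recipWeight r p.2 := by
        rw [Finset.sum_image hinj]
    _ ≤ ∑ p ∈ Ico (-(K : ℤ)) K ×ˢ Ioo (0 : ℤ) r, recipWeight r p.2 := by
        refine Finset.sum_le_sum_of_subset_of_nonneg himg fun p hp _ => ?_
        simp only [mem_product, mem_Ioo] at hp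
        exact recipWeight_nonneg hp.2.1.le hp.2.2.le
    _ = 2 * K * ∑ k ∈ Ioo (0 : ℤ) r, recipWeight r k := by
        rw [Finset.sum_product]
        dsimp only
        rw [Finset.sum_const, Int.card_Ico, nsmul_eq_mul]
        congr 1
        rw [show (K : ℤ) - -K = (2 * K : ℕ) by push_cast; ring, Int.toNat_natCast]
        push_cast
        rfl
    _ ≤ _ := by gcongr; exact sum_recipWeight_le hr

lemma sum_multiples_ge {r N : ℕ} (hr : 0 < r) (hN : 0 < N) :
    (N : ℝ) ^ 2 / (4 * r) ≤
      ∑ h ∈ (Ioo (-(N : ℤ)) N).filter (fun h => (r : ℤ) ∣ h), ((N - h.natAbs : ℕ) : ℝ) := by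
  have hr' : (0 : ℝ) < r := by exact_mod_cast hr
  set L := N / (2 * r) with hL
  have hl : ∀ l ∈ range (L + 1), 2 * (r * l) ≤ N := by
    intro l h
    rw [mem_range, Nat.lt_succ_iff, hL, Nat.le_div_iff_mul_le (by omega)] at h
    linarith
  have hsub : (range (L + 1)).image (fun l : ℕ => (r * l : ℤ)) ⊆
      (Ioo (-(N : ℤ)) N).filter (fun h => (r : ℤ) ∣ h) := by
    intro h hh
    obtain ⟨l, hl', rfl⟩ := Finset.mem_image.mp hh
    have := hl l hl'
    rw [mem_filter, mem_Ioo]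
    refine ⟨⟨?_, ?_⟩, dvd_mul_right _ _⟩ <;> zify at this hN <;> nlinarith
  refine le_trans ?_ (Finset.sum_le_sum_of_subset_of_nonneg hsub fun _ _ _ => by positivity)
  rw [Finset.sum_image fun a _ b _ hab => by
    have : (r : ℤ) ≠ 0 := by exact_mod_cast hr.ne'
    exact_mod_cast mul_left_cancel₀ this hab]
  have hterm : ∀ l ∈ range (L + 1), (N : ℝ) / 2 ≤ ((N - ((r : ℤ) * l).natAbs : ℕ) : ℝ) := by
    intro l h
    have h2 := hl l h
    have e : ((r : ℤ) * l).natAbs = r * l := by rw [Int.natAbs_mul]; simp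
    have : N ≤ 2 * (N - ((r : ℤ) * l).natAbs) := by rw [e]; omega
    have : (N : ℝ) ≤ 2 * ((N - ((r : ℤ) * l).natAbs : ℕ) : ℝ) := by exact_mod_cast this
    linarith
  refine le_trans ?_ (Finset.card_nsmul_le_sum _ _ _ hterm)
  rw [card_range, nsmul_eq_mul]
  have : (N : ℝ) < 2 * r * ((L + 1 : ℕ) : ℝ) := by
    exact_mod_cast Nat.lt_mul_div_succ N (by omega : 0 < 2 * r)
  rw [div_le_iff₀ (by positivity)]
  have hN' : (0 : ℝ) < N := by exact_mod_cast hN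
  nlinarith

/-- Lower bound for the quadratic Weyl sum near a rational point, at time `1 / (4 q)`. -/
lemma norm_sq_quadSum_ge {N q : ℕ} (hq : 0 < q) {x : ℝ} {a : ℤ}
    (hx : |x - a / q| * N ≤ 1 / 6)
    (hN : 64 * ((2 * q : ℕ) : ℝ) * (1 + Real.log (2 * q : ℕ)) ≤ N) :
    (N : ℝ) ^ 2 / (32 * q) ≤ ‖quadSum N x (1 / (4 * q))‖ ^ 2 := by
  set r : ℕ := 2 * q with hr
  have hr0 : 0 < r := by omega
  have hr1 : (1 : ℝ) ≤ r := by exact_mod_cast hr0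
  have hlog : 0 ≤ Real.log r := Real.log_nonneg hr1
  have hrN : (r : ℝ) ≤ N := by nlinarith
  have hN0 : 0 < N := by
    have : (0 : ℝ) < N := by linarith
    exact_mod_cast this
  have hrq : (r : ℤ) = 2 * q := by rw [hr]; push_cast; rfl
  have hrq' : (r : ℝ) = 2 * q := by rw [hr]; push_cast; rfl
  rw [quadSum, norm_sq_sum_unitExp N (fun n => (n : ℝ) * x + (n : ℝ) ^ 2 * (1 / (4 * q))),
    ← Finset.sum_filter_add_sum_filter_not _ (fun h : ℤ => (r : ℤ) ∣ h)]
  simp only [quadSum_phase_sub]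
  have hdiag : (N : ℝ) ^ 2 / (8 * r) ≤ ∑ h ∈ (Ioo (-(N : ℤ)) N).filter (fun h => (r : ℤ) ∣ h),
      (∑ i ∈ range (N - h.natAbs), unitExp ((h * x + (h * (2 + h.natAbs)) * (1 / (4 * q))) +
        i * (2 * h * (1 / (4 * q))))).re := by
    have h1 := sum_multiples_ge hr0 hN0
    calc (N : ℝ) ^ 2 / (8 * r) = (1 / 2) * ((N : ℝ) ^ 2 / (4 * r)) := by field_simp; norm_num
      _ ≤ _ := mul_le_mul_of_nonneg_left h1 (by norm_num)
      _ ≤ _ := by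
        rw [Finset.mul_sum]
        refine Finset.sum_le_sum fun h hh => ?_
        rw [mem_filter, mem_Ioo, hrq] at hh
        rw [Complex.re_sum]
        refine le_trans (le_of_eq ?_) (Finset.card_nsmul_le_sum _ _ _
          fun i _ => diagonal_re_ge hq hx (by omega) hh.2 i)
        rw [card_range, nsmul_eq_mul, mul_comm]
  have hoff : -(2 * ((N / r + 1 : ℕ) : ℝ) * (r * (1 + Real.log r))) ≤
      ∑ h ∈ (Ioo (-(N : ℤ)) N).filter (fun h => ¬ (r : ℤ) ∣ h),
      (∑ i ∈ range (N - h.natAbs), unitExp ((h * x + (h * (2 + h.natAbs)) * (1 / (4 * q))) +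
        i * (2 * h * (1 / (4 * q))))).re := by
    have hK : N ≤ (N / r + 1) * r := by
      rw [mul_comm]; exact (Nat.lt_mul_div_succ N hr0).le
    refine (neg_le_neg (sum_recipWeight_emod_le hr0 hK)).trans ?_
    rw [← Finset.sum_neg_distrib]
    refine Finset.sum_le_sum fun h hh => ?_
    rw [mem_filter, hrq] at hh
    exact neg_le_of_abs_le ((Complex.abs_re_le_norm _).trans (off_diagonal_norm_le hq _ hh.2 _))
  refine le_trans ?_ (add_le_add hdiag hoff)
  have hK : ((N / r + 1 : ℕ) : ℝ) * r ≤ 2 * N := by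
    have : (N / r + 1) * r ≤ 2 * N := by
      have := Nat.div_mul_le_self N r
      have : r ≤ N := by exact_mod_cast hrN
      nlinarith
    exact_mod_cast this
  have h4 : 2 * ((N / r + 1 : ℕ) : ℝ) * (r * (1 + Real.log r)) ≤ (N : ℝ) ^ 2 / (16 * r) := by
    rw [le_div_iff₀ (by positivity)]
    calc 2 * ((N / r + 1 : ℕ) : ℝ) * (r * (1 + Real.log r)) * (16 * r)
        = (((N / r + 1 : ℕ) : ℝ) * r) * (32 * r * (1 + Real.log r)) := by ring
      _ ≤ (2 * N) * (N / 2) := by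
        gcongr
        linarith
      _ = _ := by ring
  have h5 : (N : ℝ) ^ 2 / (8 * r) = (N : ℝ) ^ 2 / (16 * r) + (N : ℝ) ^ 2 / (16 * r) := by
    field_simp; norm_num
  have h6 : (N : ℝ) ^ 2 / (32 * q) = (N : ℝ) ^ 2 / (16 * r) := by rw [hrq']; ring_nf
  linarith

lemma wSum_eq_prod_quadSum (d N : ℕ) (x : Fin d → ℝ) (t : ℝ) :
    wSum d N x t = ∏ j, quadSum N (x j) t := by
  simp only [quadSum]
  rw [Finset.prod_univ_sum, wSum]
  refine Finset.sum_congr rfl fun n _ => ?_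
  simp only [unitExp]
  rw [← Complex.exp_sum, ← Finset.mul_sum, ← Complex.ofReal_sum, Finset.sum_add_distrib,
    Finset.sum_mul]

lemma norm_wSum_le (d N : ℕ) (x : Fin d → ℝ) (t : ℝ) :
    ‖wSum d N x t‖ ≤ #(Fintype.piFinset fun _ : Fin d => Finset.Icc 1 N) := by
  refine (norm_sum_le_of_le _ fun n _ => (norm_unitExp _).le).trans ?_
  simp

lemma norm_wSum_le_iSup {d N : ℕ} (x : Fin d → ℝ) {t : ℝ} (ht : t ∈ Set.Ioo (0 : ℝ) 1) :
    ‖wSum d N x t‖ ≤ ⨆ t ∈ Set.Ioo (0 : ℝ) 1, ‖wSum d N x t‖ := by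
  refine le_ciSup_of_le (f := fun t => ⨆ (_ : t ∈ Set.Ioo (0 : ℝ) 1), ‖wSum d N x t‖) ?_ t
    (by rw [ciSup_pos ht])
  rw [bddAbove_def]
  refine ⟨#(Fintype.piFinset fun _ : Fin d => Finset.Icc 1 N), ?_⟩
  rintro _ ⟨s, rfl⟩
  exact Real.iSup_le (fun _ => norm_wSum_le d N x s) (Nat.cast_nonneg _)

lemma pow_le_iSup_norm_wSum {d N : ℕ} {x : Fin d → ℝ} {t b : ℝ} (ht : t ∈ Set.Ioo (0 : ℝ) 1)
    (hb : 0 ≤ b) (h : ∀ j, b ≤ ‖quadSum N (x j) t‖) :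
    b ^ d ≤ ⨆ t ∈ Set.Ioo (0 : ℝ) 1, ‖wSum d N x t‖ := by
  refine le_trans ?_ (norm_wSum_le_iSup x ht)
  rw [wSum_eq_prod_quadSum, norm_prod]
  calc b ^ d = ∏ _j : Fin d, b := by simp
    _ ≤ _ := Finset.prod_le_prod (fun _ _ => hb) fun j _ => h j

/-- Near the origin there is no cancellation in the quadratic Weyl sum. -/
lemma half_le_norm_quadSum {N : ℕ} (hN : 1 ≤ N) {x : ℝ} (h0 : 0 ≤ x) (h1 : x ≤ 1 / (12 * N)) :
    (N : ℝ) / 2 ≤ ‖quadSum N x (1 / (12 * (N : ℝ) ^ 2))‖ := by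
  have hN' : (0 : ℝ) < N := by exact_mod_cast hN
  refine le_trans ?_ (Complex.re_le_norm _)
  rw [quadSum, Complex.re_sum]
  refine le_trans (le_of_eq ?_) (Finset.card_nsmul_le_sum _ _ (1 / 2) fun n hn => ?_)
  · simp [div_eq_mul_inv]
  · have hn' : (n : ℝ) ≤ N := by exact_mod_cast (mem_Icc.mp hn).2
    apply half_le_unitExp_re
    rw [abs_of_nonneg (by positivity)]
    calc (n : ℝ) * x + (n : ℝ) ^ 2 * (1 / (12 * (N : ℝ) ^ 2))
        ≤ N * (1 / (12 * N)) + (N : ℝ) ^ 2 * (1 / (12 * (N : ℝ) ^ 2)) := by gcongr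
      _ = 1 / 6 := by field_simp; norm_num

/-- Dirichlet's theorem on simultaneous Diophantine approximation. -/
lemma exists_simultaneous_approx {d P : ℕ} (hP : 0 < P) (x : Fin d → ℝ) :
    ∃ q : ℕ, 0 < q ∧ q ≤ P ^ d ∧ ∃ a : Fin d → ℤ, ∀ j, |q * x j - a j| < 1 / P := by
  have hP' : (0 : ℝ) < P := by exact_mod_cast hP
  have hmaps : ∀ k ∈ range (P ^ d + 1), (fun j => ⌊Int.fract ((k : ℝ) * x j) * P⌋) ∈
      Fintype.piFinset fun _ : Fin d => Ico (0 : ℤ) P := by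
    intro k _
    rw [Fintype.mem_piFinset]
    intro j
    rw [mem_Ico]
    refine ⟨Int.floor_nonneg.mpr (mul_nonneg (Int.fract_nonneg _) hP'.le), ?_⟩
    rw [Int.floor_lt]
    push_cast
    nlinarith [Int.fract_lt_one ((k : ℝ) * x j)]
  have hcard : #(Fintype.piFinset fun _ : Fin d => Ico (0 : ℤ) P) < #(range (P ^ d + 1)) := by
    simp
  obtain ⟨k, hk, l, hl, hne, heq⟩ := Finset.exists_ne_map_eq_of_card_lt_of_maps_to hcard hmaps
  wlog hlt : k < l generalizing k l
  · exact this l hl k hk hne.symm heq.symm (lt_of_le_of_ne (not_lt.mp hlt) hne.symm)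
  rw [mem_range] at hl
  refine ⟨l - k, by omega, by omega, fun j => ⌊(l : ℝ) * x j⌋ - ⌊(k : ℝ) * x j⌋, fun j => ?_⟩
  have h1 := Int.abs_sub_lt_one_of_floor_eq_floor (congrFun heq j)
  rw [← sub_mul, abs_mul, abs_of_pos hP', abs_sub_comm] at h1
  rw [lt_div_iff₀ hP']
  have e : ((l - k : ℕ) : ℝ) * x j - ((⌊(l : ℝ) * x j⌋ - ⌊(k : ℝ) * x j⌋ : ℤ) : ℝ) =
      Int.fract ((l : ℝ) * x j) - Int.fract ((k : ℝ) * x j) := by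
    rw [Nat.cast_sub hlt.le]
    simp only [Int.fract]
    push_cast
    ring
  rwa [e]

/-- The points with a simultaneous rational approximation of denominator at most `M`, with
the quality given by Dirichlet's theorem. -/
def smallDenominatorSet (d P M : ℕ) : Set (Fin d → ℝ) :=
  ⋃ q ∈ Icc 1 M, ⋃ a ∈ Fintype.piFinset (fun _ : Fin d => Icc (0 : ℤ) q),
    Metric.closedBall (fun j => (a j : ℝ) / q) (1 / (q * P))

lemma measurableSet_smallDenominatorSet (d P M : ℕ) :
    MeasurableSet (smallDenominatorSet d P M) :=
  Finset.measurableSet_biUnion _ fun _ _ => Finset.measurableSet_biUnion _ fun _ _ =>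
    Metric.isClosed_closedBall.measurableSet

lemma volume_smallDenominatorSet_le {d P : ℕ} (hP : 0 < P) (M : ℕ) :
    volume (smallDenominatorSet d P M) ≤ ENNReal.ofReal (M * (4 / P) ^ d) := by
  have hq : ∀ q ∈ Icc 1 M, volume (⋃ a ∈ Fintype.piFinset (fun _ : Fin d => Icc (0 : ℤ) q),
      Metric.closedBall (fun j => (a j : ℝ) / q) (1 / ((q : ℝ) * P))) ≤
      ENNReal.ofReal ((4 / P) ^ d) := by
    intro q hq
    have hq1 : (1 : ℝ) ≤ q := by exact_mod_cast (mem_Icc.mp hq).1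
    have hP' : (0 : ℝ) < P := by exact_mod_cast hP
    refine (measure_biUnion_finset_le _ _).trans ?_
    simp_rw [Real.volume_pi_closedBall _ (by positivity : (0 : ℝ) ≤ 1 / ((q : ℝ) * P))]
    rw [Finset.sum_const, ← ENNReal.ofReal_nsmul]
    apply ENNReal.ofReal_le_ofReal
    have hc : ((q : ℤ) + 1 - 0).toNat = q + 1 := by omega
    simp only [Fintype.card_piFinset, Int.card_Icc, hc, prod_const, card_univ, Fintype.card_fin,
      nsmul_eq_mul]
    push_cast
    rw [← mul_pow]
    gcongr
    rw [show ((q : ℝ) + 1) * (2 * (1 / (q * P))) = (2 * (q + 1) / q) / P by field_simp]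
    gcongr
    rw [div_le_iff₀ (by positivity)]
    linarith
  refine (measure_biUnion_finset_le _ _).trans ((Finset.sum_le_sum hq).trans (le_of_eq ?_))
  rw [Finset.sum_const, ← ENNReal.ofReal_nsmul, Nat.card_Icc, nsmul_eq_mul, Nat.add_sub_cancel]

lemma half_le_volume_diff_smallDenominatorSet {d P : ℕ} (hP : 0 < P) :
    1 / 2 ≤ (volume (Set.Icc (0 : Fin d → ℝ) 1 \
      smallDenominatorSet d P (P ^ d / (2 * 4 ^ d)))).toReal := by
  have hP' : (0 : ℝ) < P := by exact_mod_cast hP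
  have h1 : volume (Set.Icc (0 : Fin d → ℝ) 1) = 1 := by
    rw [Real.volume_Icc_pi]
    simp
  have h2 : ((P ^ d / (2 * 4 ^ d) : ℕ) : ℝ) * (4 / P) ^ d ≤ 1 / 2 := by
    calc ((P ^ d / (2 * 4 ^ d) : ℕ) : ℝ) * (4 / P) ^ d
        ≤ ((P ^ d : ℕ) / (2 * 4 ^ d : ℕ) : ℝ) * (4 / P) ^ d := by
          gcongr
          exact Nat.cast_div_le
      _ = 1 / 2 := by
          push_cast
          rw [div_pow]
          field_simp
  have h3 := (volume_smallDenominatorSet_le (d := d) hP (P ^ d / (2 * 4 ^ d))).trans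
    (ENNReal.ofReal_le_ofReal h2)
  have h4 := le_measure_sdiff (μ := (volume : Measure (Fin d → ℝ))) (s₁ := Set.Icc 0 1)
    (s₂ := smallDenominatorSet d P (P ^ d / (2 * 4 ^ d)))
  have h5 : ENNReal.ofReal (1 / 2) ≤ volume (Set.Icc (0 : Fin d → ℝ) 1 \
      smallDenominatorSet d P (P ^ d / (2 * 4 ^ d))) := by
    refine le_trans ?_ (h4.trans' (tsub_le_tsub_left h3 _))
    rw [h1, ← ENNReal.ofReal_one, ← ENNReal.ofReal_sub _ (by norm_num)]
    norm_num
  refine (ENNReal.ofReal_le_iff_le_toReal ?_).mp h5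
  exact ((measure_mono Set.sdiff_subset).trans_lt (h1 ▸ ENNReal.one_lt_top)).ne

/-- Off the exceptional set, the approximations given by Dirichlet's theorem have a large
denominator. -/
lemma exists_approx_large_denominator {d P M : ℕ} (hP : 0 < P) {x : Fin d → ℝ}
    (hx : x ∈ Set.Icc (0 : Fin d → ℝ) 1 \ smallDenominatorSet d P M) :
    ∃ q : ℕ, M < q ∧ q ≤ P ^ d ∧ ∃ a : Fin d → ℤ, ∀ j, |x j - a j / q| ≤ 1 / (q * P) := by
  obtain ⟨q, hq0, hq, a, ha⟩ := exists_simultaneous_approx hP x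
  have hq' : (0 : ℝ) < q := by exact_mod_cast hq0
  have hP1 : (1 : ℝ) ≤ P := by exact_mod_cast hP
  have hinv : 1 / (P : ℝ) ≤ 1 := (div_le_one (by positivity)).mpr hP1
  have hdist : ∀ j, |x j - a j / q| ≤ 1 / (q * P) := by
    intro j
    have e : q * x j - a j = q * (x j - a j / q) := by field_simp
    have := (ha j).le
    rw [e, abs_mul, abs_of_pos hq'] at this
    rw [mul_comm, ← div_div, le_div_iff₀ hq']
    linarith
  refine ⟨q, ?_, hq, a, hdist⟩
  by_contra! hM
  apply hx.2
  rw [smallDenominatorSet]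
  simp only [Set.mem_iUnion]
  refine ⟨q, mem_Icc.mpr ⟨hq0, hM⟩, a, ?_, ?_⟩
  · rw [Fintype.mem_piFinset]
    intro j
    have h0 : (0 : ℝ) ≤ x j := hx.1.1 j
    have h1 : x j ≤ 1 := hx.1.2 j
    have h2 := abs_lt.mp ((ha j).trans_le hinv)
    have h3 : (-1 : ℝ) < a j := by nlinarith
    have h4 : (a j : ℝ) < q + 1 := by nlinarith
    have h3' : (-1 : ℤ) < a j := by exact_mod_cast h3
    have h4' : a j < (q : ℤ) + 1 := by exact_mod_cast h4
    rw [mem_Icc]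
    omega
  · rw [Metric.mem_closedBall, dist_pi_le_iff (by positivity)]
    intro j
    rw [Real.dist_eq]
    exact hdist j

lemma eventually_mul_log_le {C θ : ℝ} (hC : 0 < C) (hθ : θ < 1) :
    ∀ᶠ N : ℕ in Filter.atTop,
      64 * (C * (N : ℝ) ^ θ) * (1 + Real.log (C * (N : ℝ) ^ θ)) ≤ N := by
  have hpos : 0 < 1 - θ := by linarith
  have h1 : (fun x : ℝ => (1 + Real.log C) + θ * Real.log x) =o[Filter.atTop]
      fun x : ℝ => x ^ (1 - θ) :=
    (Asymptotics.isLittleO_const_left.2 (Or.inr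
      (tendsto_norm_atTop_atTop.comp (tendsto_rpow_atTop hpos)))).add
      ((isLittleO_log_rpow_atTop hpos).const_mul_left θ)
  have h2 := tendsto_natCast_atTop_atTop.eventually
    (h1.bound (by positivity : 0 < 1 / (64 * C)))
  filter_upwards [h2, Filter.eventually_gt_atTop 0] with N hN hN0
  have hN0' : (0 : ℝ) < N := by exact_mod_cast hN0
  have hθN : (0 : ℝ) < (N : ℝ) ^ θ := by positivity
  rw [Real.norm_of_nonneg (by positivity : (0 : ℝ) ≤ (N : ℝ) ^ (1 - θ))] at hN
  rw [Real.log_mul hC.ne' hθN.ne', Real.log_rpow hN0', ← add_assoc]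
  calc 64 * (C * (N : ℝ) ^ θ) * (1 + Real.log C + θ * Real.log N)
      ≤ 64 * (C * (N : ℝ) ^ θ) * (1 / (64 * C) * (N : ℝ) ^ (1 - θ)) := by
        gcongr
        exact (le_abs_self _).trans hN
    _ = (N : ℝ) ^ θ * (N : ℝ) ^ (1 - θ) := by field_simp
    _ = N := by rw [← Real.rpow_add hN0', add_sub_cancel, Real.rpow_one]

/-- The set for large `N`: points whose rational approximations all have a large denominator. -/
lemma exists_set_of_large {d : ℕ} {C : ℝ} (hC : C = (2 * (12 * 4 ^ d)) ^ d) {N : ℕ} (hN1 : 1 ≤ N)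
    (hN : 64 * (2 * C * (N : ℝ) ^ ((d : ℝ) / (d + 1))) *
      (1 + Real.log (2 * C * (N : ℝ) ^ ((d : ℝ) / (d + 1)))) ≤ N) :
    ∃ E : Set (Fin d → ℝ), E ⊆ Set.Icc (0 : Fin d → ℝ) 1 ∧ MeasurableSet E ∧
      1 / 2 ≤ (volume E).toReal ∧
      ∀ x ∈ E, (1 / √(32 * C)) ^ d *
          (N : ℝ) ^ ((d : ℝ) / 2 + (d : ℝ) / (2 * ((d : ℝ) + 1))) ≤
        ⨆ t ∈ Set.Ioo (0 : ℝ) 1, ‖wSum d N x t‖ := by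
  have hN0 : (0 : ℝ) < N := by exact_mod_cast hN1
  have hN1' : (1 : ℝ) ≤ N := by exact_mod_cast hN1
  set A : ℝ := 12 * 4 ^ d with hA
  have hA1 : 1 ≤ A := by
    have : (1 : ℝ) ≤ 4 ^ d := one_le_pow₀ (by norm_num)
    linarith
  have hC0 : 0 < C := by rw [hC]; positivity
  set u : ℝ := (N : ℝ) ^ (1 / ((d : ℝ) + 1)) with hu
  have hu1 : 1 ≤ u := Real.one_le_rpow hN1' (by positivity)
  have hud : u ^ d = (N : ℝ) ^ ((d : ℝ) / (d + 1)) := by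
    rw [hu, ← Real.rpow_natCast, ← Real.rpow_mul hN0.le]
    congr 1
    field_simp
  have hud1 : u ^ (d + 1) = N := by
    rw [hu, ← Real.rpow_natCast, ← Real.rpow_mul hN0.le]
    push_cast
    rw [one_div_mul_cancel (by positivity), Real.rpow_one]
  set P : ℕ := ⌈A * u⌉₊ with hPdef
  have hPA : A * u ≤ P := Nat.le_ceil _
  have hAu : 1 ≤ A * u := one_le_mul_of_one_le_of_one_le hA1 hu1
  have hPle : (P : ℝ) ≤ 2 * A * u := by
    have := (Nat.ceil_lt_add_one (by positivity : 0 ≤ A * u)).le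
    linarith
  have hP' : (0 : ℝ) < P := by linarith
  have hP : 0 < P := by exact_mod_cast hP'
  have hPd : (P : ℝ) ^ d ≤ C * (N : ℝ) ^ ((d : ℝ) / (d + 1)) := by
    rw [hC, ← hud, ← mul_pow]
    gcongr
  have hPN : A * N ≤ (P : ℝ) ^ (d + 1) := by
    calc A * N ≤ A ^ (d + 1) * u ^ (d + 1) := by
          rw [hud1]
          gcongr
          exact le_self_pow₀ hA1 (by omega)
      _ = (A * u) ^ (d + 1) := (mul_pow A u (d + 1)).symm
      _ ≤ _ := by gcongr
  refine ⟨Set.Icc 0 1 \ smallDenominatorSet d P (P ^ d / (2 * 4 ^ d)), Set.sdiff_subset,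
    measurableSet_Icc.diff (measurableSet_smallDenominatorSet _ _ _),
    half_le_volume_diff_smallDenominatorSet hP, fun x hx => ?_⟩
  obtain ⟨q, hMq, hqP, a, ha⟩ := exists_approx_large_denominator hP hx
  have hq : 0 < q := Nat.zero_lt_of_lt hMq
  have hq' : (0 : ℝ) < q := by exact_mod_cast hq
  have hq1 : (1 : ℝ) ≤ q := by exact_mod_cast hq
  have hqlow : (P : ℝ) ^ d ≤ 2 * 4 ^ d * q := by
    rw [Nat.div_lt_iff_lt_mul (by positivity)] at hMq
    have : P ^ d ≤ 2 * 4 ^ d * q := by linarith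
    exact_mod_cast this
  have hqC : (q : ℝ) ≤ C * (N : ℝ) ^ ((d : ℝ) / (d + 1)) :=
    le_trans (by exact_mod_cast hqP) hPd
  have hclose : ∀ j, |x j - a j / q| * N ≤ 1 / 6 := by
    intro j
    have h1 : 6 * (N : ℝ) ≤ q * P := by
      have h4 : (0 : ℝ) < 2 * 4 ^ d := by positivity
      have : 2 * 4 ^ d * (6 * (N : ℝ)) ≤ 2 * 4 ^ d * (q * P) := by
        calc 2 * 4 ^ d * (6 * (N : ℝ)) = A * N := by rw [hA]; ring
          _ ≤ (P : ℝ) ^ d * P := by rw [← pow_succ]; exact hPN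
          _ ≤ 2 * 4 ^ d * q * P := by gcongr
          _ = _ := by ring
      exact le_of_mul_le_mul_left this h4
    calc |x j - a j / q| * N ≤ 1 / (q * P) * N := by gcongr; exact ha j
      _ ≤ 1 / 6 := by
        rw [one_div_mul_eq_div, div_le_div_iff₀ (by positivity) (by norm_num)]
        linarith
  have hlog : 64 * ((2 * q : ℕ) : ℝ) * (1 + Real.log (2 * q : ℕ)) ≤ N := by
    refine le_trans ?_ hN
    have h2 : ((2 * q : ℕ) : ℝ) ≤ 2 * C * (N : ℝ) ^ ((d : ℝ) / (d + 1)) := by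
      push_cast
      linarith
    have h3 : (1 : ℝ) ≤ (2 * q : ℕ) := by exact_mod_cast (by omega : 1 ≤ 2 * q)
    have := Real.log_nonneg h3
    gcongr
  have hb : ∀ j, 1 / √(32 * C) * (N : ℝ) ^ (1 - (d : ℝ) / (d + 1) / 2) ≤
      ‖quadSum N (x j) (1 / (4 * q))‖ := by
    intro j
    rw [← pow_le_pow_iff_left₀ (by positivity) (by positivity) two_ne_zero]
    refine le_trans ?_ (norm_sq_quadSum_ge hq (hclose j) hlog)
    have h1 : ((N : ℝ) ^ (1 - (d : ℝ) / (d + 1) / 2)) ^ 2 =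
        (N : ℝ) ^ 2 / (N : ℝ) ^ ((d : ℝ) / (d + 1)) := by
      rw [← Real.rpow_natCast, ← Real.rpow_mul hN0.le, ← Real.rpow_natCast (N : ℝ) 2,
        ← Real.rpow_sub hN0]
      congr 1
      push_cast
      ring
    rw [mul_pow, h1, div_pow, Real.sq_sqrt (by positivity), one_pow, div_mul_div_comm, one_mul]
    apply div_le_div_of_nonneg_left (by positivity) (by positivity)
    linarith
  have ht : (1 / (4 * q) : ℝ) ∈ Set.Ioo (0 : ℝ) 1 := by
    refine ⟨by positivity, ?_⟩
    rw [div_lt_one (by positivity)]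
    linarith
  refine le_trans (le_of_eq ?_) (pow_le_iSup_norm_wSum ht (by positivity) hb)
  rw [mul_pow, ← Real.rpow_natCast ((N : ℝ) ^ _) d, ← Real.rpow_mul hN0.le]
  congr 2
  field_simp
  ring

/-- The set for bounded `N`: a cube at the origin. -/
lemma exists_set_of_small (d : ℕ) {N : ℕ} (hN1 : 1 ≤ N) :
    ∃ E : Set (Fin d → ℝ), E ⊆ Set.Icc (0 : Fin d → ℝ) 1 ∧ MeasurableSet E ∧
      (1 / (12 * (N : ℝ))) ^ d ≤ (volume E).toReal ∧
      ∀ x ∈ E, (1 / 2) ^ d * (N : ℝ) ^ ((d : ℝ) / 2 + (d : ℝ) / (2 * ((d : ℝ) + 1))) ≤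
        ⨆ t ∈ Set.Ioo (0 : ℝ) 1, ‖wSum d N x t‖ := by
  have hN1' : (1 : ℝ) ≤ N := by exact_mod_cast hN1
  refine ⟨Set.Icc 0 (fun _ => 1 / (12 * (N : ℝ))), Set.Icc_subset_Icc_right fun j => ?_,
    measurableSet_Icc, ?_, fun x hx => ?_⟩
  · show 1 / (12 * (N : ℝ)) ≤ 1
    rw [div_le_one (by positivity)]
    linarith
  · rw [Real.volume_Icc_pi_toReal fun j => by show (0 : ℝ) ≤ 1 / (12 * (N : ℝ)); positivity]
    simp
  · have ht : (1 / (12 * (N : ℝ) ^ 2)) ∈ Set.Ioo (0 : ℝ) 1 := by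
      refine ⟨by positivity, ?_⟩
      rw [div_lt_one (by positivity)]
      nlinarith
    refine le_trans ?_ (pow_le_iSup_norm_wSum ht (by positivity)
      fun j => half_le_norm_quadSum hN1 (hx.1 j) (hx.2 j))
    rw [show (N : ℝ) / 2 = 1 / 2 * N by ring, mul_pow, ← Real.rpow_natCast (N : ℝ) d]
    gcongr
    have : (d : ℝ) / (2 * (d + 1)) ≤ d / 2 := by gcongr; linarith [d.cast_nonneg (α := ℝ)]
    linarith

/-- A set of positive measure on which the maximal Weyl sum is at least
`N^{d/2 + d/(2(d+1))}`. -/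
theorem stmt8 (d : ℕ) (hd : 1 ≤ d) :
    ∃ c > (0 : ℝ), ∃ c' > (0 : ℝ), ∀ N : ℕ, 1 ≤ N →
      ∃ E : Set (Fin d → ℝ), E ⊆ Set.Icc (0 : Fin d → ℝ) 1 ∧ MeasurableSet E ∧
        c ≤ (volume E).toReal ∧
        ∀ x ∈ E, c' * (N : ℝ) ^ ((d : ℝ) / 2 + (d : ℝ) / (2 * ((d : ℝ) + 1))) ≤
          ⨆ t ∈ Set.Ioo (0 : ℝ) 1, ‖wSum d N x t‖ := by
  obtain ⟨C, hC⟩ : ∃ C : ℝ, C = (2 * (12 * 4 ^ d)) ^ d := ⟨_, rfl⟩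
  have hC0 : 0 < C := by rw [hC]; positivity
  have hθ : (d : ℝ) / (d + 1) < 1 := by rw [div_lt_one (by positivity)]; linarith
  obtain ⟨N₀, hN₀⟩ := Filter.eventually_atTop.mp
    (eventually_mul_log_le (by positivity : 0 < 2 * C) hθ)
  refine ⟨min (1 / 2) ((1 / (12 * ((N₀ : ℝ) + 1))) ^ d), by positivity,
    min ((1 / √(32 * C)) ^ d) ((1 / 2) ^ d), by positivity, fun N hN => ?_⟩
  rcases le_total N₀ N with h | h
  · obtain ⟨E, hE, hmeas, hvol, hlow⟩ := exists_set_of_large hC hN (hN₀ N h)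
    refine ⟨E, hE, hmeas, (min_le_left _ _).trans hvol, fun x hx => le_trans ?_ (hlow x hx)⟩
    gcongr
    exact min_le_left _ _
  · obtain ⟨E, hE, hmeas, hvol, hlow⟩ := exists_set_of_small d hN
    refine ⟨E, hE, hmeas, (min_le_right _ _).trans (le_trans ?_ hvol),
      fun x hx => le_trans ?_ (hlow x hx)⟩
    · have hN' : (0 : ℝ) < N := by exact_mod_cast hN
      have h' : (N : ℝ) ≤ N₀ := by exact_mod_cast h
      gcongr
      linarith
    · gcongr
      exact min_le_right _ _
end
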